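/- Let μ ∈ ℂ³ with μ₁+μ₂+μ₃ = 0, Re(μ_i) = 0 for all i, and μ₁ ≠ μ₂, and let y = (y₁,y₂) with y₁ > 0 and y₂ < 0. Then K¹_{w_l}(y,μ)/(8|y₁y₂|) = 𝒥₂⁻(y,μ^{w₅}) − 𝒥₃(y,μ^{w₅}) + 𝒥₄(y,μ^{w₅}). -/

import Mathlib

open MeasureTheory
/-- The GL(3) long-element power-series Bessel function `J_{w_l}(y,μ)`. -/
noncomputable def Jwl (y₁ y₂ : ℝ) (μ₁ μ₂ μ₃ : ℂ) : ℂ :=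
  ((|4 * Real.pi ^ 2 * y₁| : ℝ) : ℂ) ^ (1 - μ₃) *
    ((|4 * Real.pi ^ 2 * y₂| : ℝ) : ℂ) ^ (1 + μ₁) *
    ∑' n : ℕ × ℕ,
      Complex.Gamma ((n.1 : ℂ) + (n.2 : ℂ) + μ₁ - μ₃ + 1) *
          ((4 * Real.pi ^ 2 * y₁ : ℝ) : ℂ) ^ n.1 * ((4 * Real.pi ^ 2 * y₂ : ℝ) : ℂ) ^ n.2 /
        (Complex.Gamma ((n.1 : ℂ) + μ₁ - μ₃ + 1) * Complex.Gamma ((n.2 : ℂ) + μ₁ - μ₁ + 1) *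
          Complex.Gamma ((n.1 : ℂ) + μ₂ - μ₃ + 1) * Complex.Gamma ((n.2 : ℂ) + μ₁ - μ₂ + 1) *
          Complex.Gamma ((n.1 : ℂ) + μ₃ - μ₃ + 1) * Complex.Gamma ((n.2 : ℂ) + μ₁ - μ₃ + 1))

/-- `J^{ε₁,ε₂}_{w_l}(y,μ) = ε₂J_{w_l}(y,μ) + ε₁J_{w_l}(y,μ^{w₄}) + ε₁ε₂J_{w_l}(y,μ^{w₅})`. -/
noncomputable def Jsign (e₁ e₂ : ℂ) (y₁ y₂ : ℝ) (μ₁ μ₂ μ₃ : ℂ) : ℂ :=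
  e₂ * Jwl y₁ y₂ μ₁ μ₂ μ₃ + e₁ * Jwl y₁ y₂ μ₃ μ₁ μ₂ + e₁ * e₂ * Jwl y₁ y₂ μ₂ μ₃ μ₁

/-- The weight-zero GL(3) long-element Bessel function `K⁰_{w_l}(y,μ)`. -/
noncomputable def K0wl (y₁ y₂ : ℝ) (μ₁ μ₂ μ₃ : ℂ) : ℂ :=
  -(1 / (16 * (Real.pi : ℂ))) *
    ((Jsign 1 1 y₁ y₂ μ₁ μ₂ μ₃ - Jsign 1 1 y₁ y₂ μ₂ μ₁ μ₃) /
      (Complex.sin ((Real.pi : ℂ) / 2 * (μ₁ - μ₂)) *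
        Complex.sin ((Real.pi : ℂ) / 2 * (μ₁ - μ₃)) *
        Complex.sin ((Real.pi : ℂ) / 2 * (μ₂ - μ₃))))

/-- The weight-one GL(3) long-element Bessel function `K¹_{w_l}(y,μ)`, with
`(ε₁,ε₂) = (sgn y₁, sgn y₂)`. -/
noncomputable def K1wl (y₁ y₂ : ℝ) (μ₁ μ₂ μ₃ : ℂ) : ℂ :=
  -(1 / (16 * (Real.pi : ℂ))) *
    ((Jsign ((Real.sign y₁ : ℝ) : ℂ) ((Real.sign y₂ : ℝ) : ℂ) y₁ y₂ μ₁ μ₂ μ₃ -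
        Jsign ((Real.sign y₁ : ℝ) : ℂ) ((Real.sign y₂ : ℝ) : ℂ) y₁ y₂ μ₂ μ₁ μ₃) /
      (Complex.cos ((Real.pi : ℂ) / 2 * (μ₁ - μ₃)) *
        Complex.cos ((Real.pi : ℂ) / 2 * (μ₂ - μ₃)) *
        Complex.sin ((Real.pi : ℂ) / 2 * (μ₁ - μ₂))))
/-- The classical Bessel function `J_ν(x) = Σ_{k≥0} (−1)^k (x/2)^{ν+2k}/(k! Γ(ν+k+1))`. -/
noncomputable def besselJ (ν : ℂ) (x : ℝ) : ℂ :=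
  ∑' k : ℕ, (-1 : ℂ) ^ k * ((x / 2 : ℝ) : ℂ) ^ (ν + 2 * (k : ℂ)) /
    ((Nat.factorial k : ℂ) * Complex.Gamma (ν + (k : ℂ) + 1))

/-- `J⁺_ν(x) = (π/2)(J_ν(2x)+J_{−ν}(2x))/cos(πν/2)`. -/
noncomputable def Jplus (ν : ℂ) (x : ℝ) : ℂ :=
  ((Real.pi : ℂ) / 2) * (besselJ ν (2 * x) + besselJ (-ν) (2 * x)) /
    Complex.cos ((Real.pi : ℂ) * ν / 2)

/-- `J⁻_ν(x) = (π/2)(J_{−ν}(2x)−J_ν(2x))/sin(πν/2)`. -/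
noncomputable def Jminus (ν : ℂ) (x : ℝ) : ℂ :=
  ((Real.pi : ℂ) / 2) * (besselJ (-ν) (2 * x) - besselJ ν (2 * x)) /
    Complex.sin ((Real.pi : ℂ) * ν / 2)

/-- `K̃_ν(x) = 2cos(πν/2)·K_ν(2x)`, with `K_ν(2x) = ∫_0^∞ e^{−2x cosh t} cosh(νt) dt`. -/
noncomputable def Ktilde (ν : ℂ) (x : ℝ) : ℂ :=
  2 * Complex.cos ((Real.pi : ℂ) * ν / 2) *
    ∫ t in Set.Ioi (0 : ℝ),
      ((Real.exp (-2 * x * Real.cosh t) : ℝ) : ℂ) * Complex.cosh (ν * (t : ℂ))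

/-- `𝒥₁⁺(y,μ)`. -/
noncomputable def calJ1plus (y₁ y₂ : ℝ) (μ₁ μ₂ μ₃ : ℂ) : ℂ :=
  ((|y₁ / y₂| : ℝ) : ℂ) ^ (μ₂ / 2) *
    ∫ u in Set.Ioi (0 : ℝ),
      Jplus (μ₃ - μ₁) (2 * Real.pi * Real.sqrt |y₁| * Real.sqrt (1 + u ^ 2)) *
        Jplus (μ₃ - μ₁) (2 * Real.pi * Real.sqrt |y₂| * Real.sqrt (1 + (1 / u) ^ 2)) *
        ((u : ℂ) ^ (3 * μ₂) / (u : ℂ))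

/-- `𝒥₂⁻(y,μ)`. -/
noncomputable def calJ2minus (y₁ y₂ : ℝ) (μ₁ μ₂ μ₃ : ℂ) : ℂ :=
  ((|y₁ / y₂| : ℝ) : ℂ) ^ (μ₂ / 2) *
    ∫ u in Set.Ioi (1 : ℝ),
      Jminus (μ₃ - μ₁) (2 * Real.pi * Real.sqrt |y₁| * Real.sqrt (u ^ 2 - 1)) *
        Jminus (μ₃ - μ₁) (2 * Real.pi * Real.sqrt |y₂| * Real.sqrt (1 - (1 / u) ^ 2)) *
        ((u : ℂ) ^ (3 * μ₂) / (u : ℂ))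

/-- `𝒥₃(y,μ)`. -/
noncomputable def calJ3 (y₁ y₂ : ℝ) (μ₁ μ₂ μ₃ : ℂ) : ℂ :=
  ((|y₁ / y₂| : ℝ) : ℂ) ^ (μ₂ / 2) *
    ∫ u in Set.Ioi (0 : ℝ),
      Ktilde (μ₃ - μ₁) (2 * Real.pi * Real.sqrt |y₁| * Real.sqrt (1 + u ^ 2)) *
        Jminus (μ₃ - μ₁) (2 * Real.pi * Real.sqrt |y₂| * Real.sqrt (1 + (1 / u) ^ 2)) *
        ((u : ℂ) ^ (3 * μ₂) / (u : ℂ))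

/-- `𝒥₄(y,μ)`. -/
noncomputable def calJ4 (y₁ y₂ : ℝ) (μ₁ μ₂ μ₃ : ℂ) : ℂ :=
  ((|y₁ / y₂| : ℝ) : ℂ) ^ (μ₂ / 2) *
    ∫ u in Set.Ioo (0 : ℝ) 1,
      Ktilde (μ₃ - μ₁) (2 * Real.pi * Real.sqrt |y₁| * Real.sqrt (1 - u ^ 2)) *
        Ktilde (μ₃ - μ₁) (2 * Real.pi * Real.sqrt |y₂| * Real.sqrt ((1 / u) ^ 2 - 1)) *
        ((u : ℂ) ^ (3 * μ₂) / (u : ℂ))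

section

open Set Filter Topology

/-- The Mellin transform of a function with expansion `∑ p i * x ^ α i` on `(0, x₀]`,
regularised at `0`. -/
noncomputable def regMellin {ι : Type*} (p α : ι → ℂ) (f : ℝ → ℂ) (x₀ : ℝ) (s : ℂ) : ℂ :=
  ∑' i, p i * (x₀ : ℂ) ^ (s + α i) / (s + α i) + ∫ x in Ioi x₀, (x : ℂ) ^ (s - 1) * f x

lemma integrableOn_Ioc_cpow {s : ℂ} (hs : 0 < s.re) {a : ℝ} (ha : 0 < a) :
    IntegrableOn (fun x : ℝ => (x : ℂ) ^ (s - 1)) (Ioc 0 a) := by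
  rw [← intervalIntegrable_iff_integrableOn_Ioc_of_le ha.le]
  exact intervalIntegral.intervalIntegrable_cpow' (by simpa using hs)

lemma integral_Ioc_cpow {s : ℂ} (hs : 0 < s.re) {a : ℝ} (ha : 0 < a) :
    ∫ x in Ioc 0 a, (x : ℂ) ^ (s - 1) = (a : ℂ) ^ s / s := by
  have hs0 : s ≠ 0 := by rintro rfl; simp at hs
  rw [← intervalIntegral.integral_of_le ha.le, integral_cpow (Or.inl (by simpa using hs))]
  simp [Complex.zero_cpow hs0]

lemma integral_Ioc_rpow {r : ℝ} (hr : 0 < r) {a : ℝ} (ha : 0 < a) :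
    ∫ x in Ioc 0 a, x ^ (r - 1) = a ^ r / r := by
  rw [← intervalIntegral.integral_of_le ha.le, integral_rpow (Or.inl (by linarith))]
  simp [Real.zero_rpow hr.ne']

lemma integral_Ioc_norm_cpow {s : ℂ} (hs : 0 < s.re) {a : ℝ} (ha : 0 < a) :
    ∫ x in Ioc 0 a, ‖(x : ℂ) ^ (s - 1)‖ = a ^ s.re / s.re := by
  rw [← integral_Ioc_rpow hs ha]
  refine setIntegral_congr_fun measurableSet_Ioc fun x hx => ?_
  simp [Complex.norm_cpow_eq_rpow_re_of_pos hx.1]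

section Continuation

variable {ι : Type*} [Countable ι] {p α : ι → ℂ} {f : ℝ → ℂ} {x₀ : ℝ}

lemma hasSum_integral_Ioc_cpow_mul (hx₀ : 0 < x₀) (hα : ∀ i, 0 ≤ (α i).re)
    (hp : Summable fun i => ‖p i‖ * x₀ ^ (α i).re)
    (hf : ∀ x, 0 < x → x ≤ x₀ → HasSum (fun i => p i * (x : ℂ) ^ α i) (f x))
    {s : ℂ} (hs : 0 < s.re) :
    HasSum (fun i => p i * (x₀ : ℂ) ^ (s + α i) / (s + α i))
      (∫ x in Ioc 0 x₀, (x : ℂ) ^ (s - 1) * f x) := by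
  have hpos : ∀ i, 0 < (s + α i).re := fun i => by
    have := hα i
    simp only [Complex.add_re]; linarith
  have key := hasSum_integral_of_summable_integral_norm (μ := volume.restrict (Ioc 0 x₀))
    (F := fun i (x : ℝ) => p i * (x : ℂ) ^ (s + α i - 1))
    (fun i => (integrableOn_Ioc_cpow (hpos i) hx₀).const_mul _) ?_
  · convert! key using 1
    · funext i
      rw [integral_const_mul, integral_Ioc_cpow (hpos i) hx₀, mul_div_assoc]
    · refine setIntegral_congr_fun measurableSet_Ioc fun x hx => ?_
      have hx0 : (x : ℂ) ≠ 0 := by exact_mod_cast hx.1.ne'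
      change _ = ∑' i, p i * (x : ℂ) ^ (s + α i - 1)
      rw [← (hf x hx.1 hx.2).tsum_eq, ← tsum_mul_left]
      congr 1; funext i
      rw [show s + α i - 1 = (s - 1) + α i by ring, Complex.cpow_add _ _ hx0]
      ring
  · have : ∀ i, ∫ x in Ioc 0 x₀, ‖p i * (x : ℂ) ^ (s + α i - 1)‖
        = ‖p i‖ * (x₀ ^ (s + α i).re / (s + α i).re) := fun i => by
      simp_rw [norm_mul]
      rw [integral_const_mul, integral_Ioc_norm_cpow (hpos i) hx₀]
    simp_rw [this]
    refine Summable.of_nonneg_of_le (fun i => ?_) (fun i => ?_)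
      (hp.mul_left (x₀ ^ s.re / s.re))
    · have := (hpos i).le; positivity
    · rw [Complex.add_re, Real.rpow_add hx₀]
      have h1 : x₀ ^ s.re * x₀ ^ (α i).re / (s.re + (α i).re)
          ≤ x₀ ^ s.re * x₀ ^ (α i).re / s.re := by
        gcongr
        linarith [hα i]
      calc _ ≤ ‖p i‖ * (x₀ ^ s.re * x₀ ^ (α i).re / s.re) := by gcongr
        _ = _ := by ring

lemma regMellin_eq_mellin (hx₀ : 0 < x₀) (hα : ∀ i, 0 ≤ (α i).re)
    (hp : Summable fun i => ‖p i‖ * x₀ ^ (α i).re)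
    (hf : ∀ x, 0 < x → x ≤ x₀ → HasSum (fun i => p i * (x : ℂ) ^ α i) (f x))
    {s : ℂ} (hs : 0 < s.re) (hconv : MellinConvergent f s) :
    regMellin p α f x₀ s = mellin f s := by
  rw [regMellin, (hasSum_integral_Ioc_cpow_mul hx₀ hα hp hf hs).tsum_eq, mellin,
    ← Ioc_union_Ioi_eq_Ioi hx₀.le, setIntegral_union (Ioc_disjoint_Ioi le_rfl) measurableSet_Ioi]
  · rfl
  · exact hconv.mono_set Ioc_subset_Ioi_self
  · exact hconv.mono_set (Ioi_subset_Ioi hx₀.le)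

/-- The regularised Mellin transform is the analytic continuation of the Mellin transform. -/
theorem regMellin_eq_of_mellin (hx₀ : 0 < x₀) (hα : ∀ i, 0 ≤ (α i).re)
    (hp : Summable fun i => ‖p i‖ * x₀ ^ (α i).re)
    (hf : ∀ x, 0 < x → x ≤ x₀ → HasSum (fun i => p i * (x : ℂ) ^ α i) (f x))
    {C δ ε : ℝ} (hfc : ContinuousOn f (Ioi 0))
    (hC : ∀ x, x₀ < x → ‖f x‖ ≤ C * x ^ (-δ))
    {D : Set ℂ} (hDo : IsOpen D) (hDc : Convex ℝ D) (hDδ : ∀ s ∈ D, s.re < δ)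
    (hε : 0 < ε) (hDε : ∀ s ∈ D, ∀ i, ε ≤ ‖s + α i‖)
    {φ : ℂ → ℂ} (hφ : DifferentiableOn ℂ φ D) (hpos : ∃ s ∈ D, 0 < s.re)
    (hM : ∀ s ∈ D, 0 < s.re → MellinConvergent f s ∧ mellin f s = φ s) {s : ℂ} (hs : s ∈ D) :
    regMellin p α f x₀ s = φ s := by
  have hx0c : (x₀ : ℂ) ≠ 0 := by exact_mod_cast hx₀.ne'
  have hfm : AEStronglyMeasurable f (volume.restrict (Ioi x₀)) :=
    (hfc.mono (Ioi_subset_Ioi hx₀.le)).aestronglyMeasurable measurableSet_Ioi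
  have hd1 : DifferentiableOn ℂ (fun s => ∑' i, p i * (x₀ : ℂ) ^ α i / (s + α i)) D := by
    refine Complex.differentiableOn_tsum_of_summable_norm (hp.div_const ε) (fun i => ?_) hDo
      fun i w hw => ?_
    · intro w hw
      have : w + α i ≠ 0 := norm_pos_iff.1 (hε.trans_le (hDε w hw i))
      fun_prop (disch := assumption)
    · rw [norm_div, norm_mul, Complex.norm_cpow_eq_rpow_re_of_pos hx₀]
      gcongr
      exact hDε w hw i
  have hd2 : DifferentiableOn ℂ (fun s => ∫ x in Ioi x₀, (x : ℂ) ^ (s - 1) * f x) D := by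
    have hm : ∀ s, mellin ((Ioi x₀).indicator f) s = ∫ x in Ioi x₀, (x : ℂ) ^ (s - 1) * f x := by
      intro s
      rw [mellin, ← integral_indicator measurableSet_Ioi, ← integral_indicator measurableSet_Ioi]
      congr 1; funext x
      by_cases h : x₀ < x
      · simp [indicator, h, hx₀.trans h]
      · simp [indicator, h]
    simp_rw [← hm]
    intro s hs
    refine DifferentiableAt.differentiableWithinAt ?_
    refine mellin_differentiableAt_of_isBigO_rpow (a := δ) (b := s.re - 1) ?_ ?_ (hDδ s hs) ?_
      (by linarith)
    · intro x hx
      obtain ⟨t, ht, hi⟩ := hfc.locallyIntegrableOn (μ := volume) measurableSet_Ioi x hx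
      exact ⟨t, ht, hi.indicator measurableSet_Ioi⟩
    · refine Asymptotics.IsBigO.of_bound C ?_
      filter_upwards [eventually_gt_atTop x₀] with x hx
      have := hC x hx
      rw [indicator_of_mem (show x ∈ Ioi x₀ from hx)]
      rwa [Real.norm_of_nonneg (Real.rpow_nonneg (hx₀.trans hx).le _)]
    · refine Asymptotics.IsBigO.of_bound 0 ?_
      filter_upwards [Ioo_mem_nhdsGT hx₀] with x hx
      simp [indicator, not_lt.2 hx.2.le]
  have heq : ∀ s, regMellin p α f x₀ s = (x₀ : ℂ) ^ s * (∑' i, p i * (x₀ : ℂ) ^ α i / (s + α i)) +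
      ∫ x in Ioi x₀, (x : ℂ) ^ (s - 1) * f x := by
    intro s
    rw [regMellin, ← tsum_mul_left]
    congr 2; funext i
    rw [Complex.cpow_add _ _ hx0c]; ring
  have hd : DifferentiableOn ℂ (regMellin p α f x₀) D := by
    rw [show regMellin p α f x₀ = _ from funext heq]
    refine DifferentiableOn.add (DifferentiableOn.mul ?_ hd1) hd2
    intro w hw
    exact (DifferentiableAt.const_cpow differentiableAt_id (Or.inl hx0c)).differentiableWithinAt
  obtain ⟨z₀, hz₀, hz₀p⟩ := hpos
  refine (hd.analyticOnNhd hDo).eqOn_of_preconnected_of_eventuallyEq (hφ.analyticOnNhd hDo)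
    hDc.isPreconnected hz₀ ?_ hs
  have h1 : ∀ᶠ z in 𝓝 z₀, 0 < z.re :=
    (Complex.continuous_re.tendsto z₀).eventually (lt_mem_nhds hz₀p)
  filter_upwards [h1, hDo.mem_nhds hz₀] with z hz hzD
  rw [← (hM z hzD hz).2]
  exact regMellin_eq_mellin hx₀ hα hp hf hz (hM z hzD hz).1

end Continuation

lemma setIntegral_comp_inv_cpow {f : ℝ → ℂ} {x₀ : ℝ} (hx₀ : 0 < x₀) (s : ℂ) :
    ∫ x in Ioc 0 x₀, (x : ℂ) ^ (s - 1) * f x⁻¹ = ∫ x in Ioi x₀⁻¹, (x : ℂ) ^ (-s - 1) * f x := by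
  have h1 := mellin_comp_inv ((Ioi x₀⁻¹).indicator f) s
  have h2 : ∀ s, mellin ((Ioi x₀⁻¹).indicator f) s
      = ∫ x in Ioi x₀⁻¹, (x : ℂ) ^ (s - 1) * f x := by
    intro s
    rw [mellin, ← integral_indicator measurableSet_Ioi, ← integral_indicator measurableSet_Ioi]
    congr 1; funext x
    by_cases h : x₀⁻¹ < x
    · simp [indicator, h, (inv_pos.2 hx₀).trans h]
    · simp [indicator, h]
  rw [← h2, ← h1, mellin, integral_Ioc_eq_integral_Ioo, ← integral_indicator measurableSet_Ioi,
    ← integral_indicator measurableSet_Ioo]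
  congr 1; funext x
  by_cases h : 0 < x
  · by_cases h' : x < x₀
    · have : x₀⁻¹ < x⁻¹ := by gcongr
      simp [indicator, h, h', this]
    · have : ¬ x₀⁻¹ < x⁻¹ := by
        rw [inv_lt_inv₀ hx₀ h]; exact h'
      simp [indicator, h, h', this]
  · simp [indicator, h]

section Convolution

variable {ι J : Type*} [Countable ι] [Countable J] {p α : ι → ℂ} {f : ℝ → ℂ} {x₀ : ℝ}
  {q : J → ℂ} {g : J → ℕ → ℂ} {G : J → ℝ → ℂ} {h : ℝ → ℂ} {c : ℂ}

/-- The part of a multiplicative convolution near `0`, expanded with the series of `h`. -/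
lemma hasSum_setIntegral_Ioc_conv (hx₀ : 0 < x₀) {C δ : ℝ} (hδ : 0 < δ)
    (hfc : ContinuousOn f (Ioi 0)) (hC : ∀ x, 0 < x → ‖f x‖ ≤ C * x ^ (-δ)) (hc : c.re = 0)
    (hg : Summable fun jk : J × ℕ => ‖q jk.1‖ * ‖g jk.1 jk.2‖ * x₀ ^ jk.2)
    (hG : ∀ j, ∀ x, 0 < x → x ≤ x₀ → HasSum (fun k : ℕ => g j k * (x : ℂ) ^ (k - c)) (G j x))
    (hh : ∀ x, 0 < x → x ≤ x₀ → HasSum (fun j => q j * G j x) (h x)) :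
    HasSum (fun jk : J × ℕ => q jk.1 * g jk.1 jk.2 *
        ∫ x in Ioi x₀⁻¹, (x : ℂ) ^ (c - jk.2 - 1) * f x)
      (∫ x in Ioc 0 x₀, f x⁻¹ * h x / x) := by
  have hC0 : 0 ≤ C := by
    have := (norm_nonneg _).trans (hC 1 one_pos); simpa using this
  have hbd : ∀ k : ℕ, ∀ x ∈ Ioc 0 x₀, ‖(x : ℂ) ^ ((k : ℂ) - c - 1) * f x⁻¹‖
      ≤ C * x₀ ^ k * x ^ (δ - 1) := by
    intro k x hx
    rw [norm_mul, Complex.norm_cpow_eq_rpow_re_of_pos hx.1]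
    have h1 := hC _ (inv_pos.2 hx.1)
    rw [Real.inv_rpow hx.1.le, Real.rpow_neg hx.1.le, inv_inv] at h1
    have h2 : x ^ ((k : ℂ) - c - 1).re = x ^ k * x ^ (-1 : ℝ) := by
      rw [← Real.rpow_natCast, ← Real.rpow_add hx.1]; simp [hc]; ring_nf
    rw [h2]
    calc _ ≤ x ^ k * x ^ (-1 : ℝ) * (C * x ^ δ) := by
          have := hx.1; gcongr
      _ = C * x ^ k * x ^ (δ - 1) := by
        rw [sub_eq_add_neg, Real.rpow_add hx.1]; ring
      _ ≤ _ := by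
        have := hx.1
        gcongr
        exact hx.2
  have hint : IntegrableOn (fun x : ℝ => x ^ (δ - 1)) (Ioc 0 x₀) := by
    rw [← intervalIntegrable_iff_integrableOn_Ioc_of_le hx₀.le]
    exact intervalIntegral.intervalIntegrable_rpow' (by linarith)
  have hI : ∀ k : ℕ, IntegrableOn (fun x : ℝ => (x : ℂ) ^ ((k : ℂ) - c - 1) * f x⁻¹)
      (Ioc 0 x₀) := by
    intro k
    refine Integrable.mono' (hint.const_mul (C * x₀ ^ k)) ?_ ?_
    · refine ContinuousOn.aestronglyMeasurable (fun x hx => ?_) measurableSet_Ioc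
      refine ContinuousWithinAt.mul (Complex.continuousAt_ofReal_cpow_const _ _
        (Or.inr hx.1.ne')).continuousWithinAt ?_
      have h1 : ContinuousAt f x⁻¹ := hfc.continuousAt (Ioi_mem_nhds (inv_pos.2 hx.1))
      exact (h1.comp (continuousAt_inv₀ hx.1.ne')).continuousWithinAt
    · filter_upwards [ae_restrict_mem measurableSet_Ioc] with x hx using hbd k x hx
  have key := hasSum_integral_of_summable_integral_norm (μ := volume.restrict (Ioc 0 x₀))
    (F := fun (jk : J × ℕ) (x : ℝ) => q jk.1 * g jk.1 jk.2 *
      ((x : ℂ) ^ ((jk.2 : ℂ) - c - 1) * f x⁻¹))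
    (fun jk => (hI jk.2).const_mul _) ?_
  · convert! key using 1
    · funext jk
      rw [integral_const_mul, setIntegral_comp_inv_cpow hx₀]
      ring_nf
    · refine setIntegral_congr_fun measurableSet_Ioc fun x hx => ?_
      have hx0 : (x : ℂ) ≠ 0 := by exact_mod_cast hx.1.ne'
      have hs : Summable fun jk : J × ℕ => q jk.1 * g jk.1 jk.2 * (x : ℂ) ^ ((jk.2 : ℂ) - c) := by
        refine Summable.of_norm_bounded hg fun jk => ?_
        rw [norm_mul, norm_mul, Complex.norm_cpow_eq_rpow_re_of_pos hx.1]
        simp only [Complex.sub_re, Complex.natCast_re, hc, sub_zero, Real.rpow_natCast]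
        have := hx.1
        gcongr
        exact hx.2
      have h1 : HasSum (fun j => q j * G j x)
          (∑' jk : J × ℕ, q jk.1 * g jk.1 jk.2 * (x : ℂ) ^ ((jk.2 : ℂ) - c)) := by
        refine hs.hasSum.prod_fiberwise fun j => ?_
        convert! (hG j x hx.1 hx.2).mul_left (q j) using 2
        ring
      have h2 := (hh x hx.1 hx.2).unique h1
      rw [h2, mul_div_assoc, ← tsum_div_const, ← tsum_mul_left]
      congr 1; funext jk
      rw [Complex.cpow_sub _ 1 hx0, Complex.cpow_one]
      ring
  · refine Summable.of_nonneg_of_le (fun _ => integral_nonneg fun _ => norm_nonneg _)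
      (fun jk => ?_) (hg.mul_right (C * ∫ x in Ioc 0 x₀, x ^ (δ - 1)))
    simp_rw [norm_mul (q _ * g _ _)]
    rw [integral_const_mul, norm_mul]
    calc _ ≤ ‖q jk.1‖ * ‖g jk.1 jk.2‖ * ∫ x in Ioc 0 x₀, C * x₀ ^ jk.2 * x ^ (δ - 1) := by
          refine mul_le_mul_of_nonneg_left ?_ (by positivity)
          exact setIntegral_mono_on (hI _).norm (hint.const_mul _) measurableSet_Ioc fun x hx =>
            hbd _ x hx
      _ = _ := by rw [integral_const_mul]; ring

/-- The part of a multiplicative convolution near `∞`, expanded with the series of `f`. -/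
lemma hasSum_setIntegral_Ioi_conv (hx₀ : 0 < x₀) (hα : ∀ i, 0 ≤ (α i).re)
    (hp : Summable fun i => ‖p i‖ * x₀⁻¹ ^ (α i).re)
    (hf : ∀ x : ℝ, 0 < x → HasSum (fun i => p i * (x : ℂ) ^ α i) (f x))
    (hGi : ∀ j, IntegrableOn (fun x => G j x / x) (Ioi x₀))
    (hGs : Summable fun j => ‖q j‖ * ∫ x in Ioi x₀, ‖G j x / x‖)
    (hh : ∀ x, x₀ < x → HasSum (fun j => q j * G j x) (h x)) :
    HasSum (fun ji : J × ι => q ji.1 * p ji.2 *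
        ∫ x in Ioi x₀, (x : ℂ) ^ (-α ji.2 - 1) * G ji.1 x)
      (∫ x in Ioi x₀, f x⁻¹ * h x / x) := by
  have hb : ∀ i, ∀ x, x₀ < x → ‖(x : ℂ) ^ (-α i)‖ ≤ x₀⁻¹ ^ (α i).re := by
    intro i x hx
    have hx0 := hx₀.trans hx
    rw [Complex.norm_cpow_eq_rpow_re_of_pos hx0, Complex.neg_re, Real.rpow_neg hx0.le,
      ← Real.inv_rpow hx0.le]
    exact Real.rpow_le_rpow (by positivity) (by gcongr) (hα i)
  have hI : ∀ j i, IntegrableOn (fun x : ℝ => (x : ℂ) ^ (-α i) * (G j x / x)) (Ioi x₀) := by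
    intro j i
    refine Integrable.bdd_mul (c := x₀⁻¹ ^ (α i).re) (hGi j) ?_ ?_
    · refine ContinuousOn.aestronglyMeasurable (fun x hx => ?_) measurableSet_Ioi
      exact (Complex.continuousAt_ofReal_cpow_const _ _
        (Or.inr (hx₀.trans hx).ne')).continuousWithinAt
    · filter_upwards [ae_restrict_mem measurableSet_Ioi] with x hx using hb i x hx
  have hsum := hGs.mul_of_nonneg hp (fun _ => mul_nonneg (norm_nonneg _)
    (integral_nonneg fun _ => norm_nonneg _)) (fun i => by positivity)
  have key := hasSum_integral_of_summable_integral_norm (μ := volume.restrict (Ioi x₀))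
    (F := fun (ji : J × ι) (x : ℝ) => q ji.1 * p ji.2 *
      ((x : ℂ) ^ (-α ji.2) * (G ji.1 x / x)))
    (fun ji => (hI ji.1 ji.2).const_mul _) ?_
  · convert! key using 1
    · funext ji
      rw [integral_const_mul]
      congr 1
      refine setIntegral_congr_fun measurableSet_Ioi fun x hx => ?_
      have hx0 : (x : ℂ) ≠ 0 := by exact_mod_cast (hx₀.trans hx).ne'
      rw [Complex.cpow_sub _ _ hx0, Complex.cpow_one]
      ring
    · refine setIntegral_congr_fun measurableSet_Ioi fun x hx => ?_
      have hx0 : 0 < x := hx₀.trans hx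
      have h1 := hf x⁻¹ (inv_pos.2 hx0)
      have h1' : Summable fun i => ‖p i * ((x⁻¹ : ℝ) : ℂ) ^ α i‖ := h1.summable.norm
      have h2 : Summable fun j => ‖q j * G j x‖ := (hh x hx).summable.norm
      have h3 := tsum_mul_tsum_of_summable_norm h2 h1'
      rw [(hh x hx).tsum_eq, h1.tsum_eq] at h3
      rw [mul_comm (f _), h3, ← tsum_div_const]
      congr 1; funext ji
      rw [Complex.cpow_neg, Complex.ofReal_inv, Complex.inv_cpow _ _
        (by rw [Complex.arg_ofReal_of_nonneg hx0.le]; exact Real.pi_pos.ne)]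
      ring
  · refine Summable.of_nonneg_of_le (fun _ => integral_nonneg fun _ => norm_nonneg _)
      (fun ji => ?_) hsum
    simp_rw [norm_mul (q _ * p _)]
    rw [integral_const_mul, norm_mul]
    calc _ ≤ ‖q ji.1‖ * ‖p ji.2‖ * ∫ x in Ioi x₀, x₀⁻¹ ^ (α ji.2).re * ‖G ji.1 x / x‖ := by
          refine mul_le_mul_of_nonneg_left ?_ (by positivity)
          refine setIntegral_mono_on (hI _ _).norm ((hGi _).norm.const_mul _) measurableSet_Ioi
            fun x hx => ?_
          rw [norm_mul]
          gcongr
          exact hb _ x hx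
      _ = _ := by rw [integral_const_mul]; ring

/-- Expansion of a multiplicative convolution by regularised Mellin transforms. -/
theorem integral_conv_eq (hx₀ : 0 < x₀) (hα : ∀ i, 0 ≤ (α i).re)
    (hp : Summable fun i => ‖p i‖ * x₀⁻¹ ^ (α i).re)
    (hf : ∀ x : ℝ, 0 < x → HasSum (fun i => p i * (x : ℂ) ^ α i) (f x))
    {C δ ε : ℝ} (hδ : 0 < δ) (hfc : ContinuousOn f (Ioi 0))
    (hC : ∀ x, 0 < x → ‖f x‖ ≤ C * x ^ (-δ)) (hc : c.re = 0)
    (hε : 0 < ε) (hcε : ∀ i, ∀ k : ℕ, ε ≤ ‖c - k + α i‖)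
    (hg : Summable fun jk : J × ℕ => ‖q jk.1‖ * ‖g jk.1 jk.2‖ * x₀ ^ jk.2)
    (hG : ∀ j, ∀ x, 0 < x → x ≤ x₀ → HasSum (fun k : ℕ => g j k * (x : ℂ) ^ (k - c)) (G j x))
    (hGi : ∀ j, IntegrableOn (fun x => G j x / x) (Ioi x₀))
    (hGs : Summable fun j => ‖q j‖ * ∫ x in Ioi x₀, ‖G j x / x‖)
    (hh : ∀ x, 0 < x → HasSum (fun j => q j * G j x) (h x))
    (hint : IntegrableOn (fun x => f x⁻¹ * h x / x) (Ioi 0)) :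
    (Summable fun jk : J × ℕ => q jk.1 * g jk.1 jk.2 * regMellin p α f x₀⁻¹ (c - jk.2)) ∧
    (Summable fun ji : J × ι => q ji.1 * p ji.2 *
      regMellin (g ji.1) (fun k => k - c) (G ji.1) x₀ (-α ji.2)) ∧
    ∫ x in Ioi 0, f x⁻¹ * h x / x =
      ∑' jk : J × ℕ, q jk.1 * g jk.1 jk.2 * regMellin p α f x₀⁻¹ (c - jk.2) +
      ∑' ji : J × ι, q ji.1 * p ji.2 *
        regMellin (g ji.1) (fun k => k - c) (G ji.1) x₀ (-α ji.2) := by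
  have hA := hasSum_setIntegral_Ioc_conv hx₀ hδ hfc hC hc hg hG (fun x h _ => hh x h)
  have hB := hasSum_setIntegral_Ioi_conv hx₀ hα hp hf hGi hGs (fun x h => hh x (hx₀.trans h))
  have hx0c : (x₀ : ℂ) ≠ 0 := by exact_mod_cast hx₀.ne'
  have harg : (x₀ : ℂ).arg ≠ Real.pi := by
    rw [Complex.arg_ofReal_of_nonneg hx₀.le]; exact Real.pi_pos.ne
  let t : (J × ℕ) × ι → ℂ := fun a => q a.1.1 * g a.1.1 a.1.2 *
    (p a.2 * ((x₀⁻¹ : ℝ) : ℂ) ^ (c - a.1.2 + α a.2) / (c - a.1.2 + α a.2))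
  have ht : Summable t := by
    refine Summable.of_norm_bounded ((hg.mul_of_nonneg hp (fun _ => by positivity)
      (fun _ => by positivity)).mul_right ε⁻¹) fun a => ?_
    have hxi : 0 < x₀⁻¹ := inv_pos.2 hx₀
    simp only [t]
    rw [norm_mul, norm_div, norm_mul, norm_mul, Complex.norm_cpow_eq_rpow_re_of_pos hxi]
    have h1 : x₀⁻¹ ^ (c - a.1.2 + α a.2).re = x₀ ^ a.1.2 * x₀⁻¹ ^ (α a.2).re := by
      simp only [Complex.add_re, Complex.sub_re, hc, Complex.natCast_re, zero_sub]
      rw [Real.rpow_add hxi, Real.rpow_neg hxi.le, ← Real.inv_rpow hxi.le, inv_inv,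
        Real.rpow_natCast]
    rw [h1]
    calc _ ≤ ‖q a.1.1‖ * ‖g a.1.1 a.1.2‖ * (‖p a.2‖ * (x₀ ^ a.1.2 * x₀⁻¹ ^ (α a.2).re) / ε) := by
          gcongr
          exact hcε _ _
      _ = _ := by ring
  have hT1 : HasSum (fun jk : J × ℕ => q jk.1 * g jk.1 jk.2 *
      ∑' i, p i * ((x₀⁻¹ : ℝ) : ℂ) ^ (c - jk.2 + α i) / (c - jk.2 + α i)) (∑' a, t a) := by
    refine ht.hasSum.prod_fiberwise fun jk => ?_
    have := (ht.prod_factor jk).hasSum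
    convert! this using 1
    rw [← tsum_mul_left]
  let e : (J × ι) × ℕ ≃ (J × ℕ) × ι :=
    ⟨fun a => ((a.1.1, a.2), a.1.2), fun a => ((a.1.1, a.2), a.1.2), fun _ => rfl, fun _ => rfl⟩
  have hT2 : HasSum (fun ji : J × ι => q ji.1 * p ji.2 *
      ∑' k, g ji.1 k * (x₀ : ℂ) ^ (-α ji.2 + (k - c)) / (-α ji.2 + (k - c))) (-∑' a, t a) := by
    have ht' : Summable (fun a => -(t ∘ e) a) := (e.summable_iff.2 ht).neg
    have h1 : -∑' a, t a = ∑' a, -(t ∘ e) a := by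
      rw [tsum_neg]; congr 1; exact (e.tsum_eq t).symm
    rw [h1]
    refine ht'.hasSum.prod_fiberwise fun ji => ?_
    have := (ht'.prod_factor ji).hasSum
    convert! this using 1
    rw [← tsum_mul_left]
    congr 1; funext k
    simp only [t, e, Function.comp, Equiv.coe_fn_mk]
    rw [show -α ji.2 + ((k : ℂ) - c) = -(c - k + α ji.2) by ring, Complex.cpow_neg,
      Complex.ofReal_inv, Complex.inv_cpow _ _ harg, div_neg]
    ring
  have hS1 := hA.add hT1
  have hS2 := hB.add hT2
  have e1 : (fun jk : J × ℕ => q jk.1 * g jk.1 jk.2 * regMellin p α f x₀⁻¹ (c - jk.2)) = fun jk =>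
      q jk.1 * g jk.1 jk.2 * (∫ x in Ioi x₀⁻¹, (x : ℂ) ^ (c - jk.2 - 1) * f x) +
      q jk.1 * g jk.1 jk.2 *
        ∑' i, p i * ((x₀⁻¹ : ℝ) : ℂ) ^ (c - jk.2 + α i) / (c - jk.2 + α i) := by
    funext jk; rw [regMellin]; ring
  have e2 : (fun ji : J × ι => q ji.1 * p ji.2 *
      regMellin (g ji.1) (fun k => k - c) (G ji.1) x₀ (-α ji.2)) = fun ji =>
      q ji.1 * p ji.2 * (∫ x in Ioi x₀, (x : ℂ) ^ (-α ji.2 - 1) * G ji.1 x) +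
      q ji.1 * p ji.2 *
        ∑' k : ℕ, g ji.1 k * (x₀ : ℂ) ^ (-α ji.2 + (k - c)) / (-α ji.2 + (k - c)) := by
    funext ji; rw [regMellin]; ring
  rw [e1, e2]
  refine ⟨hS1.summable, hS2.summable, ?_⟩
  rw [hS1.tsum_eq, hS2.tsum_eq, ← Ioc_union_Ioi_eq_Ioi hx₀.le,
    setIntegral_union (Ioc_disjoint_Ioi le_rfl) measurableSet_Ioi]
  · ring
  · exact hint.mono_set Ioc_subset_Ioi_self
  · exact hint.mono_set (Ioi_subset_Ioi hx₀.le)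

end Convolution

section Binomial

lemma choose_succ_mul_succ (e : ℂ) (k : ℕ) :
    Ring.choose e (k + 1) * (k + 1) = Ring.choose e k * (e - k) := by
  have h := Ring.choose_smul_choose e (Nat.le_succ k)
  simpa [Ring.choose_one_right, mul_comm] using h

lemma succ_mul_choose_succ (e : ℂ) (k : ℕ) :
    ((k : ℂ) + 1) * Ring.choose e (k + 1) = e * Ring.choose (e - 1) k := by
  have h := Ring.choose_smul_choose e (n := k + 1) (k := 1) (by omega)
  simpa [Ring.choose_one_right] using h

lemma norm_choose_le {e : ℂ} {M : ℕ} (h : ‖e‖ ≤ M + 1) (k : ℕ) :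
    ‖Ring.choose e k‖ ≤ (k + M).choose M := by
  induction k with
  | zero => simp
  | succ k ih =>
    have h1 := congrArg norm (choose_succ_mul_succ e k)
    rw [norm_mul, norm_mul, show ((k : ℂ) + 1) = ((k + 1 : ℕ) : ℂ) by push_cast; ring,
      Complex.norm_natCast] at h1
    have h2 : ‖e - k‖ ≤ k + M + 1 := by
      calc _ ≤ ‖e‖ + ‖(k : ℂ)‖ := norm_sub_le _ _
        _ ≤ _ := by rw [Complex.norm_natCast]; linarith
    have h3 : ((k + 1 + M).choose M : ℝ) * ((k + 1 : ℕ) : ℝ)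
        = (k + M).choose M * (k + M + 1) := by
      have h4 := Nat.add_one_mul_choose_eq (k + M) k
      rw [show (k + M).choose M = (k + M).choose k from Nat.choose_symm_add.symm,
        show (k + 1 + M).choose M = (k + 1 + M).choose (k + 1) from Nat.choose_symm_add.symm,
        show k + 1 + M = (k + M).succ by omega]
      have h5 : (((k + M).succ * (k + M).choose k : ℕ) : ℝ)
        = (((k + M).succ.choose k.succ * k.succ : ℕ) : ℝ) := by exact_mod_cast h4
      push_cast at h5 ⊢
      linarith
    have h6 : (0 : ℝ) < ((k + 1 : ℕ) : ℝ) := by positivity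
    refine le_of_mul_le_mul_right ?_ h6
    rw [h1, h3]
    gcongr

lemma summable_norm_choose_mul (e : ℂ) {r : ℝ} (hr0 : 0 ≤ r) (hr : r < 1) :
    Summable fun k => ‖Ring.choose e k‖ * r ^ k := by
  obtain ⟨M, hM⟩ := exists_nat_ge ‖e‖
  refine Summable.of_nonneg_of_le (fun _ => by positivity) (fun k => ?_)
    (summable_choose_mul_geometric_of_norm_lt_one M (r := r)
      (by rwa [Real.norm_of_nonneg hr0]))
  gcongr
  exact norm_choose_le (by linarith) k

lemma tsum_norm_choose_mul_le {e : ℂ} {M : ℕ} (h : ‖e‖ ≤ M + 1) :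
    ∑' k, ‖Ring.choose e k‖ * (1 / 2 : ℝ) ^ k ≤ 2 ^ (M + 1) := by
  have h1 := hasSum_choose_mul_geometric_of_norm_lt_one M (r := (1 / 2 : ℝ)) (by norm_num)
  calc _ ≤ ∑' k, ((k + M).choose M : ℝ) * (1 / 2 : ℝ) ^ k := by
        refine Summable.tsum_le_tsum (fun k => ?_)
          (summable_norm_choose_mul e (by norm_num) (by norm_num)) h1.summable
        gcongr
        exact norm_choose_le h k
    _ = _ := by rw [h1.tsum_eq, show (1 : ℝ) - 1 / 2 = 2⁻¹ by norm_num, inv_pow, one_div, inv_inv]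

lemma summable_norm_mul_choose {J : Type*} {q : J → ℂ} {e : J → ℂ} {n : J → ℕ}
    {M : ℕ} (he : ∀ j, ‖e j‖ ≤ ((n j + M : ℕ) : ℝ) + 1) (hq : Summable fun j => ‖q j‖ * 2 ^ n j) :
    Summable fun jk : J × ℕ => ‖q jk.1‖ * ‖Ring.choose (e jk.1) jk.2‖ * (1 / 2 : ℝ) ^ jk.2 := by
  refine (summable_prod_of_nonneg (fun _ => by positivity)).2 ⟨fun j => ?_, ?_⟩
  · simp_rw [mul_assoc]
    exact (summable_norm_choose_mul _ (by norm_num) (by norm_num)).mul_left _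
  · refine Summable.of_nonneg_of_le (fun _ => tsum_nonneg fun _ => by positivity) (fun j => ?_)
      (hq.mul_right (2 ^ (M + 1)))
    simp_rw [mul_assoc]
    rw [tsum_mul_left]
    calc _ ≤ ‖q j‖ * 2 ^ (n j + M + 1) := by
          gcongr; exact tsum_norm_choose_mul_le (he j)
      _ = _ := by ring

lemma hasSum_one_add_cpow (e : ℂ) {x : ℝ} (h : |x| < 1) :
    HasSum (fun k : ℕ => Ring.choose e k * (x : ℂ) ^ k) ((1 + x : ℂ) ^ e) := by
  have h1 := (Complex.one_add_cpow_hasFPowerSeriesOnBall_zero (a := e)).hasSum (y := (x : ℂ))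
    (by rw [Metric.mem_eball, edist_zero_right, enorm_eq_nnnorm]
        rw [ENNReal.coe_lt_one_iff, ← NNReal.coe_lt_coe]
        simpa using h)
  simp_rw [binomialSeries_apply] at h1
  simpa using h1

lemma hasSum_one_sub_cpow (e : ℂ) {x : ℝ} (h : |x| < 1) :
    HasSum (fun k : ℕ => (-1) ^ k * Ring.choose e k * (x : ℂ) ^ k) ((1 - x : ℂ) ^ e) := by
  have h1 := hasSum_one_add_cpow e (x := -x) (by simpa using h)
  convert! h1 using 1
  · funext k; push_cast; rw [neg_pow (x : ℂ)]; ring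
  · push_cast; ring_nf

lemma neg_one_pow_mul_choose {e : ℂ} (he : ∀ m : ℕ, -e ≠ -m) (k : ℕ) :
    (-1) ^ k * Ring.choose e k = Complex.Gamma (k - e) / (k.factorial * Complex.Gamma (-e)) := by
  have h0 := Complex.Gamma_ne_zero he
  induction k with
  | zero => simp [h0]
  | succ k ih =>
    have hk : (k : ℂ) - e ≠ 0 := fun h => he k (by linear_combination h)
    have h1 := choose_succ_mul_succ e k
    have h2 : (k : ℂ) + 1 ≠ 0 := by exact_mod_cast k.succ_ne_zero
    have h3 : (k.factorial : ℂ) ≠ 0 := by exact_mod_cast k.factorial_ne_zero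
    rw [show ((k + 1 : ℕ) : ℂ) - e = (k - e) + 1 by push_cast; ring,
      Complex.Gamma_add_one _ hk, Nat.factorial_succ]
    have h4 : (-1) ^ (k + 1) * Ring.choose e (k + 1) * (k + 1)
        = (k - e) * ((-1) ^ k * Ring.choose e k) := by
      rw [mul_assoc, h1]; ring
    rw [ih] at h4
    rw [eq_div_iff (by push_cast; positivity)]
    push_cast
    field_simp at h4
    linear_combination h4

end Binomial

section IncompleteBeta

/-- The incomplete beta function at `1/2`, continued in `p`. -/
noncomputable def halfBeta (p q : ℂ) : ℂ :=
  ∑' k : ℕ, (-1) ^ k * Ring.choose (q - 1) k * ((1 / 2 : ℝ) : ℂ) ^ (p + k) / (p + k)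

lemma two_inv_ne_zero : ((1 / 2 : ℝ) : ℂ) ≠ 0 := by norm_num

lemma norm_add_natCast_ge (p : ℂ) (k : ℕ) : |p.im| ≤ ‖p + k‖ := by
  simpa using Complex.abs_im_le_norm (p + k)

lemma summable_halfBeta {p : ℂ} (hp : p.im ≠ 0) (q : ℂ) :
    Summable fun k : ℕ => (-1) ^ k * Ring.choose (q - 1) k * ((1 / 2 : ℝ) : ℂ) ^ (p + k) / (p + k)
    := by
  refine Summable.of_norm_bounded
    ((summable_norm_choose_mul (q - 1) (r := 1 / 2) (by norm_num) (by norm_num)).mul_right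
      ((1 / 2 : ℝ) ^ p.re / |p.im|)) fun k => ?_
  rw [norm_div, norm_mul, norm_mul, norm_pow, norm_neg, norm_one, one_pow, one_mul,
    Complex.norm_cpow_eq_rpow_re_of_pos (by norm_num), Complex.add_re, Complex.natCast_re,
    Real.rpow_add (by norm_num), Real.rpow_natCast]
  have := abs_pos.2 hp
  calc _ ≤ ‖Ring.choose (q - 1) k‖ * ((1 / 2) ^ p.re * (1 / 2) ^ k) / |p.im| := by
        gcongr; exact norm_add_natCast_ge p k
    _ = _ := by ring

lemma add_natCast_ne_zero {p : ℂ} (hp : p.im ≠ 0) (k : ℕ) : p + k ≠ 0 := fun h => hp (by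
  simpa using congrArg Complex.im h)

lemma halfBeta_add_one_right {p : ℂ} (hp : p.im ≠ 0) (q : ℂ) :
    halfBeta p q = halfBeta (p + 1) q + halfBeta p (q + 1) := by
  have h1 := summable_halfBeta hp q
  have h2 := summable_halfBeta (p := p + 1) (by simpa using hp) q
  have h3 := summable_halfBeta hp (q + 1)
  rw [halfBeta, halfBeta, halfBeta, h1.tsum_eq_zero_add, h3.tsum_eq_zero_add]
  have e : ∀ k : ℕ, (-1) ^ (k + 1) * Ring.choose (q + 1 - 1) (k + 1) *
      ((1 / 2 : ℝ) : ℂ) ^ (p + (k + 1 : ℕ)) / (p + (k + 1 : ℕ))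
      = (-1) ^ (k + 1) * Ring.choose (q - 1) (k + 1) *
      ((1 / 2 : ℝ) : ℂ) ^ (p + (k + 1 : ℕ)) / (p + (k + 1 : ℕ)) -
      (-1) ^ k * Ring.choose (q - 1) k * ((1 / 2 : ℝ) : ℂ) ^ (p + 1 + k) / (p + 1 + k) := by
    intro k
    have := Ring.choose_succ_succ (q - 1) k
    rw [show q + 1 - 1 = q - 1 + 1 by ring, this]
    push_cast
    rw [show p + 1 + (k : ℂ) = p + (k + 1) by ring]
    ring
  simp_rw [e]
  rw [((summable_nat_add_iff 1).2 h1).tsum_sub h2]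
  simp only [Ring.choose_zero_right]
  ring

lemma halfBeta_mul_sub {p : ℂ} (hp : p.im ≠ 0) (q : ℂ) :
    p * halfBeta p (q + 1) - q * halfBeta (p + 1) q = ((1 / 2 : ℝ) : ℂ) ^ (p + q) := by
  have h2 := summable_halfBeta (p := p + 1) (by simpa using hp) q
  have h3 := summable_halfBeta hp (q + 1)
  have h5 : HasSum (fun k : ℕ => (-1) ^ k * Ring.choose q k * ((1 / 2 : ℝ) : ℂ) ^ (p + k))
      (((1 / 2 : ℝ) : ℂ) ^ (p + q)) := by
    have := (hasSum_one_sub_cpow q (x := 1 / 2) (by norm_num [abs_lt])).mul_left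
      (((1 / 2 : ℝ) : ℂ) ^ p)
    convert! this using 1
    · funext k
      rw [Complex.cpow_add _ _ two_inv_ne_zero, Complex.cpow_natCast]; ring
    · rw [Complex.cpow_add _ _ two_inv_ne_zero]; congr 2; push_cast; norm_num
  have h6 : HasSum (fun k : ℕ => (-1) ^ k * Ring.choose q k * ((1 / 2 : ℝ) : ℂ) ^ (p + k) *
      ((k : ℂ) / (p + k))) (-(q * halfBeta (p + 1) q)) := by
    rw [← hasSum_nat_add_iff' 1]
    simp only [Finset.range_one, Finset.sum_singleton, Nat.cast_zero, zero_div, mul_zero, sub_zero]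
    have := (h2.hasSum.mul_left q).neg
    convert! this using 1
    funext k
    have h7 := succ_mul_choose_succ q k
    push_cast
    have h8 : p + ((k : ℂ) + 1) ≠ 0 := by exact_mod_cast add_natCast_ne_zero hp (k + 1)
    rw [show p + 1 + (k : ℂ) = p + (k + 1) by ring, pow_succ]
    field_simp
    linear_combination -h7
  have h9 := h5.sub h6
  have h10 := h3.hasSum.mul_left p
  have h11 := h9.unique (by
    convert! h10 using 1
    funext k
    have := add_natCast_ne_zero hp k
    rw [show q + 1 - 1 = q by ring]
    field_simp
    ring)
  rw [halfBeta, ← h11]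
  ring

lemma halfBeta_eq_integral {p : ℂ} (hp : 0 < p.re) (q : ℂ) :
    halfBeta p q = ∫ x in Ioc 0 (1 / 2 : ℝ), (x : ℂ) ^ (p - 1) * (1 - x : ℂ) ^ (q - 1) := by
  have := hasSum_integral_Ioc_cpow_mul (p := fun k : ℕ => (-1) ^ k * Ring.choose (q - 1) k)
    (α := fun k : ℕ => (k : ℂ)) (f := fun x : ℝ => (1 - x : ℂ) ^ (q - 1))
    (x₀ := 1 / 2) (by norm_num) (by simp) (by
      simpa using summable_norm_choose_mul (q - 1) (r := 1 / 2) (by norm_num) (by norm_num))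
    (fun x hx hx' => by
      simpa using hasSum_one_sub_cpow (q - 1) (x := x) (by rw [abs_of_pos hx]; linarith)) hp
  exact this.tsum_eq

lemma halfBeta_add_of_pos {p q : ℂ} (hp : 0 < p.re) (hq : 0 < q.re) :
    halfBeta p q + halfBeta q p = Complex.Gamma p * Complex.Gamma q / Complex.Gamma (p + q) := by
  have hG : Complex.Gamma (p + q) ≠ 0 := Complex.Gamma_ne_zero_of_re_pos (by simp; linarith)
  rw [eq_div_iff hG, Complex.Gamma_mul_Gamma_eq_betaIntegral hp hq, mul_comm,
    halfBeta_eq_integral hp, halfBeta_eq_integral hq, Complex.betaIntegral]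
  congr 1
  have hI := Complex.betaIntegral_convergent hp hq
  rw [← intervalIntegral.integral_add_adjacent_intervals (b := 1 / 2)
    (hI.mono_set (by rw [uIcc_of_le, uIcc_of_le] <;> [apply Icc_subset_Icc; skip; skip] <;> norm_num))
    (hI.mono_set (by rw [uIcc_of_le, uIcc_of_le] <;> [apply Icc_subset_Icc; skip; skip] <;> norm_num))]
  rw [← intervalIntegral.integral_of_le (by norm_num),
    ← intervalIntegral.integral_of_le (by norm_num)]
  congr 1
  have := intervalIntegral.integral_comp_sub_left (a := 0) (b := 1 / 2)
    (fun x : ℝ => (x : ℂ) ^ (p - 1) * (1 - x : ℂ) ^ (q - 1)) 1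
  norm_num at this ⊢
  rw [← this]
  congr 1; funext x; ring

lemma halfBeta_add_swap_succ {p q : ℂ} (hp : p.im ≠ 0) (hq : q.im ≠ 0) :
    halfBeta p q + halfBeta q p = (p + q) / p * (halfBeta (p + 1) q + halfBeta q (p + 1)) := by
  have hp0 : p ≠ 0 := by rintro rfl; simp at hp
  have h1 := halfBeta_add_one_right hp q
  have h2 := halfBeta_add_one_right hq p
  have h3 := halfBeta_mul_sub hp q
  have h4 := halfBeta_mul_sub hq p
  rw [add_comm q p] at h4
  field_simp
  rw [h1, h2]
  linear_combination h3 - h4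

/-- The reflection formula for the continued incomplete beta function. -/
theorem halfBeta_add {p q : ℂ} (hp : p.im ≠ 0) (hq : q.im ≠ 0) :
    halfBeta p q + halfBeta q p = Complex.Gamma p * Complex.Gamma q / Complex.Gamma (p + q) := by
  have step1 : ∀ n : ℕ, ∀ p q : ℂ, p.im ≠ 0 → q.im ≠ 0 → 0 < p.re + n → 0 < q.re →
      halfBeta p q + halfBeta q p
        = Complex.Gamma p * Complex.Gamma q / Complex.Gamma (p + q) := by
    intro n
    induction n with
    | zero =>
      intro p q _ _ h h'
      exact halfBeta_add_of_pos (by simpa using h) h'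
    | succ n ih =>
      intro p q hp hq h h'
      have hp0 : p ≠ 0 := by rintro rfl; simp at hp
      rw [halfBeta_add_swap_succ hp hq, ih (p + 1) q (by simpa using hp) hq
        (by push_cast at h; simp; linarith) h']
      have h1 := Complex.one_div_Gamma_eq_self_mul_one_div_Gamma_add_one (p + q)
      rw [Complex.Gamma_add_one p hp0, show p + 1 + q = p + q + 1 by ring,
        div_eq_mul_inv _ (Complex.Gamma (p + q)), h1]
      field_simp
  have step2 : ∀ n : ℕ, ∀ p q : ℂ, p.im ≠ 0 → q.im ≠ 0 → 0 < q.re + n →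
      halfBeta p q + halfBeta q p
        = Complex.Gamma p * Complex.Gamma q / Complex.Gamma (p + q) := by
    intro n
    induction n with
    | zero =>
      intro p q hp hq h
      obtain ⟨n, hn⟩ := exists_nat_gt (-p.re)
      exact step1 n p q hp hq (by linarith) (by simpa using h)
    | succ n ih =>
      intro p q hp hq h
      have hq0 : q ≠ 0 := by rintro rfl; simp at hq
      rw [add_comm (halfBeta p q), halfBeta_add_swap_succ hq hp, add_comm (halfBeta (q + 1) p),
        ih p (q + 1) hp (by simpa using hq) (by push_cast at h; simp; linarith)]
      have h1 := Complex.one_div_Gamma_eq_self_mul_one_div_Gamma_add_one (p + q)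
      rw [Complex.Gamma_add_one q hq0, show p + (q + 1) = p + q + 1 by ring,
        div_eq_mul_inv _ (Complex.Gamma (p + q)), h1]
      field_simp
      ring
  obtain ⟨n, hn⟩ := exists_nat_gt (-q.re)
  exact step2 n p q hp hq (by linarith)

end IncompleteBeta

/-- `regMellin_eq_of_mellin` on a horizontal strip. -/
theorem regMellin_eq_of_strip {ι : Type*} [Countable ι] {p α : ι → ℂ} {f : ℝ → ℂ} {x₀ : ℝ}
    (hx₀ : 0 < x₀) (hα : ∀ i, 0 ≤ (α i).re) (hp : Summable fun i => ‖p i‖ * x₀ ^ (α i).re)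
    (hf : ∀ x, 0 < x → x ≤ x₀ → HasSum (fun i => p i * (x : ℂ) ^ α i) (f x))
    {C δ : ℝ} (hδ : 0 < δ) (hfc : ContinuousOn f (Ioi 0))
    (hC : ∀ x, x₀ < x → ‖f x‖ ≤ C * x ^ (-δ)) {s : ℂ} (hs : s.re < δ)
    {η : ℝ} (hη : 0 < η) (hαη : ∀ i, 2 * η ≤ |(s + α i).im|) {φ : ℂ → ℂ}
    (hφ : ∀ w, w.re < δ → |w.im - s.im| < η → DifferentiableAt ℂ φ w)
    (hM : ∀ w, 0 < w.re → w.re < δ → |w.im - s.im| < η →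
      MellinConvergent f w ∧ mellin f w = φ w) :
    regMellin p α f x₀ s = φ s := by
  have hD : {w : ℂ | w.re < δ ∧ |w.im - s.im| < η}
      = Complex.reLm ⁻¹' Iio δ ∩ Complex.imLm ⁻¹' Ioo (s.im - η) (s.im + η) := by
    ext w
    simp only [Set.mem_ofPred_eq, abs_lt, mem_inter_iff, mem_preimage, Complex.reLm_coe,
      Complex.imLm_coe, mem_Iio, mem_Ioo]
    constructor <;> rintro ⟨h1, h2, h3⟩ <;> refine ⟨h1, ?_, ?_⟩ <;> linarith
  refine regMellin_eq_of_mellin hx₀ hα hp hf hfc hC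
    (D := {w | w.re < δ ∧ |w.im - s.im| < η}) ?_ ?_ (fun w hw => hw.1) hη ?_
    (fun w hw => (hφ w hw.1 hw.2).differentiableWithinAt) ⟨⟨δ / 2, s.im⟩, ?_, by simpa using hδ⟩
    (fun w hw hw' => hM w hw' hw.1 hw.2) ⟨hs, by simpa using hη⟩
  · rw [hD]
    exact (isOpen_Iio.preimage Complex.continuous_re).inter
      (isOpen_Ioo.preimage Complex.continuous_im)
  · rw [hD]
    exact ((convex_Iio δ).linear_preimage _).inter ((convex_Ioo _ _).linear_preimage _)
  · intro w hw i
    refine le_trans ?_ (Complex.abs_im_le_norm _)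
    have h1 := hαη i
    have h2 := hw.2
    simp only [Complex.add_im] at h1 ⊢
    have h3 : |s.im + (α i).im| ≤ |w.im + (α i).im| + |w.im - s.im| := by
      rw [show s.im + (α i).im = (w.im + (α i).im) - (w.im - s.im) by ring]
      exact abs_sub _ _
    linarith
  · exact ⟨by simp [hδ], by simpa using hη⟩

lemma image_div_one_sub : (fun t : ℝ => t / (1 - t)) '' Ioo 0 1 = Ioi 0 := by
  ext x
  simp only [mem_image, mem_Ioo, mem_Ioi]
  constructor
  · rintro ⟨t, ⟨h0, h1⟩, rfl⟩
    exact div_pos h0 (by linarith)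
  · intro hx
    refine ⟨x / (1 + x), ⟨by positivity, ?_⟩, ?_⟩
    · rw [div_lt_one (by positivity)]; linarith
    · field_simp; ring

lemma integral_Ioi_beta {a b : ℂ} (ha : 0 < a.re) (hb : 0 < b.re) :
    IntegrableOn (fun x : ℝ => (x : ℂ) ^ (a - 1) * (1 + x : ℂ) ^ (-(a + b))) (Ioi 0) ∧
    ∫ x in Ioi (0 : ℝ), (x : ℂ) ^ (a - 1) * (1 + x : ℂ) ^ (-(a + b))
      = Complex.Gamma a * Complex.Gamma b / Complex.Gamma (a + b) := by
  have hd : ∀ t ∈ Ioo (0 : ℝ) 1, HasDerivWithinAt (fun t : ℝ => t / (1 - t)) ((1 - t) ^ 2)⁻¹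
      (Ioo 0 1) t := by
    intro t ht
    have h1 : (1 : ℝ) - t ≠ 0 := by linarith [ht.2]
    have := (hasDerivAt_id t).div ((hasDerivAt_id t).const_sub 1) h1
    refine HasDerivAt.hasDerivWithinAt ?_
    convert! this using 1
    simp
  have hinj : InjOn (fun t : ℝ => t / (1 - t)) (Ioo 0 1) := by
    intro s hs t ht h
    have h1 : (1 : ℝ) - t ≠ 0 := by linarith [ht.2]
    have h2 : (1 : ℝ) - s ≠ 0 := by linarith [hs.2]
    simp only at h
    rw [div_eq_div_iff h2 h1] at h
    linarith
  have hG : Complex.Gamma (a + b) ≠ 0 := Complex.Gamma_ne_zero_of_re_pos (by simp; linarith)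
  have he : ∀ t ∈ Ioo (0 : ℝ) 1, |((1 - t) ^ 2)⁻¹| •
      (((t / (1 - t) : ℝ) : ℂ) ^ (a - 1) * (1 + (t / (1 - t) : ℝ) : ℂ) ^ (-(a + b)))
      = (t : ℂ) ^ (a - 1) * (1 - t : ℂ) ^ (b - 1) := by
    intro t ht
    have h1 : (0 : ℝ) < 1 - t := by linarith [ht.2]
    have h2 : ((1 - t : ℝ) : ℂ) ≠ 0 := by exact_mod_cast h1.ne'
    have harg : ((1 - t : ℝ) : ℂ).arg ≠ Real.pi := by
      rw [Complex.arg_ofReal_of_nonneg h1.le]; exact Real.pi_pos.ne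
    have e1 : (1 + (t / (1 - t) : ℝ) : ℂ) = ((1 - t : ℝ) : ℂ)⁻¹ := by
      rw [← Complex.ofReal_one, ← Complex.ofReal_add, ← Complex.ofReal_inv]
      congr 1; field_simp; ring
    have e2 : ((1 - t : ℝ) : ℂ) = 1 - (t : ℂ) := by push_cast; ring
    rw [e1, Complex.inv_cpow _ _ harg, abs_of_pos (by positivity), div_eq_mul_inv,
      Complex.ofReal_mul, Complex.mul_cpow_ofReal_nonneg ht.1.le (by positivity),
      Complex.ofReal_inv, Complex.inv_cpow _ _ harg, ← e2, Complex.real_smul]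
    rw [← Complex.cpow_neg, ← Complex.cpow_neg, neg_neg]
    have e3 : (((1 - t) ^ 2)⁻¹ : ℝ) = ((1 - t : ℝ) : ℂ) ^ (-2 : ℂ) := by
      rw [Complex.cpow_neg]; norm_num
    have e4 : ((1 - t : ℝ) : ℂ) ^ (b - 1) = ((1 - t : ℝ) : ℂ) ^ (-2 : ℂ) *
        ((1 - t : ℝ) : ℂ) ^ (-(a - 1)) * ((1 - t : ℝ) : ℂ) ^ (a + b) := by
      rw [← Complex.cpow_add _ _ h2, ← Complex.cpow_add _ _ h2]
      congr 1; ring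
    rw [e3, e4]
    ring
  constructor
  · rw [← image_div_one_sub, integrableOn_image_iff_integrableOn_abs_deriv_smul measurableSet_Ioo hd
      hinj, integrableOn_congr_fun he measurableSet_Ioo, ← intervalIntegrable_iff_integrableOn_Ioo_of_le
      zero_le_one]
    exact Complex.betaIntegral_convergent ha hb
  · rw [← image_div_one_sub, integral_image_eq_integral_abs_deriv_smul measurableSet_Ioo hd hinj,
      setIntegral_congr_fun measurableSet_Ioo he, ← integral_Ioc_eq_integral_Ioo,
      ← intervalIntegral.integral_of_le zero_le_one, Complex.Gamma_mul_Gamma_eq_betaIntegral ha hb,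
      Complex.betaIntegral]
    field_simp

lemma norm_one_add_cpow {x : ℝ} (hx : 0 < x) (e : ℂ) : ‖(1 + x : ℂ) ^ e‖ = (1 + x) ^ e.re := by
  rw [← Complex.ofReal_one, ← Complex.ofReal_add,
    Complex.norm_cpow_eq_rpow_re_of_pos (by positivity)]

lemma norm_cpow_of_re_eq_zero {x : ℝ} (hx : 0 < x) {c : ℂ} (hc : c.re = 0) :
    ‖(x : ℂ) ^ c‖ = 1 := by
  rw [Complex.norm_cpow_eq_rpow_re_of_pos hx, hc, Real.rpow_zero]

lemma continuousOn_cpow_Ioi (c : ℂ) : ContinuousOn (fun x : ℝ => (x : ℂ) ^ c) (Ioi 0) :=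
  fun _ hx => (Complex.continuousAt_ofReal_cpow_const _ _ (Or.inr (ne_of_gt hx))).continuousWithinAt

lemma continuousOn_one_add_cpow_Ioi (c : ℂ) :
    ContinuousOn (fun x : ℝ => (1 + x : ℂ) ^ c) (Ioi 0) := by
  have h1 : ContinuousOn (fun x : ℝ => 1 + x) (Ioi 0) := by fun_prop
  have := (continuousOn_cpow_Ioi c).comp h1 (fun x hx => by
    have : (0 : ℝ) < x := hx
    simp only [mem_Ioi]; linarith)
  refine this.congr fun x _ => ?_
  simp

lemma hasSum_one_add_cpow_mul_cpow (e c : ℂ) {x : ℝ} (hx : 0 < x) (hx' : x ≤ 1 / 2) :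
    HasSum (fun k : ℕ => Ring.choose e k * (x : ℂ) ^ (k - c))
      ((1 + x : ℂ) ^ e * (x : ℂ) ^ (-c)) := by
  have h1 := (hasSum_one_add_cpow e (x := x)
    (by rw [abs_of_pos hx]; linarith)).mul_right ((x : ℂ) ^ (-c))
  convert! h1 using 1
  funext k
  rw [sub_eq_add_neg (k : ℂ) c, Complex.cpow_add _ _ (by exact_mod_cast hx.ne'),
    Complex.cpow_natCast]
  ring

lemma regMellin_beta {b c s : ℂ} {m : ℕ} (hb : b.re = m) (hc : c.re = 0) (hs : s.re ≤ 0)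
    {η : ℝ} (hη : 0 < η) (hsc : 2 * η ≤ |(s - c).im|) :
    regMellin (fun k => Ring.choose (c - 1 - b) k) (fun k : ℕ => k - c)
      (fun x => (1 + x : ℂ) ^ (c - 1 - b) * (x : ℂ) ^ (-c)) (1 / 2) s
    = Complex.Gamma (s - c) * Complex.Gamma (1 + b - s) / Complex.Gamma (1 + b - c) := by
  refine regMellin_eq_of_strip (C := 1) (δ := 1)
    (φ := fun s => Complex.Gamma (s - c) * Complex.Gamma (1 + b - s) / Complex.Gamma (1 + b - c))
    (by norm_num) (fun k => by simp [hc]) ?_ ?_ one_pos ?_ ?_ (by linarith) hη (fun k => ?_) ?_ ?_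
  · simpa [hc] using summable_norm_choose_mul (c - 1 - b) (r := 1 / 2) (by norm_num) (by norm_num)
  · exact fun x hx hx' => hasSum_one_add_cpow_mul_cpow _ _ hx hx'
  · exact (continuousOn_one_add_cpow_Ioi _).mul (continuousOn_cpow_Ioi _)
  · intro x hx
    have hx0 : (0 : ℝ) < x := by linarith
    rw [norm_mul, norm_one_add_cpow hx0, norm_cpow_of_re_eq_zero hx0 (by simp [hc])]
    simp only [Complex.sub_re, hc, Complex.one_re, hb, zero_sub, mul_one, one_mul]
    calc (1 + x) ^ (-1 - (m : ℝ)) ≤ (1 + x) ^ (-1 : ℝ) :=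
          Real.rpow_le_rpow_of_exponent_le (by linarith) (by simp)
      _ ≤ _ := Real.rpow_le_rpow_of_nonpos hx0 (by linarith) (by norm_num)
  · simpa [sub_eq_add_neg] using hsc
  · intro w hw hws
    have h1 : ∀ m : ℕ, w - c ≠ -m := by
      intro m h
      have := congrArg Complex.im h
      simp only [Complex.sub_im, Complex.neg_im, Complex.natCast_im, neg_zero] at this
      simp only [Complex.sub_im] at hsc
      rw [show s.im - c.im = -(w.im - s.im) by linarith, abs_neg] at hsc
      linarith
    have h2 : ∀ m : ℕ, 1 + b - w ≠ -m := by
      intro k h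
      have := congrArg Complex.re h
      simp [hb] at this
      have h3 : (0 : ℝ) ≤ m := by positivity
      have h4 : (0 : ℝ) ≤ k := by positivity
      linarith
    have h1' := (Complex.differentiableAt_Gamma _ h1).comp w (differentiableAt_id.sub_const c)
    have h2' := (Complex.differentiableAt_Gamma _ h2).comp w (differentiableAt_id.const_sub (1 + b))
    exact (h1'.mul h2').div_const _
  · intro w hw0 hw1 _
    have h1 := integral_Ioi_beta (a := w - c) (b := 1 + b - w) (by simpa [hc] using hw0)
      (by simp [hb]; have : (0 : ℝ) ≤ m := by positivity
          linarith)
    have h2 : ∀ x ∈ Ioi (0 : ℝ), (x : ℂ) ^ (w - c - 1) * (1 + x : ℂ) ^ (-(w - c + (1 + b - w)))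
        = (x : ℂ) ^ (w - 1) * ((1 + x : ℂ) ^ (c - 1 - b) * (x : ℂ) ^ (-c)) := by
      intro x hx
      rw [show w - c - 1 = w - 1 + -c by ring,
        Complex.cpow_add _ _ (by exact_mod_cast (ne_of_gt hx)),
        show -(w - c + (1 + b - w)) = c - 1 - b by ring]
      ring
    rw [integrableOn_congr_fun h2 measurableSet_Ioi, setIntegral_congr_fun measurableSet_Ioi h2] at h1
    refine ⟨h1.1, h1.2.trans ?_⟩
    rw [show w - c + (1 + b - w) = 1 + b - c by ring]

lemma norm_exponent_le {J : Type*} {β : J → ℂ} {n : J → ℕ} {c : ℂ} {N : ℕ}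
    (hN : ∀ j, ‖β j‖ ≤ n j + N) (hcN : ‖c‖ ≤ N) (j : J) :
    ‖c - 1 - β j‖ ≤ ((n j + 2 * N : ℕ) : ℝ) + 1 := by
  have h1 := norm_sub_le (c - 1) (β j)
  have h2 := norm_sub_le c 1
  rw [norm_one] at h2
  push_cast
  linarith [hN j]

lemma summable_norm_choose_exponent {J : Type*} {q β : J → ℂ} {n : J → ℕ} {c : ℂ} {N : ℕ}
    (hN : ∀ j, ‖β j‖ ≤ n j + N) (hcN : ‖c‖ ≤ N) (hq : Summable fun j => ‖q j‖ * 2 ^ n j) :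
    Summable fun jk : J × ℕ =>
      ‖q jk.1‖ * ‖Ring.choose (c - 1 - β jk.1) jk.2‖ * (1 / 2 : ℝ) ^ jk.2 := by
  have h := norm_exponent_le hN hcN
  exact summable_norm_mul_choose (e := fun j => c - 1 - β j) (n := n) (M := 2 * N) h hq

section Kernels

variable {ι J : Type*} [Countable ι] [Countable J] {p α : ι → ℂ} {f : ℝ → ℂ}
  {q β : J → ℂ} {n : J → ℕ} {h : ℝ → ℂ} {c : ℂ}

set_option maxHeartbeats 400000 in
/-- Convolution expansion for the weight `(1 + x) ^ (c - 1) * x ^ (-c - 1)` on `(0, ∞)`. -/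
theorem integral_conv_one_add (hα : ∀ i, 0 ≤ (α i).re)
    (hp : ∀ x, 0 < x → Summable fun i => ‖p i‖ * x ^ (α i).re)
    (hf : ∀ x : ℝ, 0 < x → HasSum (fun i => p i * (x : ℂ) ^ α i) (f x))
    {C δ η : ℝ} (hδ : 0 < δ) (hfc : ContinuousOn f (Ioi 0))
    (hC : ∀ x, 0 < x → ‖f x‖ ≤ C * x ^ (-δ)) (hc : c.re = 0)
    (hη : 0 < η) (hcη : ∀ i, 2 * η ≤ |(c + α i).im|)
    {N : ℕ} (hN : ∀ j, ‖β j‖ ≤ n j + N) (hcN : ‖c‖ ≤ N) (hβ : ∀ j, (β j).re = n j)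
    (hq : Summable fun j => ‖q j‖ * 2 ^ n j)
    (hh : ∀ x : ℝ, 0 < x → HasSum (fun j => q j * (x : ℂ) ^ β j) (h x))
    (hint : IntegrableOn (fun x : ℝ => f x⁻¹ *
      (h (1 + x)⁻¹ * (1 + x : ℂ) ^ (c - 1) * (x : ℂ) ^ (-c)) / x) (Ioi 0)) :
    (Summable fun jk : J × ℕ =>
      q jk.1 * Ring.choose (c - 1 - β jk.1) jk.2 * regMellin p α f 2 (c - jk.2)) ∧
    (Summable fun ji : J × ι => q ji.1 * p ji.2 *
      (Complex.Gamma (-c - α ji.2) * Complex.Gamma (1 + β ji.1 + α ji.2)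
        / Complex.Gamma (1 + β ji.1 - c))) ∧
    ∫ x in Ioi (0 : ℝ), f x⁻¹ * (h (1 + x)⁻¹ * (1 + x : ℂ) ^ (c - 1) * (x : ℂ) ^ (-c)) / x =
      ∑' jk : J × ℕ, q jk.1 * Ring.choose (c - 1 - β jk.1) jk.2 * regMellin p α f 2 (c - jk.2) +
      ∑' ji : J × ι, q ji.1 * p ji.2 *
      (Complex.Gamma (-c - α ji.2) * Complex.Gamma (1 + β ji.1 + α ji.2)
        / Complex.Gamma (1 + β ji.1 - c)) := by
  have hGb : ∀ j, ∀ x : ℝ, 1 / 2 < x → ‖(1 + x : ℂ) ^ (c - 1 - β j) * (x : ℂ) ^ (-c) / x‖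
      ≤ x ^ (-2 : ℝ) := by
    intro j x hx
    have hx0 : (0 : ℝ) < x := by linarith
    rw [norm_div, norm_mul, norm_one_add_cpow hx0, norm_cpow_of_re_eq_zero hx0 (by simp [hc]),
      Complex.norm_real, Real.norm_of_nonneg hx0.le]
    simp only [Complex.sub_re, hc, Complex.one_re, hβ, zero_sub, mul_one]
    rw [show (-2 : ℝ) = -1 + -1 by norm_num, Real.rpow_add hx0, Real.rpow_neg_one x, div_eq_mul_inv]
    gcongr
    rw [← Real.rpow_neg_one x]
    calc (1 + x) ^ (-1 - (n j : ℝ)) ≤ (1 + x) ^ (-1 : ℝ) :=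
          Real.rpow_le_rpow_of_exponent_le (by linarith) (by simp)
      _ ≤ _ := Real.rpow_le_rpow_of_nonpos hx0 (by linarith) (by norm_num)
  have hI2 : IntegrableOn (fun x : ℝ => x ^ (-2 : ℝ)) (Ioi (1 / 2)) :=
    integrableOn_Ioi_rpow_of_lt (by norm_num) (by norm_num)
  have hGi : ∀ j, IntegrableOn (fun x : ℝ => (1 + x : ℂ) ^ (c - 1 - β j) * (x : ℂ) ^ (-c) / x)
      (Ioi (1 / 2)) := by
    intro j
    refine Integrable.mono' hI2 ?_ ?_
    · have hsub : Ioi (1 / 2 : ℝ) ⊆ Ioi 0 := Ioi_subset_Ioi (by norm_num)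
      refine ContinuousOn.aestronglyMeasurable (ContinuousOn.div (ContinuousOn.mul ?_ ?_) ?_ ?_)
        measurableSet_Ioi
      · exact (continuousOn_one_add_cpow_Ioi _).mono hsub
      · exact (continuousOn_cpow_Ioi _).mono hsub
      · exact Complex.continuous_ofReal.continuousOn
      · intro x hx; exact_mod_cast ne_of_gt (hsub hx)
    · filter_upwards [ae_restrict_mem measurableSet_Ioi] with x hx using hGb j x hx
  have hg : Summable fun jk : J × ℕ =>
      ‖q jk.1‖ * ‖Ring.choose (c - 1 - β jk.1) jk.2‖ * (1 / 2 : ℝ) ^ jk.2 :=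
    summable_norm_choose_exponent hN hcN hq
  have hG : ∀ j, ∀ x : ℝ, 0 < x → x ≤ 1 / 2 →
      HasSum (fun k : ℕ => Ring.choose (c - 1 - β j) k * (x : ℂ) ^ (k - c))
        ((1 + x : ℂ) ^ (c - 1 - β j) * (x : ℂ) ^ (-c)) :=
    fun j x hx hx' => hasSum_one_add_cpow_mul_cpow _ _ hx hx'
  have hcε : ∀ i, ∀ k : ℕ, 2 * η ≤ ‖c - k + α i‖ := by
    intro i k
    refine le_trans ?_ (Complex.abs_im_le_norm _)
    have := hcη i
    simpa only [Complex.add_im, Complex.sub_im, Complex.natCast_im, sub_zero] using this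
  have hGs : Summable fun j => ‖q j‖ *
      ∫ x in Ioi (1 / 2 : ℝ), ‖(1 + x : ℂ) ^ (c - 1 - β j) * (x : ℂ) ^ (-c) / x‖ := by
    refine Summable.of_nonneg_of_le (fun _ => mul_nonneg (norm_nonneg _)
      (integral_nonneg fun _ => norm_nonneg _)) (fun j => ?_)
      (hq.mul_right (∫ x in Ioi (1 / 2 : ℝ), x ^ (-2 : ℝ)))
    have h1 : (1 : ℝ) ≤ 2 ^ n j := one_le_pow₀ (by norm_num)
    have h2 : ∫ x in Ioi (1 / 2 : ℝ), ‖(1 + x : ℂ) ^ (c - 1 - β j) * (x : ℂ) ^ (-c) / x‖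
        ≤ ∫ x in Ioi (1 / 2 : ℝ), x ^ (-2 : ℝ) :=
      setIntegral_mono_on (hGi j).norm hI2 measurableSet_Ioi fun x hx => hGb j x hx
    have h3 : 0 ≤ ∫ x in Ioi (1 / 2 : ℝ), x ^ (-2 : ℝ) :=
      setIntegral_nonneg measurableSet_Ioi fun x hx =>
        Real.rpow_nonneg (by have : (1 / 2 : ℝ) < x := hx
                             linarith) _
    calc _ ≤ ‖q j‖ * ∫ x in Ioi (1 / 2 : ℝ), x ^ (-2 : ℝ) :=
          mul_le_mul_of_nonneg_left h2 (norm_nonneg _)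
      _ = ‖q j‖ * 1 * ∫ x in Ioi (1 / 2 : ℝ), x ^ (-2 : ℝ) := by ring
      _ ≤ _ := by gcongr
  have hh' : ∀ x : ℝ, 0 < x →
      HasSum (fun j => q j * ((1 + x : ℂ) ^ (c - 1 - β j) * (x : ℂ) ^ (-c)))
        (h (1 + x)⁻¹ * (1 + x : ℂ) ^ (c - 1) * (x : ℂ) ^ (-c)) := by
    intro x hx
    have hx1 : (0 : ℝ) < 1 + x := by linarith
    have h1 := ((hh (1 + x)⁻¹ (inv_pos.2 hx1)).mul_right
      ((1 + x : ℂ) ^ (c - 1) * (x : ℂ) ^ (-c)))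
    convert! h1 using 1
    · funext j
      have hx2 : (1 + x : ℂ) ≠ 0 := by exact_mod_cast hx1.ne'
      rw [Complex.ofReal_inv, Complex.inv_cpow _ _ (by
        rw [Complex.arg_ofReal_of_nonneg hx1.le]; exact Real.pi_pos.ne)]
      push_cast
      rw [Complex.cpow_sub _ _ hx2]
      ring
    · ring
  have e2 : ∀ ji : J × ι, regMellin (fun k => Ring.choose (c - 1 - β ji.1) k)
      (fun k : ℕ => k - c) (fun x => (1 + x : ℂ) ^ (c - 1 - β ji.1) * (x : ℂ) ^ (-c))
      (1 / 2) (-α ji.2) = Complex.Gamma (-c - α ji.2) * Complex.Gamma (1 + β ji.1 + α ji.2)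
      / Complex.Gamma (1 + β ji.1 - c) := by
    intro ji
    rw [regMellin_beta (hβ _) hc (by simpa using hα ji.2) hη]
    · rw [show -α ji.2 - c = -c - α ji.2 by ring, sub_neg_eq_add]
    · have := hcη ji.2
      rw [show -α ji.2 - c = -(c + α ji.2) by ring, Complex.neg_im, abs_neg]
      exact this
  have hp2 : Summable fun i => ‖p i‖ * ((1 / 2 : ℝ)⁻¹) ^ (α i).re := hp _ (by norm_num)
  have h12 : (0 : ℝ) < 1 / 2 := by norm_num
  have hη2 : 0 < 2 * η := by linarith
  obtain ⟨h1, h2, h3⟩ := integral_conv_eq (x₀ := 1 / 2) (q := q) (p := p) (α := α) (f := f)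
    (g := fun j k => Ring.choose (c - 1 - β j) k)
    (G := fun j x => (1 + x : ℂ) ^ (c - 1 - β j) * (x : ℂ) ^ (-c))
    (h := fun x => h (1 + x)⁻¹ * (1 + x : ℂ) ^ (c - 1) * (x : ℂ) ^ (-c)) h12 hα hp2 hf hδ hfc hC hc
    hη2 hcε hg hG hGi hGs hh' hint
  have e1 : (1 / 2 : ℝ)⁻¹ = 2 := by norm_num
  rw [e1] at h1 h3
  have e3 : (fun ji : J × ι => q ji.1 * p ji.2 *
      regMellin (fun k => Ring.choose (c - 1 - β ji.1) k)
      (fun k : ℕ => k - c) (fun x => (1 + x : ℂ) ^ (c - 1 - β ji.1) * (x : ℂ) ^ (-c))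
      (1 / 2) (-α ji.2)) = fun ji => q ji.1 * p ji.2 *
      (Complex.Gamma (-c - α ji.2) * Complex.Gamma (1 + β ji.1 + α ji.2)
      / Complex.Gamma (1 + β ji.1 - c)) := funext fun ji => by rw [e2]
  rw [e3] at h2 h3
  exact ⟨h1, h2, h3⟩

end Kernels

lemma hasSum_one_sub_cpow_mul_cpow (e c : ℂ) {x : ℝ} (hx : 0 < x) (hx' : x ≤ 1 / 2) :
    HasSum (fun k : ℕ => (-1) ^ k * Ring.choose e k * (x : ℂ) ^ (k - c))
      ((1 - x : ℂ) ^ e * (x : ℂ) ^ (-c)) := by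
  have h1 := (hasSum_one_sub_cpow e (x := x)
    (by rw [abs_of_pos hx]; linarith)).mul_right ((x : ℂ) ^ (-c))
  convert! h1 using 1
  funext k
  rw [sub_eq_add_neg (k : ℂ) c, Complex.cpow_add _ _ (by exact_mod_cast hx.ne'),
    Complex.cpow_natCast]
  ring

/-- Convolution expansion for the weight `(1 - x) ^ (c - 1) * x ^ (-c - 1)` on `(0, 1 / 2]`. -/
theorem integral_conv_one_sub {ι J : Type*} [Countable ι] [Countable J] {p α : ι → ℂ} {f : ℝ → ℂ}
    {q β : J → ℂ} {n : J → ℕ} {h : ℝ → ℂ} {c : ℂ} (hα : ∀ i, 0 ≤ (α i).re)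
    (hp : ∀ x, 0 < x → Summable fun i => ‖p i‖ * x ^ (α i).re)
    (hf : ∀ x : ℝ, 0 < x → HasSum (fun i => p i * (x : ℂ) ^ α i) (f x))
    {C δ η : ℝ} (hδ : 0 < δ) (hfc : ContinuousOn f (Ioi 0))
    (hC : ∀ x, 0 < x → ‖f x‖ ≤ C * x ^ (-δ)) (hc : c.re = 0)
    (hη : 0 < η) (hcη : ∀ i, 2 * η ≤ |(c + α i).im|)
    {N : ℕ} (hN : ∀ j, ‖β j‖ ≤ n j + N) (hcN : ‖c‖ ≤ N)
    (hq : Summable fun j => ‖q j‖ * 2 ^ n j)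
    (hh : ∀ x : ℝ, 0 < x → HasSum (fun j => q j * (x : ℂ) ^ β j) (h x))
    (hint : IntegrableOn (fun x : ℝ => f x⁻¹ *
      (h (1 - x)⁻¹ * (1 - x : ℂ) ^ (c - 1) * (x : ℂ) ^ (-c)) / x) (Ioc 0 (1 / 2))) :
    (Summable fun jk : J × ℕ => q jk.1 * ((-1) ^ jk.2 * Ring.choose (c - 1 - β jk.1) jk.2) *
      regMellin p α f 2 (c - jk.2)) ∧
    (Summable fun ji : J × ι => q ji.1 * p ji.2 * halfBeta (-c - α ji.2) (c - β ji.1)) ∧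
    ∫ x in Ioc (0 : ℝ) (1 / 2), f x⁻¹ * (h (1 - x)⁻¹ * (1 - x : ℂ) ^ (c - 1) * (x : ℂ) ^ (-c)) / x =
      ∑' jk : J × ℕ, q jk.1 * ((-1) ^ jk.2 * Ring.choose (c - 1 - β jk.1) jk.2) *
        regMellin p α f 2 (c - jk.2) +
      ∑' ji : J × ι, q ji.1 * p ji.2 * halfBeta (-c - α ji.2) (c - β ji.1) := by
  classical
  have h12 : (0 : ℝ) < 1 / 2 := by norm_num
  have hη2 : 0 < 2 * η := by linarith
  obtain ⟨G, hGdef⟩ : ∃ G : J → ℝ → ℂ, G = fun j (x : ℝ) =>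
    if x ≤ 1 / 2 then (1 - x : ℂ) ^ (c - 1 - β j) * (x : ℂ) ^ (-c) else 0 := ⟨_, rfl⟩
  obtain ⟨H, hHdef⟩ : ∃ H : ℝ → ℂ, H = fun x : ℝ =>
    if x ≤ 1 / 2 then h (1 - x)⁻¹ * (1 - x : ℂ) ^ (c - 1) * (x : ℂ) ^ (-c) else 0 := ⟨_, rfl⟩
  have hG0 : ∀ j, ∀ x ∈ Ioi (1 / 2 : ℝ), G j x / x = 0 := by
    intro j x hx
    simp only [hGdef, if_neg (not_le.2 (show (1 / 2 : ℝ) < x from hx)), zero_div]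
  have hg : Summable fun jk : J × ℕ =>
      ‖q jk.1‖ * ‖(-1) ^ jk.2 * Ring.choose (c - 1 - β jk.1) jk.2‖ * (1 / 2 : ℝ) ^ jk.2 := by
    have := summable_norm_choose_exponent hN hcN hq
    refine this.congr fun jk => ?_
    rw [norm_mul, norm_pow, norm_neg, norm_one, one_pow, one_mul]
  have hG : ∀ j, ∀ x : ℝ, 0 < x → x ≤ 1 / 2 →
      HasSum (fun k : ℕ => (-1) ^ k * Ring.choose (c - 1 - β j) k * (x : ℂ) ^ (k - c))
        (G j x) := by
    intro j x hx hx'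
    rw [hGdef]
    simp only [if_pos hx']
    exact hasSum_one_sub_cpow_mul_cpow _ _ hx hx'
  have hGi : ∀ j, IntegrableOn (fun x : ℝ => G j x / x) (Ioi (1 / 2)) := by
    intro j
    rw [integrableOn_congr_fun (hG0 j) measurableSet_Ioi]
    exact integrableOn_zero
  have hGs : Summable fun j => ‖q j‖ * ∫ x in Ioi (1 / 2 : ℝ), ‖G j x / x‖ := by
    refine summable_zero.congr fun j => ?_
    rw [setIntegral_congr_fun (g := fun _ => (0 : ℝ)) measurableSet_Ioi fun x hx => by
      simp only [hG0 j x hx, norm_zero]]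
    simp
  have hcε : ∀ i, ∀ k : ℕ, 2 * η ≤ ‖c - k + α i‖ := by
    intro i k
    refine le_trans ?_ (Complex.abs_im_le_norm _)
    have := hcη i
    simpa only [Complex.add_im, Complex.sub_im, Complex.natCast_im, sub_zero] using this
  have hh' : ∀ x : ℝ, 0 < x → HasSum (fun j => q j * G j x) (H x) := by
    intro x hx
    rw [hGdef, hHdef]
    by_cases hx' : x ≤ 1 / 2
    · simp only [if_pos hx']
      have hx1 : (0 : ℝ) < 1 - x := by linarith
      have h1 := ((hh (1 - x)⁻¹ (inv_pos.2 hx1)).mul_right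
        ((1 - x : ℂ) ^ (c - 1) * (x : ℂ) ^ (-c)))
      convert! h1 using 1
      · funext j
        have hx2 : (1 - x : ℂ) ≠ 0 := by exact_mod_cast hx1.ne'
        rw [Complex.ofReal_inv, Complex.inv_cpow _ _ (by
          rw [Complex.arg_ofReal_of_nonneg hx1.le]; exact Real.pi_pos.ne)]
        push_cast
        rw [Complex.cpow_sub _ _ hx2]
        ring
      · ring
    · simp only [if_neg hx', mul_zero]
      exact hasSum_zero
  have hHi : ∀ x ∈ Ioi (0 : ℝ), f x⁻¹ * H x / x = (Ioc (0 : ℝ) (1 / 2)).indicator (fun x : ℝ =>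
      f x⁻¹ * (h (1 - x)⁻¹ * (1 - x : ℂ) ^ (c - 1) * (x : ℂ) ^ (-c)) / x) x := by
    intro x hx
    have hx0 : (0 : ℝ) < x := hx
    rw [hHdef]
    by_cases hx' : x ≤ 1 / 2
    · rw [indicator_of_mem (show x ∈ Ioc (0 : ℝ) (1 / 2) from ⟨hx, hx'⟩)]
      simp only [if_pos hx']
    · rw [indicator_of_notMem (fun h => hx' h.2)]
      simp only [if_neg hx']
      simp
  have hsub : Ioc (0 : ℝ) (1 / 2) ∩ Ioi 0 = Ioc 0 (1 / 2) :=
    inter_eq_left.2 fun x hx => hx.1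
  have hint' : IntegrableOn (fun x : ℝ => f x⁻¹ * H x / x) (Ioi 0) := by
    rw [integrableOn_congr_fun hHi measurableSet_Ioi, IntegrableOn,
      integrable_indicator_iff measurableSet_Ioc, IntegrableOn,
      Measure.restrict_restrict measurableSet_Ioc, hsub]
    exact hint
  have hI : ∫ x in Ioi (0 : ℝ), f x⁻¹ * H x / x = ∫ x in Ioc (0 : ℝ) (1 / 2),
      f x⁻¹ * (h (1 - x)⁻¹ * (1 - x : ℂ) ^ (c - 1) * (x : ℂ) ^ (-c)) / x := by
    rw [setIntegral_congr_fun measurableSet_Ioi hHi, integral_indicator measurableSet_Ioc,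
      Measure.restrict_restrict measurableSet_Ioc, hsub]
  have hp2 : Summable fun i => ‖p i‖ * ((1 / 2 : ℝ)⁻¹) ^ (α i).re := hp _ (by norm_num)
  obtain ⟨h1, h2, h3⟩ := integral_conv_eq (x₀ := 1 / 2) (q := q) (p := p) (α := α) (f := f)
    (g := fun j k => (-1) ^ k * Ring.choose (c - 1 - β j) k)
    (G := G) (h := H) h12 hα hp2 hf hδ hfc hC hc hη2 hcε hg hG hGi hGs hh' hint'
  have e1 : (1 / 2 : ℝ)⁻¹ = 2 := by norm_num
  rw [e1] at h1 h3
  have e3 : (fun ji : J × ι => q ji.1 * p ji.2 *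
      regMellin (fun k => (-1) ^ k * Ring.choose (c - 1 - β ji.1) k)
      (fun k : ℕ => k - c) (G ji.1) (1 / 2) (-α ji.2)) = fun ji => q ji.1 * p ji.2 *
      halfBeta (-c - α ji.2) (c - β ji.1) := by
    funext ji
    congr 1
    have h0 : ∀ x ∈ Ioi (1 / 2 : ℝ), (x : ℂ) ^ (-α ji.2 - 1) * G ji.1 x = 0 := by
      intro x hx
      simp only [hGdef, if_neg (not_le.2 (show (1 / 2 : ℝ) < x from hx)), mul_zero]
    rw [regMellin, setIntegral_congr_fun measurableSet_Ioi h0, integral_zero, add_zero, halfBeta]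
    refine tsum_congr fun k => ?_
    rw [show -α ji.2 + (k - c) = -c - α ji.2 + k by ring,
      show c - 1 - β ji.1 = c - β ji.1 - 1 by ring]
  rw [e3] at h2 h3
  rw [hI] at h3
  exact ⟨h1, h2, h3⟩

lemma factorial_mul_norm_Gamma_le {ν : ℂ} (hν : ν.re = 0) (m : ℕ) :
    m.factorial * ‖Complex.Gamma (1 + ν)‖ ≤ ‖Complex.Gamma (m + ν + 1)‖ := by
  induction m with
  | zero => simp [add_comm]
  | succ k ih =>
    have h0 : (k + ν + 1 : ℂ) ≠ 0 := by
      intro h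
      have := congrArg Complex.re h
      simp [hν] at this
      have : (0 : ℝ) ≤ k := by positivity
      linarith
    have h1 : ((k + 1 : ℕ) : ℝ) ≤ ‖(k + ν + 1 : ℂ)‖ := by
      refine le_trans ?_ (Complex.re_le_norm _)
      simp [hν]
    rw [show ((k + 1 : ℕ) + ν + 1 : ℂ) = (k + ν + 1) + 1 by push_cast; ring,
      Complex.Gamma_add_one _ h0, norm_mul, Nat.factorial_succ]
    push_cast at h1 ⊢
    calc _ = ((k : ℝ) + 1) * (k.factorial * ‖Complex.Gamma (1 + ν)‖) := by ring
      _ ≤ _ := mul_le_mul h1 ih (by positivity) (norm_nonneg _)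

lemma Gamma_natCast_add_add_one_ne_zero {ν : ℂ} (hν : ν.re = 0) (m : ℕ) :
    Complex.Gamma (m + ν + 1) ≠ 0 :=
  Complex.Gamma_ne_zero_of_re_pos (by simp [hν]; positivity)

lemma norm_Gamma_one_add_pos {ν : ℂ} (hν : ν.re = 0) : 0 < ‖Complex.Gamma (1 + ν)‖ :=
  norm_pos_iff.2 (Complex.Gamma_ne_zero_of_re_pos (by simp [hν]))

lemma hasSum_bool_prod {g : Bool × ℕ → ℂ} {a b : ℂ} (h1 : HasSum (fun m => g (true, m)) a)
    (h2 : HasSum (fun m => g (false, m)) b) : HasSum g (a + b) := by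
  rw [add_comm, ← (Equiv.boolProdEquivSum ℕ).symm.hasSum_iff]
  exact HasSum.sum h2 h1

/-- The sign attached to a boolean. -/
noncomputable def boolSign (b : Bool) : ℂ := if b then 1 else -1

@[simp] lemma boolSign_true : boolSign true = 1 := rfl
@[simp] lemma boolSign_false : boolSign false = -1 := by simp [boolSign]
@[simp] lemma norm_boolSign (b : Bool) : ‖boolSign b‖ = 1 := by cases b <;> simp
@[simp] lemma boolSign_re_mul (b : Bool) {ν : ℂ} (h : ν.re = 0) : (boolSign b * ν).re = 0 := by
  cases b <;> simp [h]

/-- Exponents `m ± ν / 2` in the expansion of the Bessel kernels. -/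
noncomputable def besselExp (ν : ℂ) (i : Bool × ℕ) : ℂ := i.2 + boolSign i.1 * ν / 2

/-- Coefficients in the expansion of the Bessel kernels; `η = -1` for `J`, `η = 1` for `K`. -/
noncomputable def besselCoeff (ν η : ℂ) (i : Bool × ℕ) : ℂ :=
  -boolSign i.1 * ((Real.pi : ℂ) / (2 * Complex.sin (Real.pi * ν / 2))) * η ^ i.2 /
    (i.2.factorial * Complex.Gamma (i.2 + boolSign i.1 * ν + 1))

lemma besselExp_re {ν : ℂ} (hν : ν.re = 0) (i : Bool × ℕ) : (besselExp ν i).re = i.2 := by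
  rcases i with ⟨b, m⟩
  cases b <;> simp [besselExp, hν]

lemma summable_pow_div_factorial_mul (R : ℝ) :
    Summable fun m : ℕ => R ^ m / m.factorial := Real.summable_pow_div_factorial R

lemma summable_besselCoeff {ν η : ℂ} (hν : ν.re = 0) (hη : ‖η‖ ≤ 1) (R : ℝ) (hR : 0 ≤ R) :
    Summable fun i : Bool × ℕ => ‖besselCoeff ν η i‖ * R ^ i.2 := by
  refine (summable_prod_of_nonneg (fun _ => by positivity)).2 ⟨fun b => ?_, ?_⟩
  · have hb : (boolSign b * ν).re = 0 := boolSign_re_mul b hν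
    have hG := norm_Gamma_one_add_pos hb
    set κ := ‖(Real.pi : ℂ) / (2 * Complex.sin (Real.pi * ν / 2))‖ with hκ
    refine Summable.of_nonneg_of_le (fun _ => by positivity) (fun m => ?_)
      ((summable_pow_div_factorial_mul R).mul_left (κ / ‖Complex.Gamma (1 + boolSign b * ν)‖))
    have h1 := factorial_mul_norm_Gamma_le hb m
    have h2 : (1 : ℝ) ≤ m.factorial := by exact_mod_cast m.factorial_pos
    have h3 : ‖besselCoeff ν η (b, m)‖ ≤ κ / (m.factorial * ‖Complex.Gamma (1 + boolSign b * ν)‖) := by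
      rw [besselCoeff]
      simp only [norm_div, norm_mul, norm_neg, norm_boolSign, one_mul, norm_pow, Complex.norm_natCast]
      rw [← norm_mul, ← norm_div, ← hκ]
      calc κ * ‖η‖ ^ m / (m.factorial * ‖Complex.Gamma (m + boolSign b * ν + 1)‖)
          ≤ κ * 1 / (1 * (m.factorial * ‖Complex.Gamma (1 + boolSign b * ν)‖)) := by
            gcongr
            exact pow_le_one₀ (norm_nonneg _) hη
        _ = _ := by ring
    calc _ ≤ κ / (m.factorial * ‖Complex.Gamma (1 + boolSign b * ν)‖) * R ^ m := by gcongr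
      _ = _ := by ring
  · exact (hasSum_fintype _).summable

lemma summable_besselCoeff_rpow {ν η : ℂ} (hν : ν.re = 0) (hη : ‖η‖ ≤ 1) (R : ℝ) (hR : 0 ≤ R) :
    Summable fun i : Bool × ℕ => ‖besselCoeff ν η i‖ * R ^ (besselExp ν i).re := by
  refine (summable_besselCoeff hν hη R hR).congr fun i => ?_
  rw [besselExp_re hν, Real.rpow_natCast]

/-- A series of powers converging absolutely on `(0, ∞)` is continuous there. -/
lemma continuousOn_of_hasSum_cpow {ι : Type*} {p α : ι → ℂ} {f : ℝ → ℂ} (hα : ∀ i, 0 ≤ (α i).re)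
    (hp : ∀ x, 0 < x → Summable fun i => ‖p i‖ * x ^ (α i).re)
    (hf : ∀ x : ℝ, 0 < x → HasSum (fun i => p i * (x : ℂ) ^ α i) (f x)) :
    ContinuousOn f (Ioi 0) := by
  intro x hx
  have hx0 : (0 : ℝ) < x := hx
  have h1 : ContinuousOn (fun x : ℝ => ∑' i, p i * (x : ℂ) ^ α i) (Ioo 0 (2 * x)) := by
    refine continuousOn_tsum (fun i => ?_) (hp (2 * x) (by positivity)) fun i y hy => ?_
    · exact continuousOn_const.mul ((continuousOn_cpow_Ioi _).mono fun y hy => hy.1)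
    · rw [norm_mul, Complex.norm_cpow_eq_rpow_re_of_pos hy.1]
      gcongr
      · exact hy.1.le
      · exact hα i
      · exact hy.2.le
  have h2 : ContinuousOn f (Ioo 0 (2 * x)) :=
    h1.congr fun y hy => (hf y hy.1).tsum_eq.symm
  exact (h2.continuousAt (Ioo_mem_nhds hx0 (by linarith))).continuousWithinAt

/-- What is needed of the kernels `J⁻_ν(√x)` (`η = -1`) and `K̃_ν(√x)` (`η = 1`): the expansion at
the origin, boundedness and decay, and the Mellin transform. -/
structure BesselKernel (ν η : ℂ) (w : ℂ → ℂ) (F : ℝ → ℂ) : Prop where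
  hasSum : ∀ x : ℝ, 0 < x → HasSum (fun i => besselCoeff ν η i * (x : ℂ) ^ besselExp ν i) (F x)
  bounded : ∃ C, ∀ x : ℝ, 0 < x → ‖F x‖ ≤ C ∧ ‖F x‖ ≤ C * x ^ (-(1 / 4) : ℝ)
  mellin : ∀ s : ℂ, 0 < s.re → s.re < 1 / 4 → MellinConvergent F s ∧
    mellin F s = Complex.Gamma (s + ν / 2) * Complex.Gamma (s - ν / 2) * w s

lemma mellinConvergent_exp_neg_mul {X : ℝ} (hX : 0 < X) {s : ℂ} (hs : 0 < s.re) :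
    MellinConvergent (fun t : ℝ => Complex.exp (-(X * t))) s ∧
      mellin (fun t : ℝ => Complex.exp (-(X * t))) s = (X : ℂ) ^ (-s) * Complex.Gamma s := by
  constructor
  · have h1 : MellinConvergent (fun t : ℝ => Complex.exp (-t)) s := by
      refine (Complex.GammaIntegral_convergent hs).congr_fun (fun x _ => ?_) measurableSet_Ioi
      simp [mul_comm]
    have h2 := (MellinConvergent.comp_mul_left (s := s) hX).2 h1
    simpa using h2
  · rw [mellin]
    simp only [smul_eq_mul]
    rw [Complex.integral_cpow_mul_exp_neg_mul_Ioi hs (by simpa using hX), one_div,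
      Complex.inv_cpow _ _ (by rw [Complex.arg_ofReal_of_nonneg hX.le]; exact Real.pi_pos.ne),
      Complex.cpow_neg]

lemma hasSum_exp_neg_mul (X t : ℝ) :
    HasSum (fun m : ℕ => (-X : ℂ) ^ m / m.factorial * (t : ℂ) ^ (m : ℂ)) (Complex.exp (-(X * t))) := by
  have h := NormedSpace.expSeries_div_hasSum_exp (-(X * t) : ℂ)
  rw [← Complex.exp_eq_exp_ℂ] at h
  refine h.congr_fun fun m => ?_
  rw [Complex.cpow_natCast, neg_mul_eq_neg_mul, mul_pow]
  ring

lemma continuous_exp_neg_mul (X : ℝ) : Continuous fun t : ℝ => Complex.exp (-(X * t)) := by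
  fun_prop

lemma norm_exp_neg_mul_le {X t : ℝ} (hX : 0 < X) (ht : 0 < t) :
    ‖Complex.exp (-(X * t))‖ ≤ X⁻¹ * t ^ (-1 : ℝ) := by
  rw [← Complex.ofReal_mul, ← Complex.ofReal_neg, Complex.norm_exp_ofReal, Real.rpow_neg_one,
    ← mul_inv, Real.exp_neg]
  have h : 0 < X * t := by positivity
  exact inv_anti₀ h (by linarith [Real.add_one_le_exp (X * t)])

lemma summable_norm_neg_pow_div_factorial (X x : ℝ) :
    Summable fun m : ℕ => ‖(-X : ℂ) ^ m / m.factorial‖ * x ^ ((m : ℂ)).re := by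
  refine ((Real.summable_pow_div_factorial (|X| * x))).congr fun m => ?_
  simp only [norm_div, norm_pow, norm_neg, Complex.norm_real, Complex.norm_natCast,
    Complex.natCast_re, Real.rpow_natCast, Real.norm_eq_abs, mul_pow]
  ring

lemma regMellin_exp {X : ℝ} (hX : 0 < X) {s : ℂ} (hs : s.re < 1) (hs' : s.im ≠ 0) :
    regMellin (fun m : ℕ => (-X : ℂ) ^ m / m.factorial) (fun m => (m : ℂ))
      (fun t => Complex.exp (-(X * t))) 1 s = (X : ℂ) ^ (-s) * Complex.Gamma s := by
  have hη : 0 < |s.im| / 2 := by positivity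
  refine regMellin_eq_of_strip (C := X⁻¹) (δ := 1) (η := |s.im| / 2)
    (φ := fun s => (X : ℂ) ^ (-s) * Complex.Gamma s) one_pos (fun m => by simp) ?_ ?_ one_pos
    (continuous_exp_neg_mul X).continuousOn ?_ hs hη (fun m => ?_) ?_ ?_
  · exact summable_norm_neg_pow_div_factorial X 1
  · intro x _ _
    exact hasSum_exp_neg_mul X x
  · intro x hx
    exact norm_exp_neg_mul_le hX (by linarith)
  · simp
    linarith
  · intro w hw hws
    have h1 : ∀ m : ℕ, w ≠ -m := by
      intro m h
      have := congrArg Complex.im h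
      simp only [Complex.neg_im, Complex.natCast_im, neg_zero] at this
      rw [this, zero_sub, abs_neg] at hws
      linarith
    have hX0 : (X : ℂ) ≠ 0 := by exact_mod_cast hX.ne'
    exact (differentiableAt_id.neg.const_cpow (Or.inl hX0)).mul (Complex.differentiableAt_Gamma _ h1)
  · intro w hw _ _
    exact mellinConvergent_exp_neg_mul hX hw

/-- `2 (√x) ^ (-ν) K_ν(2 √x)`, as a Mellin convolution. -/
noncomputable def macdonaldIntegral (ν : ℂ) (x : ℝ) : ℂ :=
  ∫ u in Ioi (0 : ℝ), Complex.exp (-(x * (u⁻¹ : ℝ))) * (Complex.exp (-((1 : ℝ) * u)) * (u : ℂ) ^ (-ν)) / u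

lemma norm_exp_mul_exp_cpow_div {ν : ℂ} (hν : ν.re = 0) (x : ℝ) {u : ℝ} (hu : 0 < u) :
    ‖Complex.exp (-(x * (u⁻¹ : ℝ))) * (Complex.exp (-((1 : ℝ) * u)) * (u : ℂ) ^ (-ν)) / u‖ =
      Real.exp (-(x * u⁻¹)) * Real.exp (-u) / u := by
  rw [norm_div, norm_mul, norm_mul, norm_cpow_of_re_eq_zero hu (by simp [hν]), Complex.norm_real,
    Real.norm_of_nonneg hu.le, ← Complex.ofReal_mul, ← Complex.ofReal_neg, ← Complex.ofReal_mul,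
    ← Complex.ofReal_neg, Complex.norm_exp_ofReal, Complex.norm_exp_ofReal, one_mul, mul_one]

lemma continuousOn_macdonald (ν : ℂ) (x : ℝ) : ContinuousOn (fun u : ℝ =>
    Complex.exp (-(x * (u⁻¹ : ℝ))) * (Complex.exp (-((1 : ℝ) * u)) * (u : ℂ) ^ (-ν)) / u)
    (Ioi 0) := by
  have h0 : ContinuousOn (fun u : ℝ => u⁻¹) (Ioi 0) :=
    continuousOn_inv₀.mono fun u hu => ne_of_gt hu
  refine ContinuousOn.div (ContinuousOn.mul ?_ (ContinuousOn.mul ?_ (continuousOn_cpow_Ioi _)))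
    Complex.continuous_ofReal.continuousOn fun u hu => by exact_mod_cast ne_of_gt hu
  · exact (continuous_exp_neg_mul x).comp_continuousOn h0
  · exact (continuous_exp_neg_mul 1).continuousOn

lemma integrableOn_macdonald {ν : ℂ} (hν : ν.re = 0) {x : ℝ} (hx : 0 < x) :
    IntegrableOn (fun u : ℝ =>
      Complex.exp (-(x * (u⁻¹ : ℝ))) * (Complex.exp (-((1 : ℝ) * u)) * (u : ℂ) ^ (-ν)) / u)
      (Ioi 0) := by
  have h1 : IntegrableOn (fun u : ℝ => x⁻¹ * Real.exp (-u)) (Ioi 0) := by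
    have := integrableOn_exp_neg_Ioi (0 : ℝ)
    exact this.const_mul _
  refine Integrable.mono' h1 ((continuousOn_macdonald ν x).aestronglyMeasurable measurableSet_Ioi) ?_
  filter_upwards [ae_restrict_mem measurableSet_Ioi] with u hu
  have hu0 : (0 : ℝ) < u := hu
  rw [norm_exp_mul_exp_cpow_div hν x hu0]
  have h2 : Real.exp (-(x * u⁻¹)) ≤ x⁻¹ * u := by
    have h : 0 < x * u⁻¹ := by positivity
    rw [Real.exp_neg]
    calc (Real.exp (x * u⁻¹))⁻¹ ≤ (x * u⁻¹)⁻¹ :=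
          inv_anti₀ h (by linarith [Real.add_one_le_exp (x * u⁻¹)])
      _ = x⁻¹ * u := by rw [mul_inv, inv_inv]
  calc _ ≤ x⁻¹ * u * Real.exp (-u) / u := by gcongr
    _ = _ := by field_simp

lemma tsum_unit_prod (g : Unit × ℕ → ℂ) : ∑' a, g a = ∑' k, g ((), k) :=
  ((Equiv.punitProd ℕ).symm.tsum_eq g).symm

lemma macdonaldIntegral_eq {ν : ℂ} (hν : ν.re = 0) (hν' : ν.im ≠ 0) {x : ℝ} (hx : 0 < x) :
    macdonaldIntegral ν x =
      ∑' k : ℕ, (-1 : ℂ) ^ k / k.factorial * ((x : ℂ) ^ (-(ν - k)) * Complex.Gamma (ν - k)) +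
      ∑' m : ℕ, (-x : ℂ) ^ m / m.factorial * Complex.Gamma (-m - ν) := by
  have hG : ∀ _ : Unit, ∀ u : ℝ, 0 < u → u ≤ 1 →
      HasSum (fun k : ℕ => (-(1 : ℝ) : ℂ) ^ k / k.factorial * (u : ℂ) ^ ((k : ℂ) - ν))
        (Complex.exp (-((1 : ℝ) * u)) * (u : ℂ) ^ (-ν)) := by
    intro _ u hu _
    refine ((hasSum_exp_neg_mul 1 u).mul_right ((u : ℂ) ^ (-ν))).congr_fun fun k => ?_
    rw [sub_eq_add_neg, Complex.cpow_add _ _ (by exact_mod_cast hu.ne')]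
    ring
  have hcε : ∀ i k : ℕ, |ν.im| ≤ ‖ν - k + i‖ := by
    intro i k
    refine le_trans (le_of_eq ?_) (Complex.abs_im_le_norm _)
    simp
  have hg : Summable fun jk : Unit × ℕ =>
      ‖(1 : ℂ)‖ * ‖(-(1 : ℝ) : ℂ) ^ jk.2 / jk.2.factorial‖ * (1 : ℝ) ^ jk.2 := by
    have := (summable_norm_neg_pow_div_factorial 1 1)
    refine (Equiv.summable_iff (Equiv.punitProd ℕ).symm).1 (this.congr fun k => ?_)
    simp
  have hint := integrableOn_macdonald hν hx
  have hGi : ∀ _ : Unit, IntegrableOn (fun u : ℝ =>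
      (Complex.exp (-((1 : ℝ) * u)) * (u : ℂ) ^ (-ν)) / u) (Ioi 1) := by
    intro _
    have h0 := (integrableOn_macdonald hν one_pos).mono_set (Ioi_subset_Ioi zero_le_one)
    have h1 : IntegrableOn (fun u : ℝ => Real.exp (-u)) (Ioi 1) := integrableOn_exp_neg_Ioi 1
    refine Integrable.mono' h1 ?_ ?_
    · refine ContinuousOn.aestronglyMeasurable (ContinuousOn.div (ContinuousOn.mul
        (continuous_exp_neg_mul 1).continuousOn ((continuousOn_cpow_Ioi _).mono
        (Ioi_subset_Ioi zero_le_one))) Complex.continuous_ofReal.continuousOn fun u hu => ?_)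
        measurableSet_Ioi
      exact_mod_cast (ne_of_gt (zero_lt_one.trans hu))
    · filter_upwards [ae_restrict_mem measurableSet_Ioi] with u hu
      have hu1 : (1 : ℝ) < u := hu
      have hu0 : (0 : ℝ) < u := by linarith
      have := norm_exp_mul_exp_cpow_div hν 0 hu0
      rw [Complex.ofReal_zero, zero_mul, zero_mul, neg_zero, neg_zero, Complex.exp_zero, one_mul,
        Real.exp_zero, one_mul] at this
      rw [this]
      exact div_le_self (Real.exp_pos _).le hu1.le
  have h := integral_conv_eq (x₀ := 1) (p := fun m : ℕ => (-x : ℂ) ^ m / m.factorial)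
    (α := fun m => (m : ℂ)) (f := fun t => Complex.exp (-(x * t))) (q := fun _ : Unit => 1)
    (g := fun _ k => (-(1 : ℝ) : ℂ) ^ k / k.factorial)
    (G := fun _ u => Complex.exp (-((1 : ℝ) * u)) * (u : ℂ) ^ (-ν))
    (h := fun u => Complex.exp (-((1 : ℝ) * u)) * (u : ℂ) ^ (-ν)) one_pos (fun m => by simp)
    (summable_norm_neg_pow_div_factorial x _) (fun u _ => hasSum_exp_neg_mul x u) one_pos
    (continuous_exp_neg_mul x).continuousOn (fun t ht => norm_exp_neg_mul_le hx ht) hν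
    (abs_pos.2 hν') hcε hg hG hGi (hasSum_fintype _).summable
    (fun u hu => by simp) hint
  have h3 := h.2.2
  rw [macdonaldIntegral, h3]
  congr 1
  · rw [tsum_unit_prod]
    refine tsum_congr fun k => ?_
    have := regMellin_exp hx (s := ν - k) (by simp [hν]; linarith [(Nat.cast_nonneg k : (0:ℝ) ≤ k)])
      (by simpa using hν')
    rw [inv_one, this]
    simp
  · rw [tsum_unit_prod]
    refine tsum_congr fun m => ?_
    have h1 := regMellin_exp one_pos (s := -m - ν)
      (by simp [hν]; linarith [(Nat.cast_nonneg m : (0:ℝ) ≤ m)]) (by simpa using hν')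
    have h2 : regMellin (fun k : ℕ => (-(1 : ℝ) : ℂ) ^ k / k.factorial) (fun k => (k : ℂ) - ν)
        (fun u => Complex.exp (-((1 : ℝ) * u)) * (u : ℂ) ^ (-ν)) 1 (-m)
        = Complex.Gamma (-m - ν) := by
      rw [Complex.ofReal_one, Complex.one_cpow, one_mul] at h1
      rw [← h1, regMellin, regMellin]
      congr 1
      · refine tsum_congr fun k => ?_
        rw [show (-m + ((k : ℂ) - ν)) = -m - ν + k by ring]
        simp
      · refine setIntegral_congr_fun measurableSet_Ioi fun u hu => ?_
        have hu0 : (u : ℂ) ≠ 0 := by exact_mod_cast (ne_of_gt (zero_lt_one.trans hu))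
        rw [show (-m - ν - 1 : ℂ) = -m - 1 + -ν by ring, Complex.cpow_add _ _ hu0]
        simp; ring
    rw [h2]
    simp

lemma image_mul_exp_univ {y : ℝ} (hy : 0 < y) :
    (fun t : ℝ => y * Real.exp t) '' univ = Ioi 0 := by
  ext u
  simp only [image_univ, mem_range, mem_Ioi]
  constructor
  · rintro ⟨t, rfl⟩; positivity
  · intro hu
    exact ⟨Real.log (u / y), by rw [Real.exp_log (by positivity)]; field_simp⟩

lemma integral_exp_cosh {ν : ℂ} (hν : ν.re = 0) {y : ℝ} (hy : 0 < y) :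
    ∫ t in Ioi (0 : ℝ), ((Real.exp (-2 * y * Real.cosh t) : ℝ) : ℂ) * Complex.cosh (ν * (t : ℂ)) =
      (y : ℂ) ^ ν * macdonaldIntegral ν (y ^ 2) / 2 := by
  have hd : ∀ t ∈ (univ : Set ℝ), HasDerivWithinAt (fun t : ℝ => y * Real.exp t)
      (y * Real.exp t) univ t := fun t _ => ((Real.hasDerivAt_exp t).const_mul y).hasDerivWithinAt
  have hinj : InjOn (fun t : ℝ => y * Real.exp t) univ := by
    intro a _ b _ h
    exact Real.exp_injective (mul_left_cancel₀ hy.ne' h)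
  have hg : ∀ t : ℝ, |y * Real.exp t| • (Complex.exp (-((y ^ 2 : ℝ) * ((y * Real.exp t)⁻¹ : ℝ))) *
      (Complex.exp (-((1 : ℝ) * (y * Real.exp t : ℝ))) * ((y * Real.exp t : ℝ) : ℂ) ^ (-ν)) /
      (y * Real.exp t : ℝ)) = (y : ℂ) ^ (-ν) *
        (((Real.exp (-2 * y * Real.cosh t) : ℝ) : ℂ) * Complex.exp (-(ν * t))) := by
    intro t
    have hpos : 0 < y * Real.exp t := by positivity
    have h1 : ((y * Real.exp t : ℝ) : ℂ) ^ (-ν) = (y : ℂ) ^ (-ν) * Complex.exp (-(ν * t)) := by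
      rw [Complex.ofReal_mul, Complex.mul_cpow_ofReal_nonneg hy.le (Real.exp_pos t).le,
        Complex.ofReal_exp, Complex.cpow_def_of_ne_zero (Complex.exp_ne_zero _),
        ← Complex.ofReal_exp, ← Complex.ofReal_log (Real.exp_pos t).le, Real.log_exp]
      congr 2; ring
    have h2 : ((Real.exp (-2 * y * Real.cosh t) : ℝ) : ℂ) =
        Complex.exp (-((y ^ 2 : ℝ) * ((y * Real.exp t)⁻¹ : ℝ))) *
          Complex.exp (-((1 : ℝ) * (y * Real.exp t : ℝ))) := by
      have hr : -2 * y * Real.cosh t =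
          -(y ^ 2 * (y * Real.exp t)⁻¹) + -(1 * (y * Real.exp t)) := by
        rw [Real.cosh_eq, Real.exp_neg]
        field_simp
        ring
      rw [← Complex.exp_add, hr]
      push_cast
      rfl
    have h3 : ((y * Real.exp t : ℝ) : ℂ) ≠ 0 := by exact_mod_cast hpos.ne'
    rw [abs_of_pos hpos, h1, h2, Complex.real_smul]
    field_simp
  have hint := integrableOn_macdonald hν (show 0 < y ^ 2 by positivity)
  rw [← image_mul_exp_univ hy,
    integrableOn_image_iff_integrableOn_abs_deriv_smul MeasurableSet.univ hd hinj] at hint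
  simp only [hg] at hint
  have hval : macdonaldIntegral ν (y ^ 2) = ∫ t : ℝ, (y : ℂ) ^ (-ν) *
        (((Real.exp (-2 * y * Real.cosh t) : ℝ) : ℂ) * Complex.exp (-(ν * t))) := by
    rw [macdonaldIntegral, ← image_mul_exp_univ hy,
      integral_image_eq_integral_abs_deriv_smul MeasurableSet.univ hd hinj]
    simp only [hg, setIntegral_univ]
  have hy0 : (y : ℂ) ≠ 0 := by exact_mod_cast hy.ne'
  have hyν : (y : ℂ) ^ (-ν) ≠ 0 := by simp [Complex.cpow_eq_zero_iff, hy0]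
  have hint' : Integrable fun t : ℝ =>
      ((Real.exp (-2 * y * Real.cosh t) : ℝ) : ℂ) * Complex.exp (-(ν * t)) := by
    have := (integrableOn_univ.1 hint).const_mul ((y : ℂ) ^ (-ν))⁻¹
    refine this.congr (Eventually.of_forall fun t => ?_)
    simp only []
    rw [inv_mul_cancel_left₀ hyν]
  have hneg := hint'.comp_neg
  rw [integral_const_mul] at hval
  rw [hval, ← mul_assoc, ← Complex.cpow_add _ _ hy0, add_neg_cancel, Complex.cpow_zero, one_mul,
    ← intervalIntegral.integral_Iic_add_Ioi hint'.integrableOn hint'.integrableOn (b := 0)]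
  have h4 := integral_comp_neg_Ioi (0 : ℝ) fun t : ℝ =>
      ((Real.exp (-2 * y * Real.cosh t) : ℝ) : ℂ) * Complex.exp (-(ν * t))
  rw [neg_zero] at h4
  rw [← h4, ← integral_add hneg.integrableOn hint'.integrableOn, ← integral_div]
  refine integral_congr_ae (Eventually.of_forall fun t => ?_)
  simp only [Real.cosh_neg, Complex.ofReal_neg, Complex.cosh]
  ring_nf

lemma sin_pi_mul_ne_zero_of_im {z : ℂ} (hz : z.im ≠ 0) : Complex.sin (Real.pi * z) ≠ 0 := by
  rw [Ne, Complex.sin_eq_zero_iff]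
  rintro ⟨k, hk⟩
  have := congrArg Complex.im hk
  simp [Real.pi_ne_zero, hz] at this

lemma cos_pi_mul_ne_zero_of_im {z : ℂ} (hz : z.im ≠ 0) : Complex.cos (Real.pi * z) ≠ 0 := by
  rw [← Complex.sin_add_pi_div_two, show (Real.pi * z + Real.pi / 2 : ℂ) = Real.pi * (z + 1 / 2) by
    ring]
  exact sin_pi_mul_ne_zero_of_im (by simpa using hz)

lemma Gamma_sub_natCast_eq {ν : ℂ} (hν : ν.re = 0) (hν' : ν.im ≠ 0) (k : ℕ) :
    Complex.Gamma (ν - k) =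
      Real.pi * (-1) ^ k / (Complex.sin (Real.pi * ν) * Complex.Gamma (k + -ν + 1)) := by
  have h1 := Complex.Gamma_mul_Gamma_one_sub (ν - k)
  have h2 : Complex.sin (Real.pi * (ν - k)) = (-1) ^ k * Complex.sin (Real.pi * ν) := by
    rw [mul_sub, mul_comm _ (k : ℂ), Complex.sin_antiperiodic.sub_nat_mul_eq]
  have h3 := sin_pi_mul_ne_zero_of_im hν'
  have h4 : Complex.Gamma (k + -ν + 1) ≠ 0 :=
    Gamma_natCast_add_add_one_ne_zero (by simp [hν]) k
  rw [show (1 - (ν - k) : ℂ) = k + -ν + 1 by ring, h2] at h1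
  rw [eq_div_iff (mul_ne_zero h3 h4)]
  have h5 : ((-1 : ℂ) ^ k) * (-1) ^ k = 1 := by rw [← mul_pow]; simp
  rw [eq_div_iff (mul_ne_zero (by simp) h3)] at h1
  linear_combination (-1) ^ k * h1 - Complex.Gamma (ν - k) * Complex.Gamma (k + -ν + 1) *
    Complex.sin (Real.pi * ν) * h5

lemma sqrt_cpow {x : ℝ} (hx : 0 < x) (z : ℂ) : ((√x : ℝ) : ℂ) ^ z = (x : ℂ) ^ (z / 2) := by
  have h := Real.sqrt_pos.2 hx
  rw [Complex.cpow_def_of_ne_zero (by exact_mod_cast h.ne'),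
    Complex.cpow_def_of_ne_zero (by exact_mod_cast hx.ne'), ← Complex.ofReal_log h.le,
    ← Complex.ofReal_log hx.le, Real.log_sqrt hx.le]
  push_cast
  congr 1; ring

lemma Ktilde_sqrt {ν : ℂ} (hν : ν.re = 0) {x : ℝ} (hx : 0 < x) :
    Ktilde ν (√x) = Complex.cos (Real.pi * ν / 2) * (x : ℂ) ^ (ν / 2) * macdonaldIntegral ν x := by
  rw [Ktilde, integral_exp_cosh hν (Real.sqrt_pos.2 hx), Real.sq_sqrt hx.le, sqrt_cpow hx]
  ring

lemma hasSum_bool_prod_of_summable {g : Bool × ℕ → ℂ} (h : Summable g) :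
    HasSum g (∑' m, g (true, m) + ∑' m, g (false, m)) :=
  hasSum_bool_prod (h.comp_injective (i := fun m => (true, m)) fun _ _ h => (Prod.mk.inj h).2).hasSum
    (h.comp_injective (i := fun m => (false, m)) fun _ _ h => (Prod.mk.inj h).2).hasSum

lemma summable_besselCoeff_cpow {ν η : ℂ} (hν : ν.re = 0) (hη : ‖η‖ ≤ 1) {x : ℝ} (hx : 0 < x) :
    Summable fun i => besselCoeff ν η i * (x : ℂ) ^ besselExp ν i := by
  refine Summable.of_norm ((summable_besselCoeff_rpow hν hη x hx.le).congr fun i => ?_)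
  rw [norm_mul, Complex.norm_cpow_eq_rpow_re_of_pos hx]

lemma neg_one_pow_mul_self (k : ℕ) : (-1 : ℂ) ^ k * (-1) ^ k = 1 := by rw [← mul_pow]; simp

lemma sin_pi_mul_eq_two_mul (ν : ℂ) : Complex.sin (Real.pi * ν) =
    2 * Complex.sin (Real.pi * ν / 2) * Complex.cos (Real.pi * ν / 2) := by
  rw [← Complex.sin_two_mul]; congr 1; ring

lemma hasSum_Ktilde {ν : ℂ} (hν : ν.re = 0) (hν' : ν.im ≠ 0) {x : ℝ} (hx : 0 < x) :
    HasSum (fun i => besselCoeff ν 1 i * (x : ℂ) ^ besselExp ν i) (Ktilde ν (√x)) := by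
  have hx0 : (x : ℂ) ≠ 0 := by exact_mod_cast hx.ne'
  have hsum := hasSum_bool_prod_of_summable (summable_besselCoeff_cpow hν (η := 1) (by simp) hx)
  have hsin : Complex.sin (Real.pi * ν / 2) ≠ 0 := by
    rw [mul_div_assoc]; exact sin_pi_mul_ne_zero_of_im (by simpa using hν')
  have hcos : Complex.cos (Real.pi * ν / 2) ≠ 0 := by
    rw [mul_div_assoc]; exact cos_pi_mul_ne_zero_of_im (by simpa using hν')
  have hxν : (x : ℂ) ^ (ν / 2) ≠ 0 := by simp [Complex.cpow_eq_zero_iff, hx0]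
  have key : Ktilde ν (√x) =
      ∑' m : ℕ, besselCoeff ν 1 (true, m) * (x : ℂ) ^ besselExp ν (true, m) +
        ∑' m : ℕ, besselCoeff ν 1 (false, m) * (x : ℂ) ^ besselExp ν (false, m) := by
    rw [Ktilde_sqrt hν hx, macdonaldIntegral_eq hν hν' hx, mul_add, add_comm, ← tsum_mul_left,
      ← tsum_mul_left]
    congr 1
    · refine tsum_congr fun m => ?_
      have h3 := Gamma_natCast_add_add_one_ne_zero hν m
      have h4 : (m.factorial : ℂ) ≠ 0 := by exact_mod_cast m.factorial_ne_zero
      have h5 : Complex.Gamma (-m - ν) = -(Real.pi * (-1) ^ m) / (2 * Complex.sin (Real.pi * ν / 2) *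
          Complex.cos (Real.pi * ν / 2) * Complex.Gamma (m + ν + 1)) := by
        rw [show (-m - ν : ℂ) = -ν - m by ring, Gamma_sub_natCast_eq (by simpa using hν)
          (by simpa using hν'), mul_neg, Complex.sin_neg, sin_pi_mul_eq_two_mul, neg_neg]
        field_simp
      rw [h5, besselCoeff, besselExp, boolSign_true, Complex.cpow_add _ _ hx0,
        Complex.cpow_natCast, one_mul, one_pow, neg_pow]
      field_simp
      linear_combination (-1) * neg_one_pow_mul_self m
    · refine tsum_congr fun m => ?_
      have h3 : Complex.Gamma (m + -ν + 1) ≠ 0 :=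
        Gamma_natCast_add_add_one_ne_zero (by simpa using hν) m
      have h4 : (m.factorial : ℂ) ≠ 0 := by exact_mod_cast m.factorial_ne_zero
      rw [besselCoeff, besselExp, boolSign_false, neg_one_mul ν, one_pow,
        Gamma_sub_natCast_eq hν hν', sin_pi_mul_eq_two_mul,
        show (-(ν - m) : ℂ) = -(ν / 2) + (m + -(ν / 2)) by ring, Complex.cpow_add _ _ hx0,
        neg_div, Complex.cpow_neg _ (ν / 2)]
      generalize (x : ℂ) ^ (m + -(ν / 2)) = w
      field_simp
      linear_combination w * neg_one_pow_mul_self m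
  rw [key]
  exact hsum

lemma exp_neg_le_rpow_neg_half {z : ℝ} (hz : 0 < z) : Real.exp (-z) ≤ z ^ (-(1 / 2) : ℝ) := by
  rw [Real.exp_neg, Real.rpow_neg hz.le, ← Real.sqrt_eq_rpow]
  refine inv_anti₀ (Real.sqrt_pos.2 hz) ?_
  have h1 := Real.add_one_le_exp z
  have h2 : √z ≤ z + 1 := by
    rw [Real.sqrt_le_left (by linarith)]
    nlinarith
  linarith

lemma norm_cosh_mul_le_one {ν : ℂ} (hν : ν.re = 0) (t : ℝ) : ‖Complex.cosh (ν * t)‖ ≤ 1 := by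
  rw [Complex.cosh, norm_div]
  have h1 : ‖Complex.exp (ν * t)‖ = 1 := by rw [Complex.norm_exp]; simp [hν]
  have h2 : ‖Complex.exp (-(ν * t))‖ = 1 := by rw [Complex.norm_exp]; simp [hν]
  have := norm_add_le (Complex.exp (ν * t)) (Complex.exp (-(ν * t)))
  rw [h1, h2] at this
  rw [RCLike.norm_ofNat, div_le_one (by norm_num)]
  linarith

lemma norm_Ktilde_le {ν : ℂ} (hν : ν.re = 0) {x : ℝ} (hx : 0 < x) :
    ‖Ktilde ν (√x)‖ ≤ 4 * ‖Complex.cos (Real.pi * ν / 2)‖ * x ^ (-(1 / 4) : ℝ) := by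
  have hy := Real.sqrt_pos.2 hx
  have hI : IntegrableOn (fun t : ℝ => Real.exp (-(1 / 2) * t)) (Ioi 0) :=
    integrableOn_exp_mul_Ioi (by norm_num) 0
  have hval : ∫ t in Ioi (0 : ℝ), Real.exp (-(1 / 2) * t) = 2 := by
    rw [integral_exp_mul_Ioi (by norm_num)]; norm_num
  have hb : ‖∫ t in Ioi (0 : ℝ), ((Real.exp (-2 * √x * Real.cosh t) : ℝ) : ℂ) *
      Complex.cosh (ν * (t : ℂ))‖ ≤ ∫ t in Ioi (0 : ℝ), x ^ (-(1 / 4) : ℝ) * Real.exp (-(1 / 2) * t) := by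
    refine norm_integral_le_of_norm_le (hI.const_mul _) (Eventually.of_forall fun t => ?_)
    rw [norm_mul, Complex.norm_real, Real.norm_of_nonneg (Real.exp_pos _).le]
    calc _ ≤ Real.exp (-2 * √x * Real.cosh t) * 1 :=
          mul_le_mul_of_nonneg_left (norm_cosh_mul_le_one hν t) (Real.exp_pos _).le
      _ ≤ Real.exp (-(√x * Real.exp t)) := by
          rw [mul_one, Real.exp_le_exp, Real.cosh_eq]
          nlinarith [mul_pos hy (Real.exp_pos (-t))]
      _ ≤ (√x * Real.exp t) ^ (-(1 / 2) : ℝ) := exp_neg_le_rpow_neg_half (by positivity)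
      _ = _ := by
          rw [Real.mul_rpow hy.le (Real.exp_pos t).le, ← Real.exp_mul, Real.sqrt_eq_rpow,
            ← Real.rpow_mul hx.le]
          rw [show (1 / 2 * -(1 / 2) : ℝ) = -(1 / 4) by norm_num, mul_comm t]
  rw [integral_const_mul, hval] at hb
  rw [Ktilde, norm_mul, norm_mul, RCLike.norm_ofNat]
  nlinarith [norm_nonneg (Complex.cos (Real.pi * ν / 2))]

lemma bounded_of_decay {ν η : ℂ} (hν : ν.re = 0) (hη : ‖η‖ ≤ 1) {F : ℝ → ℂ} {C : ℝ}
    (hF : ∀ x : ℝ, 0 < x → HasSum (fun i => besselCoeff ν η i * (x : ℂ) ^ besselExp ν i) (F x))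
    (hC : ∀ x : ℝ, 0 < x → ‖F x‖ ≤ C * x ^ (-(1 / 4) : ℝ)) :
    ∃ C, ∀ x : ℝ, 0 < x → ‖F x‖ ≤ C ∧ ‖F x‖ ≤ C * x ^ (-(1 / 4) : ℝ) := by
  have hs := summable_besselCoeff_rpow hν hη 1 zero_le_one
  refine ⟨max C (∑' i, ‖besselCoeff ν η i‖ * 1 ^ (besselExp ν i).re), fun x hx => ⟨?_, ?_⟩⟩
  · rcases le_total x 1 with h | h
    · refine le_trans ?_ (le_max_right _ _)
      rw [← (hF x hx).tsum_eq]
      refine tsum_of_norm_bounded hs.hasSum fun i => ?_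
      rw [norm_mul, Complex.norm_cpow_eq_rpow_re_of_pos hx]
      gcongr
      rw [besselExp_re hν]; positivity
    · have hC0 : 0 ≤ C := by
        have := (norm_nonneg _).trans (hC 1 one_pos)
        simpa using this
      refine le_trans ((hC x hx).trans ?_) (le_max_left _ _)
      exact mul_le_of_le_one_right hC0 (Real.rpow_le_one_of_one_le_of_nonpos h (by norm_num))
  · refine (hC x hx).trans ?_
    gcongr
    exact le_max_left _ _

lemma integrable_prod_of_continuousOn_Ioi {g : ℝ × ℝ → ℂ} (hg : ContinuousOn g (Ioi 0 ×ˢ Ioi 0))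
    (h1 : ∀ u : ℝ, 0 < u → IntegrableOn (fun x => g (x, u)) (Ioi 0))
    {b : ℝ → ℝ} (hb : IntegrableOn b (Ioi 0))
    (h2 : ∀ u : ℝ, 0 < u → ∫ x in Ioi (0 : ℝ), ‖g (x, u)‖ ≤ b u) :
    Integrable g ((volume.restrict (Ioi 0)).prod (volume.restrict (Ioi 0))) := by
  have hm : AEStronglyMeasurable g ((volume.restrict (Ioi 0)).prod (volume.restrict (Ioi 0))) := by
    rw [Measure.prod_restrict]
    exact hg.aestronglyMeasurable (measurableSet_Ioi.prod measurableSet_Ioi)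
  refine (integrable_prod_iff' hm).2 ⟨?_, ?_⟩
  · filter_upwards [ae_restrict_mem measurableSet_Ioi] with u hu using h1 u hu
  · refine Integrable.mono' hb hm.norm.prod_swap.integral_prod_right' ?_
    filter_upwards [ae_restrict_mem measurableSet_Ioi] with u hu
    rw [Real.norm_of_nonneg (integral_nonneg fun _ => norm_nonneg _)]
    exact h2 u hu

lemma mellin_Ktilde {ν : ℂ} (hν : ν.re = 0) {s : ℂ} (hs : 0 < s.re) :
    MellinConvergent (fun x => Ktilde ν (√x)) s ∧ mellin (fun x => Ktilde ν (√x)) s =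
      Complex.Gamma (s + ν / 2) * Complex.Gamma (s - ν / 2) * Complex.cos (Real.pi * ν / 2) := by
  set S : ℂ := s + ν / 2 with hS
  have hSre : S.re = s.re := by simp [hS, hν]
  have hSpos : 0 < S.re := hSre ▸ hs
  set g : ℝ × ℝ → ℂ := fun p => ((p.1 : ℂ) ^ (S - 1) * Complex.exp (-((p.2⁻¹ : ℝ) * p.1))) *
    (Complex.exp (-p.2) * (p.2 : ℂ) ^ (-ν) / p.2) with hg
  have hgc : ContinuousOn g (Ioi 0 ×ˢ Ioi 0) := by
    have e1 : ContinuousOn (fun p : ℝ × ℝ => (p.1 : ℂ) ^ (S - 1)) (Ioi 0 ×ˢ Ioi 0) :=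
      (continuousOn_cpow_Ioi _).comp continuousOn_fst fun p hp => hp.1
    have e2 : ContinuousOn (fun p : ℝ × ℝ => (p.2 : ℂ) ^ (-ν)) (Ioi 0 ×ˢ Ioi 0) :=
      (continuousOn_cpow_Ioi _).comp continuousOn_snd fun p hp => hp.2
    have e3 : ContinuousOn (fun p : ℝ × ℝ => p.2⁻¹) (Ioi 0 ×ˢ Ioi 0) :=
      continuousOn_snd.inv₀ fun p hp => ne_of_gt hp.2
    have e4 : ContinuousOn (fun p : ℝ × ℝ => (p.2 : ℂ)) (Ioi 0 ×ˢ Ioi 0) :=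
      Complex.continuous_ofReal.comp_continuousOn continuousOn_snd
    have e5 : ContinuousOn (fun p : ℝ × ℝ => (p.1 : ℂ)) (Ioi 0 ×ˢ Ioi 0) :=
      Complex.continuous_ofReal.comp_continuousOn continuousOn_fst
    refine (e1.mul (Complex.continuous_exp.comp_continuousOn
      ((Complex.continuous_ofReal.comp_continuousOn e3).mul e5).neg)).mul
      (((Complex.continuous_exp.comp_continuousOn e4.neg).mul e2).div e4 fun p hp => ?_)
    exact_mod_cast ne_of_gt hp.2
  have hmel : ∀ u : ℝ, 0 < u → IntegrableOn
      (fun x : ℝ => (x : ℂ) ^ (S - 1) * Complex.exp (-((u⁻¹ : ℝ) * x))) (Ioi 0) ∧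
      ∫ x in Ioi (0 : ℝ), (x : ℂ) ^ (S - 1) * Complex.exp (-((u⁻¹ : ℝ) * x)) =
        (u : ℂ) ^ S * Complex.Gamma S := by
    intro u hu
    have h := mellinConvergent_exp_neg_mul (inv_pos.2 hu) hSpos
    refine ⟨h.1, h.2.trans ?_⟩
    rw [Complex.ofReal_inv, Complex.inv_cpow _ _ (by
      rw [Complex.arg_ofReal_of_nonneg hu.le]; exact Real.pi_pos.ne), Complex.cpow_neg, inv_inv]
  have hnorm : ∀ u : ℝ, 0 < u → ∫ x in Ioi (0 : ℝ), ‖g (x, u)‖ =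
      Real.Gamma s.re * (u ^ (s.re - 1) * Real.exp (-u)) := by
    intro u hu
    have hu' : ‖Complex.exp (-u) * (u : ℂ) ^ (-ν) / u‖ = Real.exp (-u) / u := by
      rw [norm_div, norm_mul, norm_cpow_of_re_eq_zero hu (by simp [hν]), Complex.norm_real,
        Real.norm_of_nonneg hu.le, ← Complex.ofReal_neg, Complex.norm_exp_ofReal, mul_one]
    have : ∀ x ∈ Ioi (0 : ℝ), ‖g (x, u)‖ =
        x ^ (s.re - 1) * Real.exp (-(u⁻¹ * x)) * (Real.exp (-u) / u) := by
      intro x hx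
      simp only [hg]
      rw [norm_mul, hu', norm_mul, Complex.norm_cpow_eq_rpow_re_of_pos hx, ← Complex.ofReal_mul,
        ← Complex.ofReal_neg, Complex.norm_exp_ofReal, Complex.sub_re, hSre, Complex.one_re]
    rw [setIntegral_congr_fun measurableSet_Ioi this, integral_mul_const,
      Real.integral_rpow_mul_exp_neg_mul_Ioi hs (inv_pos.2 hu), one_div, inv_inv,
      Real.rpow_sub_one hu.ne']
    ring
  have hbint : IntegrableOn (fun u : ℝ => Real.Gamma s.re * (u ^ (s.re - 1) * Real.exp (-u)))
      (Ioi 0) := by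
    refine Integrable.const_mul ?_ _
    refine (Real.GammaIntegral_convergent hs).congr_fun (fun u _ => ?_) measurableSet_Ioi
    simp only []; ring
  have hgi := integrable_prod_of_continuousOn_Ioi hgc (fun u hu =>
    (hmel u hu).1.mul_const (Complex.exp (-u) * (u : ℂ) ^ (-ν) / u)) hbint fun u hu => (hnorm u hu).le
  have hF : ∀ x ∈ Ioi (0 : ℝ), (x : ℂ) ^ (s - 1) • Ktilde ν (√x) =
      Complex.cos (Real.pi * ν / 2) * ∫ u in Ioi (0 : ℝ), g (x, u) := by
    intro x hx
    have hx0 : (x : ℂ) ≠ 0 := by exact_mod_cast (ne_of_gt hx)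
    have : ∫ u in Ioi (0 : ℝ), g (x, u) = (x : ℂ) ^ (S - 1) * macdonaldIntegral ν x := by
      rw [macdonaldIntegral, ← integral_const_mul]
      refine setIntegral_congr_fun measurableSet_Ioi fun u hu => ?_
      simp only [hg]
      rw [mul_comm (x : ℂ) ((u⁻¹ : ℝ) : ℂ), Complex.ofReal_one, one_mul]
      ring
    rw [this, Ktilde_sqrt hν hx, smul_eq_mul, show S - 1 = (s - 1) + ν / 2 by rw [hS]; ring,
      Complex.cpow_add _ _ hx0]
    ring
  refine ⟨?_, ?_⟩
  · refine IntegrableOn.congr_fun ?_ (fun x hx => (hF x hx).symm) measurableSet_Ioi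
    exact hgi.integral_prod_left.const_mul _
  · rw [mellin, setIntegral_congr_fun measurableSet_Ioi hF, integral_const_mul,
      integral_integral_swap hgi]
    have : ∀ u ∈ Ioi (0 : ℝ), ∫ x in Ioi (0 : ℝ), g (x, u) =
        Complex.Gamma S * (Complex.exp (-u) * (u : ℂ) ^ (s - ν / 2 - 1)) := by
      intro u hu
      have hu0 : (u : ℂ) ≠ 0 := by exact_mod_cast (ne_of_gt hu)
      simp only [hg]
      have hc : (u : ℂ) ^ (s - ν / 2 - 1) = (u : ℂ) ^ S * (u : ℂ) ^ (-ν) * (u : ℂ)⁻¹ := by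
        rw [show s - ν / 2 - 1 = S + (-ν) + (-1) by rw [hS]; ring, Complex.cpow_add _ _ hu0,
          Complex.cpow_add _ _ hu0, Complex.cpow_neg_one]
      rw [integral_mul_const, (hmel u hu).2, hc]
      field_simp
    rw [setIntegral_congr_fun measurableSet_Ioi this, integral_const_mul]
    rw [Complex.Gamma_eq_integral (s := s - ν / 2) (by simpa [hν] using hs), Complex.GammaIntegral]
    ring_nf
    simp

lemma besselKernel_Ktilde {ν : ℂ} (hν : ν.re = 0) (hν' : ν.im ≠ 0) :
    BesselKernel ν 1 (fun _ => Complex.cos (Real.pi * ν / 2)) (fun x => Ktilde ν (√x)) where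
  hasSum _ hx := hasSum_Ktilde hν hν' hx
  bounded := bounded_of_decay hν (by simp) (fun _ hx => hasSum_Ktilde hν hν' hx)
    fun _ hx => norm_Ktilde_le hν hx
  mellin _ hs _ := mellin_Ktilde hν hs

/-- Coefficients of the Bessel function `J_ν(2√x)` as a series in `x`. -/
noncomputable def besCoeff (ν : ℂ) (m : ℕ) : ℂ :=
  (-1) ^ m / (m.factorial * Complex.Gamma (m + ν + 1))

/-- The Bessel function `J_ν(2√x)`. -/
noncomputable def bes (ν : ℂ) (x : ℝ) : ℂ := ∑' m : ℕ, besCoeff ν m * (x : ℂ) ^ (m + ν / 2)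

lemma norm_besCoeff_le {ν : ℂ} (hν : ν.re = 0) (m : ℕ) :
    ‖besCoeff ν m‖ ≤ ‖Complex.Gamma (1 + ν)‖⁻¹ * (1 / (m.factorial * m.factorial)) := by
  have h1 := factorial_mul_norm_Gamma_le hν m
  have h2 := norm_Gamma_one_add_pos hν
  have h4 : (0 : ℝ) < m.factorial := by positivity
  rw [besCoeff]
  simp only [norm_div, norm_mul, norm_pow, norm_neg, norm_one, one_pow, Complex.norm_natCast]
  calc 1 / (m.factorial * ‖Complex.Gamma (m + ν + 1)‖)
      ≤ 1 / (m.factorial * (m.factorial * ‖Complex.Gamma (1 + ν)‖)) := by gcongr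
    _ = _ := by field_simp

lemma summable_besCoeff_mul_pow {ν : ℂ} (hν : ν.re = 0) {R : ℝ} (hR : 0 ≤ R) (j : ℕ) :
    Summable fun m : ℕ => ‖besCoeff ν m‖ * ‖(m + ν / 2 : ℂ)‖ ^ j * R ^ m := by
  have hG := norm_Gamma_one_add_pos hν
  refine Summable.of_nonneg_of_le (fun m => by positivity) (fun m => ?_)
    ((Real.summable_pow_div_factorial (Real.exp 1 * R)).mul_left
      (‖Complex.Gamma (1 + ν)‖⁻¹ * (j.factorial * Real.exp ‖ν / 2‖)))
  have h1 := norm_besCoeff_le hν m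
  have h2 : ‖(m + ν / 2 : ℂ)‖ ^ j ≤ j.factorial * (Real.exp ‖ν / 2‖ * Real.exp 1 ^ m) := by
    have h3 : ‖(m + ν / 2 : ℂ)‖ ≤ ‖ν / 2‖ + m := by
      refine (norm_add_le _ _).trans ?_
      rw [Complex.norm_natCast, add_comm]
    have h4 := Real.pow_div_factorial_le_exp (‖ν / 2‖ + m) (by positivity) j
    rw [div_le_iff₀ (by positivity), Real.exp_add, show (m : ℝ) = m * 1 by ring, Real.exp_nat_mul,
      mul_one] at h4
    calc _ ≤ (‖ν / 2‖ + m) ^ j := by gcongr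
      _ ≤ _ := h4
      _ = _ := by ring
  have h5 : (1 : ℝ) ≤ m.factorial := by exact_mod_cast m.factorial_pos
  calc _ ≤ ‖Complex.Gamma (1 + ν)‖⁻¹ * (1 / (m.factorial * 1)) *
        (j.factorial * (Real.exp ‖ν / 2‖ * Real.exp 1 ^ m)) * R ^ m := by
        refine mul_le_mul_of_nonneg_right (mul_le_mul (h1.trans ?_) h2 (by positivity)
          (by positivity)) (by positivity)
        gcongr
    _ = _ := by rw [mul_pow]; ring

lemma norm_besCoeff_mul_cpow {ν : ℂ} (hν : ν.re = 0) {x : ℝ} (hx : 0 < x) (m : ℕ) :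
    ‖besCoeff ν m * (x : ℂ) ^ (m + ν / 2)‖ = ‖besCoeff ν m‖ * x ^ m := by
  rw [norm_mul, Complex.norm_cpow_eq_rpow_re_of_pos hx]
  simp [hν]

lemma summable_besCoeff {ν : ℂ} (hν : ν.re = 0) {x : ℝ} (hx : 0 ≤ x) :
    Summable fun m : ℕ => ‖besCoeff ν m‖ * x ^ m := by
  simpa using summable_besCoeff_mul_pow hν hx 0

lemma hasSum_bes {ν : ℂ} (hν : ν.re = 0) {x : ℝ} (hx : 0 < x) :
    HasSum (fun m : ℕ => besCoeff ν m * (x : ℂ) ^ (m + ν / 2)) (bes ν x) := by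
  refine (Summable.of_norm ((summable_besCoeff hν hx.le).congr fun m => ?_)).hasSum
  rw [norm_besCoeff_mul_cpow hν hx]

lemma besselJ_two_mul_sqrt (ν : ℂ) {x : ℝ} (hx : 0 < x) : besselJ ν (2 * √x) = bes ν x := by
  refine tsum_congr fun m => ?_
  rw [mul_div_cancel_left₀ _ two_ne_zero, sqrt_cpow hx, besCoeff,
    show (ν + 2 * (m : ℂ)) / 2 = m + ν / 2 by ring, add_comm ν]
  ring

lemma Jminus_sqrt (ν : ℂ) {x : ℝ} (hx : 0 < x) : Jminus ν (√x) =
    Real.pi / (2 * Complex.sin (Real.pi * ν / 2)) * (bes (-ν) x - bes ν x) := by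
  rw [Jminus, besselJ_two_mul_sqrt _ hx, besselJ_two_mul_sqrt _ hx]
  ring

lemma hasSum_Jminus {ν : ℂ} (hν : ν.re = 0) {x : ℝ} (hx : 0 < x) :
    HasSum (fun i => besselCoeff ν (-1) i * (x : ℂ) ^ besselExp ν i) (Jminus ν (√x)) := by
  have h1 := (hasSum_bes hν hx).mul_left (-(Real.pi / (2 * Complex.sin (Real.pi * ν / 2))))
  have h2 := (hasSum_bes (ν := -ν) (by simpa using hν) hx).mul_left
    (Real.pi / (2 * Complex.sin (Real.pi * ν / 2)))
  rw [Jminus_sqrt ν hx, mul_sub, sub_eq_neg_add, ← neg_mul]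
  refine hasSum_bool_prod (h1.congr_fun fun m => ?_) (h2.congr_fun fun m => ?_)
  · rw [besselCoeff, besselExp, besCoeff, boolSign_true, one_mul]
    ring
  · rw [besselCoeff, besselExp, besCoeff, boolSign_false, neg_one_mul]
    ring

/-- The `j`-th derivative of `t ↦ J_ν(2e^{t/2})`. -/
noncomputable def besDeriv (ν : ℂ) (j : ℕ) (t : ℝ) : ℂ :=
  ∑' m : ℕ, besCoeff ν m * (m + ν / 2) ^ j * Complex.exp ((m + ν / 2) * t)

lemma norm_besDeriv_term {ν : ℂ} (hν : ν.re = 0) (j m : ℕ) (t : ℝ) :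
    ‖besCoeff ν m * (m + ν / 2) ^ j * Complex.exp ((m + ν / 2) * t)‖ =
      ‖besCoeff ν m‖ * ‖(m + ν / 2 : ℂ)‖ ^ j * Real.exp t ^ m := by
  rw [norm_mul, norm_mul, norm_pow, Complex.norm_exp, ← Real.exp_nat_mul]
  simp [hν]

lemma summable_besDeriv {ν : ℂ} (hν : ν.re = 0) (j : ℕ) (t : ℝ) : Summable fun m : ℕ =>
    besCoeff ν m * (m + ν / 2) ^ j * Complex.exp ((m + ν / 2) * t) :=
  Summable.of_norm ((summable_besCoeff_mul_pow hν (Real.exp_pos t).le j).congr fun m =>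
    (norm_besDeriv_term hν j m t).symm)

lemma hasDerivAt_besDeriv {ν : ℂ} (hν : ν.re = 0) (j : ℕ) (t : ℝ) :
    HasDerivAt (besDeriv ν j) (besDeriv ν (j + 1) t) t := by
  have ht : t ∈ Iio (t + 1) := by simp
  have hd : ∀ (m : ℕ) (y : ℝ), y ∈ Iio (t + 1) → HasDerivAt
      (fun y : ℝ => besCoeff ν m * (m + ν / 2) ^ j * Complex.exp ((m + ν / 2) * y))
      (besCoeff ν m * (m + ν / 2) ^ (j + 1) * Complex.exp ((m + ν / 2) * y)) y := by
    intro m y _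
    have h : HasDerivAt (fun y : ℝ => ((m : ℂ) + ν / 2) * y) (m + ν / 2) y := by
      simpa using (Complex.ofRealCLM.hasDerivAt (x := y)).const_mul ((m : ℂ) + ν / 2)
    refine (h.cexp.const_mul (besCoeff ν m * (m + ν / 2) ^ j)).congr_deriv ?_
    ring
  have hb : ∀ (m : ℕ) (y : ℝ), y ∈ Iio (t + 1) →
      ‖besCoeff ν m * (m + ν / 2) ^ (j + 1) * Complex.exp ((m + ν / 2) * y)‖ ≤
      ‖besCoeff ν m‖ * ‖(m + ν / 2 : ℂ)‖ ^ (j + 1) * Real.exp (t + 1) ^ m := by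
    intro m y hy
    rw [norm_besDeriv_term hν]
    have : Real.exp y ≤ Real.exp (t + 1) := Real.exp_le_exp.2 (le_of_lt hy)
    gcongr
  exact hasDerivAt_tsum_of_isPreconnected
    (summable_besCoeff_mul_pow hν (Real.exp_pos (t + 1)).le (j + 1)) isOpen_Iio isPreconnected_Iio
    hd hb ht (summable_besDeriv hν j t) ht

lemma besDeriv_two {ν : ℂ} (hν : ν.re = 0) (t : ℝ) :
    besDeriv ν 2 t = -(Real.exp t - ν ^ 2 / 4) * besDeriv ν 0 t := by
  have h : besDeriv ν 2 t - ν ^ 2 / 4 * besDeriv ν 0 t = -Real.exp t * besDeriv ν 0 t := by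
    rw [besDeriv, besDeriv, ← tsum_mul_left, ← tsum_mul_left,
      ← (summable_besDeriv hν 2 t).tsum_sub ((summable_besDeriv hν 0 t).mul_left _)]
    have hs := (summable_besDeriv hν 2 t).sub ((summable_besDeriv hν 0 t).mul_left (ν ^ 2 / 4))
    rw [hs.tsum_eq_zero_add]
    have h0 : ∀ m : ℕ, besCoeff ν m = -((m + 1) * (m + 1 + ν)) * besCoeff ν (m + 1) := by
      intro m
      have h1 := Gamma_natCast_add_add_one_ne_zero hν m
      have h2 : (m + ν + 1 : ℂ) ≠ 0 := by
        intro h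
        have := congrArg Complex.re h
        simp [hν] at this
        linarith [(Nat.cast_nonneg m : (0 : ℝ) ≤ m)]
      have h3 : (m.factorial : ℂ) ≠ 0 := by exact_mod_cast m.factorial_ne_zero
      have h4 : (m + 1 : ℂ) ≠ 0 := by exact_mod_cast m.succ_ne_zero
      rw [besCoeff, besCoeff, Nat.factorial_succ,
        show ((m + 1 : ℕ) + ν + 1 : ℂ) = (m + ν + 1) + 1 by push_cast; ring,
        Complex.Gamma_add_one _ h2]
      push_cast
      field_simp
      ring
    have hz : besCoeff ν 0 * (((0 : ℕ) : ℂ) + ν / 2) ^ 2 * Complex.exp ((((0 : ℕ) : ℂ) + ν / 2) * t) -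
        ν ^ 2 / 4 * (besCoeff ν 0 * (((0 : ℕ) : ℂ) + ν / 2) ^ 0 *
          Complex.exp ((((0 : ℕ) : ℂ) + ν / 2) * t)) = 0 := by
      push_cast; ring
    rw [hz, zero_add]
    refine tsum_congr fun m => ?_
    rw [h0 m, Complex.ofReal_exp, show (((m + 1 : ℕ) : ℂ) + ν / 2) * t = t + (m + ν / 2) * t by
      push_cast; ring, Complex.exp_add]
    push_cast
    ring
  linear_combination h

lemma bes_exp (ν : ℂ) (t : ℝ) : bes ν (Real.exp t) = besDeriv ν 0 t := by
  refine tsum_congr fun m => ?_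
  rw [pow_zero, mul_one, Complex.cpow_def_of_ne_zero (by simp),
    ← Complex.ofReal_log (Real.exp_pos t).le, Real.log_exp, mul_comm (t : ℂ)]

/-- A decreasing energy for the differential equation satisfied by `t ↦ J_ν(2e^{t/2})`. -/
noncomputable def besEnergy (ν : ℂ) (t : ℝ) : ℝ :=
  Real.exp (-(t / 2)) * (((besDeriv ν 1 t).re + (besDeriv ν 0 t).re / 4) ^ 2 +
    ((besDeriv ν 1 t).im + (besDeriv ν 0 t).im / 4) ^ 2) +
  (Real.exp (t / 2) + (1 / 16 + ν.im ^ 2 / 4) * Real.exp (-(t / 2))) *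
    ((besDeriv ν 0 t).re ^ 2 + (besDeriv ν 0 t).im ^ 2)

lemma antitone_besEnergy {ν : ℂ} (hν : ν.re = 0) : Antitone (besEnergy ν) := by
  have hre : ∀ j t, HasDerivAt (fun t => (besDeriv ν j t).re) (besDeriv ν (j + 1) t).re t :=
    fun j t => Complex.reCLM.hasFDerivAt.comp_hasDerivAt t (hasDerivAt_besDeriv hν j t)
  have him : ∀ j t, HasDerivAt (fun t => (besDeriv ν j t).im) (besDeriv ν (j + 1) t).im t :=
    fun j t => Complex.imCLM.hasFDerivAt.comp_hasDerivAt t (hasDerivAt_besDeriv hν j t)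
  have hE : ∀ t, HasDerivAt (besEnergy ν) (-((1 / 16 + ν.im ^ 2 / 4) * Real.exp (-(t / 2)) *
      ((besDeriv ν 0 t).re ^ 2 + (besDeriv ν 0 t).im ^ 2))) t := by
    intro t
    have e1 : HasDerivAt (fun t : ℝ => Real.exp (t / 2)) (Real.exp (t / 2) * (1 / 2)) t :=
      ((hasDerivAt_id t).div_const 2).exp
    have e2 : HasDerivAt (fun t : ℝ => Real.exp (-(t / 2))) (Real.exp (-(t / 2)) * (-(1 / 2))) t :=
      ((hasDerivAt_id t).div_const 2).neg.exp
    have hν2 : ν ^ 2 = ((-ν.im ^ 2 : ℝ) : ℂ) := by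
      apply Complex.ext <;> simp [pow_two, hν]
    have h2 : besDeriv ν 2 t = ((-(Real.exp t + ν.im ^ 2 / 4) : ℝ) : ℂ) * besDeriv ν 0 t := by
      rw [besDeriv_two hν, hν2]; push_cast; ring
    have h2re := congrArg Complex.re h2
    have h2im := congrArg Complex.im h2
    rw [Complex.re_ofReal_mul] at h2re
    rw [Complex.im_ofReal_mul] at h2im
    have hx : Real.exp t * Real.exp (-(t / 2)) = Real.exp (t / 2) := by
      rw [← Real.exp_add]; congr 1; ring
    have := (e2.mul ((((hre 1 t).add ((hre 0 t).div_const 4)).pow 2).add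
      (((him 1 t).add ((him 0 t).div_const 4)).pow 2))).add
      ((e1.add (e2.const_mul (1 / 16 + ν.im ^ 2 / 4))).mul (((hre 0 t).pow 2).add ((him 0 t).pow 2)))
    refine this.congr_deriv ?_
    simp only [Pi.add_apply, Pi.pow_apply]
    norm_num
    rw [h2re, h2im]
    set p := (besDeriv ν 0 t).re
    set q := (besDeriv ν 0 t).im
    set a := (besDeriv ν 1 t).re
    set b := (besDeriv ν 1 t).im
    set T := Real.exp (-(t / 2))
    linear_combination (-2 * p * (a + p / 4) - 2 * q * (b + q / 4)) * hx
  refine antitone_of_hasDerivAt_nonpos hE fun t => ?_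
  have := Real.exp_pos (-(t / 2))
  have : 0 ≤ (1 / 16 + ν.im ^ 2 / 4) * Real.exp (-(t / 2)) *
      ((besDeriv ν 0 t).re ^ 2 + (besDeriv ν 0 t).im ^ 2) := by positivity
  simpa using this

lemma norm_bes_le {ν : ℂ} (hν : ν.re = 0) :
    ∃ C, ∀ x : ℝ, 0 < x → ‖bes ν x‖ ≤ C ∧ ‖bes ν x‖ ≤ C * x ^ (-(1 / 4) : ℝ) := by
  have hs := summable_besCoeff hν zero_le_one
  set C1 := ∑' m, ‖besCoeff ν m‖ * 1 ^ m
  have hC1 : 0 ≤ C1 := tsum_nonneg fun m => by positivity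
  set C2 := √(besEnergy ν 0)
  have hsmall : ∀ x : ℝ, 0 < x → x ≤ 1 → ‖bes ν x‖ ≤ C1 := by
    intro x hx h
    refine tsum_of_norm_bounded hs.hasSum fun m => ?_
    rw [norm_besCoeff_mul_cpow hν hx]
    gcongr
  have hlarge : ∀ x : ℝ, 1 ≤ x → ‖bes ν x‖ ≤ C2 * x ^ (-(1 / 4) : ℝ) := by
    intro x h
    have hx : 0 < x := by linarith
    have h1 := antitone_besEnergy hν (Real.log_nonneg h)
    have h2 : Real.exp (Real.log x / 2) * ‖bes ν x‖ ^ 2 ≤ besEnergy ν (Real.log x) := by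
      have h3 : bes ν x = besDeriv ν 0 (Real.log x) := by rw [← bes_exp, Real.exp_log hx]
      rw [h3, ← Complex.normSq_eq_norm_sq, Complex.normSq_apply, besEnergy]
      have := Real.exp_pos (-(Real.log x / 2))
      have := Real.exp_pos (Real.log x / 2)
      set p := (besDeriv ν 0 (Real.log x)).re
      set q := (besDeriv ν 0 (Real.log x)).im
      have h4 : 0 ≤ Real.exp (-(Real.log x / 2)) * (((besDeriv ν 1 (Real.log x)).re + p / 4) ^ 2 +
        ((besDeriv ν 1 (Real.log x)).im + q / 4) ^ 2) := by positivity
      have h5 : 0 ≤ (1 / 16 + ν.im ^ 2 / 4) * Real.exp (-(Real.log x / 2)) * (p ^ 2 + q ^ 2) := by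
        positivity
      linarith
    have h3 : Real.exp (Real.log x / 2) = (x ^ (1 / 4 : ℝ)) ^ 2 := by
      rw [Real.rpow_def_of_pos hx, ← Real.exp_nat_mul]; congr 1; push_cast; ring
    have h4 : x ^ (1 / 4 : ℝ) * ‖bes ν x‖ ≤ C2 := by
      refine Real.le_sqrt_of_sq_le ?_
      rw [mul_pow, ← h3]
      linarith
    rw [Real.rpow_neg hx.le, ← div_eq_mul_inv, le_div_iff₀ (by positivity)]
    linarith
  refine ⟨max C1 C2, fun x hx => ?_⟩
  rcases le_total x 1 with h | h
  · have h1 := (hsmall x hx h).trans (le_max_left C1 C2)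
    exact ⟨h1, h1.trans (le_mul_of_one_le_right (hC1.trans (le_max_left _ _))
      (Real.one_le_rpow_of_pos_of_le_one_of_nonpos hx h (by norm_num)))⟩
  · have h1 : ‖bes ν x‖ ≤ max C1 C2 * x ^ (-(1 / 4) : ℝ) := by
      refine (hlarge x h).trans ?_
      gcongr
      exact le_max_right _ _
    exact ⟨h1.trans (mul_le_of_le_one_right (hC1.trans (le_max_left _ _))
      (Real.rpow_le_one_of_one_le_of_nonpos h (by norm_num))), h1⟩

lemma continuousOn_bes {ν : ℂ} (hν : ν.re = 0) : ContinuousOn (bes ν) (Ioi 0) := by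
  have hre : ∀ m : ℕ, (m + ν / 2 : ℂ).re = m := fun m => by simp [hν]
  refine continuousOn_of_hasSum_cpow (fun m => ?_) (fun x hx => ?_) fun x hx => hasSum_bes hν hx
  · rw [hre]; positivity
  · refine (summable_besCoeff hν hx.le).congr fun m => ?_
    rw [hre, Real.rpow_natCast]

lemma integrableOn_rpow_mul_exp_neg {a : ℝ} (ha : 0 < a) :
    IntegrableOn (fun x : ℝ => x ^ (a - 1) * Real.exp (-x)) (Ioi 0) :=
  (Real.GammaIntegral_convergent ha).congr_fun (fun x _ => by simp only []; ring) measurableSet_Ioi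

/-- A function bounded near `0` and decaying like `x ^ (-1/4)` has a Mellin transform in a strip. -/
lemma mellinConvergent_of_bounds {f : ℝ → ℂ} (hf : ContinuousOn f (Ioi 0)) {C : ℝ}
    (hC : ∀ x : ℝ, 0 < x → ‖f x‖ ≤ C ∧ ‖f x‖ ≤ C * x ^ (-(1 / 4) : ℝ)) {s : ℂ} (hs : 0 < s.re)
    (hs' : s.re < 1 / 4) : MellinConvergent f s := by
  have hm : ContinuousOn (fun x : ℝ => (x : ℂ) ^ (s - 1) • f x) (Ioi 0) :=
    (continuousOn_cpow_Ioi _).smul hf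
  rw [MellinConvergent, ← Ioc_union_Ioi_eq_Ioi zero_le_one]
  refine IntegrableOn.union ?_ ?_
  · have h1 : IntegrableOn (fun x : ℝ => C * x ^ (s.re - 1)) (Ioc 0 1) := by
      refine Integrable.const_mul ?_ C
      rw [← IntegrableOn, ← intervalIntegrable_iff_integrableOn_Ioc_of_le zero_le_one]
      exact intervalIntegral.intervalIntegrable_rpow' (by linarith)
    refine Integrable.mono' h1 ((hm.mono Ioc_subset_Ioi_self).aestronglyMeasurable
      measurableSet_Ioc) ?_
    filter_upwards [ae_restrict_mem measurableSet_Ioc] with x hx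
    rw [norm_smul, Complex.norm_cpow_eq_rpow_re_of_pos hx.1, mul_comm]
    have := (hC x hx.1).1
    have h0 : 0 ≤ x ^ (s - 1).re := Real.rpow_nonneg hx.1.le _
    simp only [Complex.sub_re, Complex.one_re] at h0 ⊢
    exact mul_le_mul_of_nonneg_right this h0
  · have h1 : IntegrableOn (fun x : ℝ => C * x ^ (s.re - 1 - 1 / 4)) (Ioi 1) :=
      (integrableOn_Ioi_rpow_of_lt (by linarith) one_pos).const_mul C
    refine Integrable.mono' h1 ((hm.mono (Ioi_subset_Ioi zero_le_one)).aestronglyMeasurable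
      measurableSet_Ioi) ?_
    filter_upwards [ae_restrict_mem measurableSet_Ioi] with x hx
    have hx0 : 0 < x := zero_lt_one.trans hx
    rw [norm_smul, Complex.norm_cpow_eq_rpow_re_of_pos hx0, sub_eq_add_neg _ (1 / 4 : ℝ),
      Real.rpow_add hx0, Complex.sub_re, Complex.one_re, mul_comm, mul_left_comm, mul_comm C]
    rw [mul_comm _ C, mul_comm]
    exact mul_le_mul_of_nonneg_left (hC x hx0).2 (Real.rpow_nonneg hx0.le _)

lemma integral_bes_mul_exp {ν : ℂ} (hν : ν.re = 0) {X : ℝ} (hX : 0 < X) :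
    ∫ x in Ioi (0 : ℝ), bes ν (X * x) * (Complex.exp (-x) * (x : ℂ) ^ (ν / 2)) =
      (X : ℂ) ^ (ν / 2) * Complex.exp (-X) := by
  have hX0 : (X : ℂ) ≠ 0 := by exact_mod_cast hX.ne'
  set F : ℕ → ℝ → ℂ := fun m x => besCoeff ν m * (X : ℂ) ^ (m + ν / 2) *
    (Complex.exp (-x) * (x : ℂ) ^ ((m + ν + 1 : ℂ) - 1)) with hF
  have hre : ∀ m : ℕ, (m + ν + 1 : ℂ).re = m + 1 := fun m => by simp [hν]
  have hpos : ∀ m : ℕ, 0 < (m + ν + 1 : ℂ).re := fun m => by rw [hre]; positivity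
  have hFi : ∀ m, Integrable (F m) (volume.restrict (Ioi 0)) := fun m =>
    ((Complex.GammaIntegral_convergent (hpos m)).congr_fun
      (fun x _ => by simp) measurableSet_Ioi).const_mul _
  have hval : ∀ m, ∫ x in Ioi (0 : ℝ), F m x = (X : ℂ) ^ (ν / 2) * ((-X) ^ m / m.factorial) := by
    intro m
    have h1 : ∫ x in Ioi (0 : ℝ), F m x = besCoeff ν m * (X : ℂ) ^ (m + ν / 2) *
        Complex.Gamma (m + ν + 1) := by
      rw [Complex.Gamma_eq_integral (hpos m), Complex.GammaIntegral, ← integral_const_mul]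
      simp [hF]
    have h2 := Gamma_natCast_add_add_one_ne_zero hν m
    rw [h1, besCoeff, Complex.cpow_add _ _ hX0, Complex.cpow_natCast, neg_pow (X : ℂ)]
    field_simp
  have hnorm : ∀ m, ∫ x in Ioi (0 : ℝ), ‖F m x‖ = ‖besCoeff ν m‖ * X ^ m * m.factorial := by
    intro m
    have h1 : ∀ x ∈ Ioi (0 : ℝ), ‖F m x‖ = ‖besCoeff ν m‖ * X ^ m *
        (Real.exp (-x) * x ^ ((m + 1 : ℝ) - 1)) := by
      intro x hx
      simp only [hF]
      rw [norm_mul, norm_besCoeff_mul_cpow hν hX, norm_mul, Complex.norm_cpow_eq_rpow_re_of_pos hx,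
        Complex.sub_re, hre, ← Complex.ofReal_neg, Complex.norm_exp_ofReal, Complex.one_re]
    rw [setIntegral_congr_fun measurableSet_Ioi h1, integral_const_mul,
      ← Real.Gamma_eq_integral (by positivity), Real.Gamma_nat_eq_factorial]
  have hFs : Summable fun m => ∫ x in Ioi (0 : ℝ), ‖F m x‖ := by
    have hG := norm_Gamma_one_add_pos hν
    refine Summable.of_nonneg_of_le (fun m => by rw [hnorm]; positivity) (fun m => ?_)
      ((Real.summable_pow_div_factorial X).mul_left ‖Complex.Gamma (1 + ν)‖⁻¹)
    rw [hnorm]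
    have := norm_besCoeff_le hν m
    calc _ ≤ ‖Complex.Gamma (1 + ν)‖⁻¹ * (1 / (m.factorial * m.factorial)) * X ^ m *
          m.factorial := by gcongr
      _ = _ := by field_simp
  have h := hasSum_integral_of_summable_integral_norm hFi hFs
  have h2 : HasSum (fun m : ℕ => (X : ℂ) ^ (ν / 2) * ((-X : ℂ) ^ m / m.factorial))
      ((X : ℂ) ^ (ν / 2) * Complex.exp (-X)) := by
    have := (hasSum_exp_neg_mul X 1).mul_left ((X : ℂ) ^ (ν / 2))
    simpa using this
  rw [← h2.tsum_eq, ← tsum_congr hval, h.tsum_eq]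
  refine setIntegral_congr_fun measurableSet_Ioi fun x hx => ?_
  have hx0 : (0 : ℝ) < x := hx
  have hxc : (x : ℂ) ≠ 0 := by exact_mod_cast hx0.ne'
  rw [← (hasSum_bes hν (mul_pos hX hx0)).tsum_eq, ← tsum_mul_right]
  refine tsum_congr fun m => ?_
  simp only [hF]
  have hsplit : (x : ℂ) ^ (m + ν + 1 - 1 : ℂ) = (x : ℂ) ^ (m + ν / 2 : ℂ) * (x : ℂ) ^ (ν / 2) := by
    rw [← Complex.cpow_add _ _ hxc]; congr 1; ring
  rw [Complex.ofReal_mul, Complex.mul_cpow_ofReal_nonneg hX.le hx0.le, hsplit]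
  ring

lemma mellin_bes_mul_Gamma {ν : ℂ} (hν : ν.re = 0) {s : ℂ} (hs : 0 < s.re) (hs' : s.re < 1 / 4) :
    mellin (bes ν) s * Complex.Gamma (1 - s + ν / 2) = Complex.Gamma (s + ν / 2) := by
  obtain ⟨C, hC⟩ := norm_bes_le hν
  have hmc := mellinConvergent_of_bounds (continuousOn_bes hν) hC hs hs'
  set g : ℝ × ℝ → ℂ := fun p => (p.1 : ℂ) ^ (s - 1) * bes ν (p.2 * p.1) *
    (Complex.exp (-p.2) * (p.2 : ℂ) ^ (ν / 2)) with hg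
  have hgc : ContinuousOn g (Ioi 0 ×ˢ Ioi 0) := by
    have e1 : ContinuousOn (fun p : ℝ × ℝ => (p.1 : ℂ) ^ (s - 1)) (Ioi 0 ×ˢ Ioi 0) :=
      (continuousOn_cpow_Ioi _).comp continuousOn_fst fun p hp => hp.1
    have e2 : ContinuousOn (fun p : ℝ × ℝ => (p.2 : ℂ) ^ (ν / 2)) (Ioi 0 ×ˢ Ioi 0) :=
      (continuousOn_cpow_Ioi _).comp continuousOn_snd fun p hp => hp.2
    have e4 : ContinuousOn (fun p : ℝ × ℝ => (p.2 : ℂ)) (Ioi 0 ×ˢ Ioi 0) :=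
      Complex.continuous_ofReal.comp_continuousOn continuousOn_snd
    have e5 : ContinuousOn (fun p : ℝ × ℝ => bes ν (p.2 * p.1)) (Ioi 0 ×ˢ Ioi 0) :=
      (continuousOn_bes hν).comp (continuousOn_snd.mul continuousOn_fst)
        fun p hp => mul_pos (mem_Ioi.1 hp.2) (mem_Ioi.1 hp.1)
    exact (e1.mul e5).mul ((Complex.continuous_exp.comp_continuousOn e4.neg).mul e2)
  have hscale : ∀ u : ℝ, 0 < u → MellinConvergent (fun x => bes ν (u * x)) s ∧
      mellin (fun x => bes ν (u * x)) s = (u : ℂ) ^ (-s) * mellin (bes ν) s := fun u hu =>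
    ⟨(MellinConvergent.comp_mul_left hu).2 hmc, by rw [mellin_comp_mul_left _ _ hu, smul_eq_mul]⟩
  set M := ∫ y in Ioi (0 : ℝ), ‖(y : ℂ) ^ (s - 1) * bes ν y‖
  have hnorm : ∀ u : ℝ, 0 < u → ∫ x in Ioi (0 : ℝ), ‖g (x, u)‖ =
      M * (u ^ ((1 - s.re) - 1) * Real.exp (-u)) := by
    intro u hu
    have hu' : ‖Complex.exp (-u) * (u : ℂ) ^ (ν / 2)‖ = Real.exp (-u) := by
      rw [norm_mul, norm_cpow_of_re_eq_zero hu (by simp [hν]),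
        ← Complex.ofReal_neg, Complex.norm_exp_ofReal, mul_one]
    have : ∀ x ∈ Ioi (0 : ℝ), ‖g (x, u)‖ = (Real.exp (-u) * u ^ (1 - s.re)) *
        ‖((u * x : ℝ) : ℂ) ^ (s - 1) * bes ν (u * x)‖ := by
      intro x hx
      have hx0 : (0 : ℝ) < x := hx
      have h1 : u ^ (1 - s.re) * u ^ (s.re - 1) = 1 := by
        rw [← Real.rpow_add hu]; simp
      simp only [hg]
      rw [norm_mul, hu', norm_mul, norm_mul, Complex.norm_cpow_eq_rpow_re_of_pos hx,
        Complex.norm_cpow_eq_rpow_re_of_pos (mul_pos hu hx0), Real.mul_rpow hu.le hx0.le,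
        Complex.sub_re, Complex.one_re]
      linear_combination (-Real.exp (-u) * x ^ (s.re - 1) * ‖bes ν (u * x)‖) * h1
    rw [setIntegral_congr_fun measurableSet_Ioi this, integral_const_mul,
      integral_comp_mul_left_Ioi (fun y : ℝ => ‖(y : ℂ) ^ (s - 1) * bes ν y‖) 0 hu, mul_zero,
      smul_eq_mul, Real.rpow_sub_one hu.ne']
    ring
  have hgi := integrable_prod_of_continuousOn_Ioi hgc (fun u hu =>
    (hscale u hu).1.mul_const (Complex.exp (-u) * (u : ℂ) ^ (ν / 2)))
    ((integrableOn_rpow_mul_exp_neg (by linarith : 0 < 1 - s.re)).const_mul M)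
    fun u hu => (hnorm u hu).le
  have hswap := integral_integral_swap (f := fun x u => g (x, u)) hgi
  have hL : ∀ x ∈ Ioi (0 : ℝ), ∫ u in Ioi (0 : ℝ), g (x, u) =
      Complex.exp (-x) * (x : ℂ) ^ ((s + ν / 2) - 1) := by
    intro x hx
    have hx0 : (x : ℂ) ≠ 0 := by exact_mod_cast (ne_of_gt hx)
    have h1 := integral_bes_mul_exp hν hx
    rw [show s + ν / 2 - 1 = (s - 1) + ν / 2 by ring, Complex.cpow_add _ _ hx0]
    simp only [hg, mul_assoc]
    rw [integral_const_mul]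
    simp only [mul_comm _ x]
    rw [h1]
    ring
  have hR : ∀ u ∈ Ioi (0 : ℝ), ∫ x in Ioi (0 : ℝ), g (x, u) =
      mellin (bes ν) s * (Complex.exp (-u) * (u : ℂ) ^ ((1 - s + ν / 2) - 1)) := by
    intro u hu
    have hu0 : (u : ℂ) ≠ 0 := by exact_mod_cast (ne_of_gt hu)
    have h1 := (hscale u hu).2
    rw [mellin] at h1
    simp only [smul_eq_mul] at h1
    simp only [hg]
    rw [integral_mul_const, h1, show 1 - s + ν / 2 - 1 = -s + ν / 2 by ring,
      Complex.cpow_add _ _ hu0]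
    ring
  rw [setIntegral_congr_fun measurableSet_Ioi hL, setIntegral_congr_fun measurableSet_Ioi hR,
    integral_const_mul] at hswap
  rw [Complex.Gamma_eq_integral (s := s + ν / 2) (by simpa [hν] using hs),
    Complex.Gamma_eq_integral (s := 1 - s + ν / 2) (by simp [hν]; linarith),
    Complex.GammaIntegral, Complex.GammaIntegral]
  simpa using hswap.symm

lemma mellin_bes {ν : ℂ} (hν : ν.re = 0) {s : ℂ} (hs : 0 < s.re) (hs' : s.re < 1 / 4) :
    mellin (bes ν) s = Complex.Gamma (s + ν / 2) * Complex.Gamma (s - ν / 2) *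
      (Complex.sin (Real.pi * (s - ν / 2)) / Real.pi) := by
  have h1 := mellin_bes_mul_Gamma hν hs hs'
  have h2 := Complex.Gamma_mul_Gamma_one_sub (s - ν / 2)
  have h3 : Complex.Gamma (1 - s + ν / 2) ≠ 0 :=
    Complex.Gamma_ne_zero_of_re_pos (by simp [hν]; linarith)
  have h4 : Complex.Gamma (s - ν / 2) ≠ 0 :=
    Complex.Gamma_ne_zero_of_re_pos (by simp [hν]; linarith)
  have hpi : (Real.pi : ℂ) ≠ 0 := by exact_mod_cast Real.pi_ne_zero
  rw [show 1 - (s - ν / 2) = 1 - s + ν / 2 by ring] at h2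
  have h5 : Complex.sin (Real.pi * (s - ν / 2)) ≠ 0 := by
    intro h
    rw [h, div_zero] at h2
    exact mul_ne_zero h4 h3 h2
  rw [eq_div_iff h5] at h2
  refine mul_right_cancel₀ h3 ?_
  rw [h1, ← mul_div_assoc, div_mul_eq_mul_div, eq_div_iff hpi]
  linear_combination (-Complex.Gamma (s + ν / 2)) * h2

lemma besselKernel_Jminus {ν : ℂ} (hν : ν.re = 0) (hν' : ν.im ≠ 0) :
    BesselKernel ν (-1) (fun s => Complex.cos (Real.pi * s)) (fun x => Jminus ν (√x)) where
  hasSum _ hx := hasSum_Jminus hν hx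
  bounded := by
    have hn : (-ν).re = 0 := by simpa using hν
    obtain ⟨C, hC⟩ := norm_bes_le hν
    obtain ⟨D, hD⟩ := norm_bes_le hn
    refine bounded_of_decay hν (by simp) (fun _ hx => hasSum_Jminus hν hx)
      (C := ‖(Real.pi / (2 * Complex.sin (Real.pi * ν / 2)) : ℂ)‖ * (D + C)) fun x hx => ?_
    rw [Jminus_sqrt ν hx, norm_mul, mul_assoc, add_mul]
    refine mul_le_mul_of_nonneg_left ((norm_sub_le _ _).trans ?_) (norm_nonneg _)
    exact add_le_add (hD x hx).2 (hC x hx).2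
  mellin s hs hs' := by
    have hn : (-ν).re = 0 := by simpa using hν
    obtain ⟨C, hC⟩ := norm_bes_le hν
    obtain ⟨D, hD⟩ := norm_bes_le hn
    have h1 := mellinConvergent_of_bounds (continuousOn_bes hν) hC hs hs'
    have h2 := mellinConvergent_of_bounds (continuousOn_bes hn) hD hs hs'
    have hs0 : Complex.sin (Real.pi * ν / 2) ≠ 0 := by
      rw [mul_div_assoc]; exact sin_pi_mul_ne_zero_of_im (by simpa using hν')
    set κ : ℂ := Real.pi / (2 * Complex.sin (Real.pi * ν / 2)) with hκ
    have hEq : EqOn (fun x : ℝ => (x : ℂ) ^ (s - 1) • Jminus ν (√x)) (fun x : ℝ =>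
        κ * ((x : ℂ) ^ (s - 1) • bes (-ν) x - (x : ℂ) ^ (s - 1) • bes ν x)) (Ioi 0) := by
      intro x hx
      simp only [smul_eq_mul]
      rw [Jminus_sqrt ν hx]
      ring
    refine ⟨?_, ?_⟩
    · exact IntegrableOn.congr_fun ((h2.sub h1).const_mul κ) hEq.symm measurableSet_Ioi
    · have h3 : mellin (fun x => Jminus ν (√x)) s = κ * (mellin (bes (-ν)) s - mellin (bes ν) s) := by
        rw [mellin, setIntegral_congr_fun measurableSet_Ioi hEq, integral_const_mul,
          integral_sub h2 h1, mellin, mellin]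
      rw [h3, mellin_bes hν hs hs', mellin_bes hn hs hs', hκ]
      have hpi : (Real.pi : ℂ) ≠ 0 := by exact_mod_cast Real.pi_ne_zero
      have h4 : Complex.sin (Real.pi * (s - -ν / 2)) - Complex.sin (Real.pi * (s - ν / 2)) =
          2 * Complex.cos (Real.pi * s) * Complex.sin (Real.pi * ν / 2) := by
        rw [show Real.pi * (s - -ν / 2) = Real.pi * s + Real.pi * ν / 2 by ring,
          show Real.pi * (s - ν / 2) = Real.pi * s - Real.pi * ν / 2 by ring,
          Complex.sin_add, Complex.sin_sub]
        ring
      rw [show s + -ν / 2 = s - ν / 2 by ring]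
      rw [show Complex.Gamma (s - -ν / 2) = Complex.Gamma (s + ν / 2) by congr 1; ring]
      generalize Complex.sin (Real.pi * (s - -ν / 2)) = a at *
      generalize Complex.sin (Real.pi * (s - ν / 2)) = b at *
      generalize Complex.Gamma (s + ν / 2) = A
      generalize Complex.Gamma (s - ν / 2) = B
      field_simp
      linear_combination A * B * h4

lemma differentiableAt_Gamma_of_im_ne_zero {z : ℂ} (hz : z.im ≠ 0) :
    DifferentiableAt ℂ Complex.Gamma z := by
  refine Complex.differentiableAt_Gamma z fun m h => hz ?_
  rw [h]
  simp

section Scaling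

variable {ν η : ℂ} {w : ℂ → ℂ} {F : ℝ → ℂ}

lemma besselExp_im (i : Bool × ℕ) :
    (besselExp ν i).im = (ν / 2).im ∨ (besselExp ν i).im = -(ν / 2).im := by
  rcases i with ⟨b, m⟩
  cases b
  · right
    simp [besselExp, neg_div]
  · left
    simp [besselExp]

lemma norm_besselExp_le (i : Bool × ℕ) : ‖besselExp ν i‖ ≤ i.2 + ‖ν‖ := by
  rw [besselExp]
  refine (norm_add_le _ _).trans ?_
  rw [norm_div, norm_mul, norm_boolSign, Complex.norm_natCast]
  have := norm_nonneg ν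
  norm_num

/-- Coefficients of the expansion of `F (X * ·)` for a Bessel kernel `F`. -/
noncomputable def scaledCoeff (ν η : ℂ) (X : ℝ) (i : Bool × ℕ) : ℂ :=
  besselCoeff ν η i * (X : ℂ) ^ besselExp ν i

lemma summable_scaledCoeff (hν : ν.re = 0) (hη : ‖η‖ ≤ 1) {X : ℝ} (hX : 0 < X) {x : ℝ}
    (hx : 0 < x) : Summable fun i => ‖scaledCoeff ν η X i‖ * x ^ (besselExp ν i).re := by
  refine (summable_besselCoeff_rpow hν hη (X * x) (by positivity)).congr fun i => ?_
  rw [scaledCoeff, norm_mul, Complex.norm_cpow_eq_rpow_re_of_pos hX, Real.mul_rpow hX.le hx.le]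
  ring

lemma BesselKernel.continuousOn (hF : BesselKernel ν η w F) (hν : ν.re = 0) (hη : ‖η‖ ≤ 1) :
    ContinuousOn F (Ioi 0) :=
  continuousOn_of_hasSum_cpow (p := besselCoeff ν η) (α := besselExp ν)
    (fun i => by rw [besselExp_re hν]; positivity)
    (fun x hx => summable_besselCoeff_rpow hν hη x hx.le) hF.hasSum

lemma BesselKernel.continuousOn_comp_mul (hF : BesselKernel ν η w F) (hν : ν.re = 0)
    (hη : ‖η‖ ≤ 1) {X : ℝ} (hX : 0 < X) : ContinuousOn (fun x => F (X * x)) (Ioi 0) :=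
  (hF.continuousOn hν hη).comp (by fun_prop) fun x hx => mul_pos hX hx

lemma BesselKernel.hasSum_comp_mul (hF : BesselKernel ν η w F) {X x : ℝ} (hX : 0 < X)
    (hx : 0 < x) :
    HasSum (fun i => scaledCoeff ν η X i * (x : ℂ) ^ besselExp ν i) (F (X * x)) := by
  refine (hF.hasSum (X * x) (mul_pos hX hx)).congr_fun fun i => ?_
  rw [scaledCoeff, Complex.ofReal_mul, Complex.mul_cpow_ofReal_nonneg hX.le hx.le]
  ring

lemma BesselKernel.exists_bound (hF : BesselKernel ν η w F) {X : ℝ} (hX : 0 < X) :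
    ∃ C, 0 ≤ C ∧ ∀ x, 0 < x → ‖F (X * x)‖ ≤ C ∧ ‖F (X * x)‖ ≤ C * x ^ (-(1 / 4) : ℝ) := by
  obtain ⟨C, hC⟩ := hF.bounded
  have hC0 : 0 ≤ C := (norm_nonneg _).trans (hC 1 one_pos).1
  refine ⟨C + C * X ^ (-(1 / 4) : ℝ), by positivity, fun x hx => ⟨?_, ?_⟩⟩
  · refine (hC _ (mul_pos hX hx)).1.trans ?_
    have : 0 ≤ C * X ^ (-(1 / 4) : ℝ) := by positivity
    linarith
  · refine (hC _ (mul_pos hX hx)).2.trans ?_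
    rw [Real.mul_rpow hX.le hx.le, ← mul_assoc]
    gcongr
    linarith

lemma BesselKernel.regMellin_eq (hF : BesselKernel ν η w F) (hν : ν.re = 0) (hη : ‖η‖ ≤ 1)
    (hw : Differentiable ℂ w) {X : ℝ} (hX : 0 < X) {c : ℂ} (hc : c.re = 0)
    (h1 : (c + ν / 2).im ≠ 0) (h2 : (c - ν / 2).im ≠ 0) (k : ℕ) :
    regMellin (scaledCoeff ν η X) (besselExp ν) (fun x => F (X * x)) 2 (c - k) =
      (X : ℂ) ^ (k - c) *
        (Complex.Gamma (c - k + ν / 2) * Complex.Gamma (c - k - ν / 2) * w (c - k)) := by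
  obtain ⟨C, -, hC⟩ := hF.exists_bound hX
  have hX0 : (X : ℂ) ≠ 0 := by exact_mod_cast hX.ne'
  set e : ℝ := min |(c + ν / 2).im| |(c - ν / 2).im| / 2 with he
  have he0 : 0 < e := by
    have := lt_min (abs_pos.2 h1) (abs_pos.2 h2)
    positivity
  have hle1 : 2 * e ≤ |(c + ν / 2).im| := by
    have := min_le_left |(c + ν / 2).im| |(c - ν / 2).im|
    linarith
  have hle2 : 2 * e ≤ |(c - ν / 2).im| := by
    have := min_le_right |(c + ν / 2).im| |(c - ν / 2).im|
    linarith
  have him : ∀ z : ℂ, ∀ t : ℝ, 2 * e ≤ |c.im + t| → |z.im - (c - k).im| < e → z.im + t ≠ 0 := by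
    intro z t ht hz h
    rw [Complex.sub_im, Complex.natCast_im, sub_zero] at hz
    have : c.im + t = -(z.im - c.im) := by linarith
    rw [this, abs_neg] at ht
    linarith
  have key := regMellin_eq_of_strip (p := scaledCoeff ν η X) (α := besselExp ν)
    (f := fun x => F (X * x)) (x₀ := 2) (C := C) (δ := 1 / 4) (s := c - k) (η := e)
    (φ := fun s => (X : ℂ) ^ (-s) * (Complex.Gamma (s + ν / 2) * Complex.Gamma (s - ν / 2) * w s))
    two_pos (fun i => by rw [besselExp_re hν]; positivity)
    (summable_scaledCoeff hν hη hX two_pos) (fun x hx _ => hF.hasSum_comp_mul hX hx)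
    (by norm_num) (hF.continuousOn_comp_mul hν hη hX)
    (fun x hx => (hC x (by linarith)).2)
    (by
      rw [Complex.sub_re, hc, Complex.natCast_re]
      have : (0 : ℝ) ≤ k := k.cast_nonneg
      linarith)
    he0
    (fun i => by
      rw [Complex.add_im, Complex.sub_im, Complex.natCast_im, sub_zero]
      rcases besselExp_im (ν := ν) i with h | h
      · rw [h, ← Complex.add_im]
        exact hle1
      · rw [h, ← sub_eq_add_neg, ← Complex.sub_im]
        exact hle2)
    (fun z _ hz => by
      have d1 : DifferentiableAt ℂ (fun s => Complex.Gamma (s + ν / 2)) z := by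
        refine DifferentiableAt.comp z (differentiableAt_Gamma_of_im_ne_zero ?_) (by fun_prop)
        rw [Complex.add_im]
        exact him z _ (by rwa [← Complex.add_im]) hz
      have d2 : DifferentiableAt ℂ (fun s => Complex.Gamma (s - ν / 2)) z := by
        refine DifferentiableAt.comp z (differentiableAt_Gamma_of_im_ne_zero ?_) (by fun_prop)
        rw [Complex.sub_im, sub_eq_add_neg]
        exact him z _ (by rwa [← sub_eq_add_neg, ← Complex.sub_im]) hz
      have d3 : DifferentiableAt ℂ (fun s : ℂ => (X : ℂ) ^ (-s)) z :=
        (differentiableAt_id.neg).const_cpow (Or.inl hX0)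
      exact d3.mul ((d1.mul d2).mul (hw z)))
    (fun z hz1 hz2 _ => by
      obtain ⟨m1, m2⟩ := hF.mellin z hz1 hz2
      refine ⟨(MellinConvergent.comp_mul_left hX).2 m1, ?_⟩
      rw [mellin_comp_mul_left F z hX, m2, smul_eq_mul])
  rw [key]
  simp only [neg_sub]

end Scaling

lemma integrableOn_rpow_mul_one_add_inv :
    IntegrableOn (fun x : ℝ => x ^ (-(3 / 4) : ℝ) * (1 + x)⁻¹) (Ioi 0) := by
  have hm : ContinuousOn (fun x : ℝ => x ^ (-(3 / 4) : ℝ) * (1 + x)⁻¹) (Ioi 0) := by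
    refine ContinuousOn.mul (fun x hx => ?_) (fun x hx => ?_)
    · exact (Real.continuousAt_rpow_const _ _ (Or.inl (ne_of_gt hx))).continuousWithinAt
    · have : (1 + x) ≠ 0 := by have : 0 < x := hx; positivity
      exact (ContinuousAt.inv₀ (by fun_prop) this).continuousWithinAt
  have hu : Ioc (0 : ℝ) 1 ∪ Ioi 1 = Ioi 0 := Ioc_union_Ioi_eq_Ioi zero_le_one
  rw [← hu]
  refine IntegrableOn.union ?_ ?_
  · have h1 : IntegrableOn (fun x : ℝ => x ^ (-(3 / 4) : ℝ)) (Ioc 0 1) :=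
      (intervalIntegrable_iff_integrableOn_Ioc_of_le zero_le_one).1
        (intervalIntegral.intervalIntegrable_rpow' (by norm_num))
    refine Integrable.mono' h1 ((hm.mono Ioc_subset_Ioi_self).aestronglyMeasurable
      measurableSet_Ioc) ?_
    filter_upwards [ae_restrict_mem measurableSet_Ioc] with x hx
    have hx0 : 0 < x := hx.1
    rw [Real.norm_of_nonneg (by positivity)]
    exact mul_le_of_le_one_right (by positivity) (inv_le_one_of_one_le₀ (by linarith))
  · have h1 : IntegrableOn (fun x : ℝ => x ^ (-(7 / 4) : ℝ)) (Ioi 1) :=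
      integrableOn_Ioi_rpow_of_lt (by norm_num) one_pos
    refine Integrable.mono' h1 ((hm.mono (Ioi_subset_Ioi zero_le_one)).aestronglyMeasurable
      measurableSet_Ioi) ?_
    filter_upwards [ae_restrict_mem measurableSet_Ioi] with x hx
    have hx0 : 0 < x := one_pos.trans hx
    rw [Real.norm_of_nonneg (by positivity), show (-(7 / 4) : ℝ) = -(3 / 4) + -1 by norm_num,
      Real.rpow_add hx0, Real.rpow_neg_one]
    gcongr
    linarith

section Conv

variable {ν η θ : ℂ} {w v : ℂ → ℂ} {F G : ℝ → ℂ} {X Y : ℝ}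

/-- The integrand on `(0, ∞)` arising from the first and last double Bessel integrals. -/
noncomputable def convAdd (F G : ℝ → ℂ) (X Y : ℝ) (c : ℂ) (x : ℝ) : ℂ :=
  F (X * x⁻¹) * (G (Y * (1 + x)⁻¹) * (1 + x : ℂ) ^ (c - 1) * (x : ℂ) ^ (-c)) / x

/-- The integrand on `(0, 1)` arising from the middle double Bessel integral. -/
noncomputable def convSub (F G : ℝ → ℂ) (X Y : ℝ) (c : ℂ) (x : ℝ) : ℂ :=
  F (X * x⁻¹) * (G (Y * (1 - x)⁻¹) * (1 - x : ℂ) ^ (c - 1) * (x : ℂ) ^ (-c)) / x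

lemma exists_norm_convAdd_le (hF : BesselKernel ν η w F) (hG : BesselKernel ν θ v G)
    (hX : 0 < X) (hY : 0 < Y) : ∃ C, ∀ c : ℂ, c.re = 0 → ∀ x, 0 < x →
      ‖convAdd F G X Y c x‖ ≤ C * (x ^ (-(3 / 4) : ℝ) * (1 + x)⁻¹) := by
  obtain ⟨A, hA0, hA⟩ := hF.exists_bound hX
  obtain ⟨B, hB0, hB⟩ := hG.exists_bound hY
  refine ⟨A * B, fun c hc x hx => ?_⟩
  have h1 := (hA x⁻¹ (by positivity)).2
  have h2 := (hB (1 + x)⁻¹ (by positivity)).1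
  rw [convAdd, norm_div, norm_mul, norm_mul, norm_mul, norm_one_add_cpow hx,
    norm_cpow_of_re_eq_zero hx (by simp [hc]), Complex.norm_real, Real.norm_of_nonneg hx.le]
  rw [Real.inv_rpow hx.le, Real.rpow_neg hx.le, inv_inv] at h1
  simp only [Complex.sub_re, hc, Complex.one_re, zero_sub, Real.rpow_neg_one, mul_one]
  calc _ ≤ (A * x ^ (1 / 4 : ℝ)) * (B * (1 + x)⁻¹) / x := by gcongr
    _ = A * B * ((x ^ (1 / 4 : ℝ) * x ^ (-1 : ℝ)) * (1 + x)⁻¹) := by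
        rw [Real.rpow_neg_one]
        ring
    _ = _ := by rw [← Real.rpow_add hx]; norm_num

lemma exists_norm_convSub_le (hF : BesselKernel ν η w F) (hG : BesselKernel ν θ v G)
    (hX : 0 < X) (hY : 0 < Y) : ∃ C, ∀ c : ℂ, c.re = 0 → ∀ x, 0 < x → x ≤ 1 / 2 →
      ‖convSub F G X Y c x‖ ≤ C * (x ^ (-(3 / 4) : ℝ) * (1 + x)⁻¹) := by
  obtain ⟨A, hA0, hA⟩ := hF.exists_bound hX
  obtain ⟨B, hB0, hB⟩ := hG.exists_bound hY
  refine ⟨3 * (A * B), fun c hc x hx hx2 => ?_⟩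
  have hx1 : 0 < 1 - x := by linarith
  have h1 := (hA x⁻¹ (by positivity)).2
  have h2 := (hB (1 - x)⁻¹ (by positivity)).1
  have h3 : ‖(1 - x : ℂ) ^ (c - 1)‖ = (1 - x)⁻¹ := by
    rw [← Complex.ofReal_one, ← Complex.ofReal_sub, Complex.norm_cpow_eq_rpow_re_of_pos hx1]
    simp [hc, Real.rpow_neg_one]
  have h4 : (1 - x)⁻¹ ≤ 3 * (1 + x)⁻¹ := by
    rw [← div_eq_mul_inv, inv_eq_one_div, div_le_div_iff₀ hx1 (by linarith)]
    linarith
  rw [convSub, norm_div, norm_mul, norm_mul, norm_mul, h3,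
    norm_cpow_of_re_eq_zero hx (by simp [hc]), Complex.norm_real, Real.norm_of_nonneg hx.le]
  rw [Real.inv_rpow hx.le, Real.rpow_neg hx.le, inv_inv] at h1
  simp only [mul_one]
  calc _ ≤ (A * x ^ (1 / 4 : ℝ)) * (B * (3 * (1 + x)⁻¹)) / x := by gcongr
    _ = 3 * (A * B) * ((x ^ (1 / 4 : ℝ) * x ^ (-1 : ℝ)) * (1 + x)⁻¹) := by
        rw [Real.rpow_neg_one]
        ring
    _ = _ := by rw [← Real.rpow_add hx]; norm_num

lemma continuousOn_convAdd (hF : ContinuousOn F (Ioi 0)) (hG : ContinuousOn G (Ioi 0))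
    (hX : 0 < X) (hY : 0 < Y) (c : ℂ) : ContinuousOn (convAdd F G X Y c) (Ioi 0) := by
  have hinv : ContinuousOn (fun x : ℝ => X * x⁻¹) (Ioi 0) :=
    continuousOn_const.mul (continuousOn_inv₀.mono fun x hx => ne_of_gt hx)
  have hinv' : ContinuousOn (fun x : ℝ => Y * (1 + x)⁻¹) (Ioi 0) :=
    continuousOn_const.mul (ContinuousOn.inv₀ (by fun_prop)
      fun x hx => by have : 0 < x := hx; positivity)
  refine ContinuousOn.div (ContinuousOn.mul ?_ ((ContinuousOn.mul ?_ ?_).mul ?_)) (by fun_prop)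
    fun x hx => by exact_mod_cast (ne_of_gt hx : x ≠ 0)
  · exact hF.comp hinv fun x hx => mul_pos hX (inv_pos.2 hx)
  · exact hG.comp hinv' fun x hx => mul_pos hY (inv_pos.2 (by have : 0 < x := hx; positivity))
  · exact continuousOn_one_add_cpow_Ioi _
  · exact continuousOn_cpow_Ioi _

lemma continuousOn_convSub (hF : ContinuousOn F (Ioi 0)) (hG : ContinuousOn G (Ioi 0))
    (hX : 0 < X) (hY : 0 < Y) (c : ℂ) : ContinuousOn (convSub F G X Y c) (Ioo 0 1) := by
  have hinv : ContinuousOn (fun x : ℝ => X * x⁻¹) (Ioo 0 1) :=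
    continuousOn_const.mul (continuousOn_inv₀.mono fun x hx => ne_of_gt hx.1)
  have hinv' : ContinuousOn (fun x : ℝ => Y * (1 - x)⁻¹) (Ioo 0 1) :=
    continuousOn_const.mul (ContinuousOn.inv₀ (by fun_prop) fun x hx => (sub_pos.2 hx.2).ne')
  refine ContinuousOn.div (ContinuousOn.mul ?_ ((ContinuousOn.mul ?_ ?_).mul ?_)) (by fun_prop)
    fun x hx => by exact_mod_cast hx.1.ne'
  · exact hF.comp hinv fun x hx => mul_pos hX (inv_pos.2 hx.1)
  · exact hG.comp hinv' fun x hx => mul_pos hY (inv_pos.2 (sub_pos.2 hx.2))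
  · have : ContinuousOn (fun x : ℝ => ((1 - x : ℝ) : ℂ) ^ (c - 1)) (Ioo 0 1) :=
      (continuousOn_cpow_Ioi (c - 1)).comp (by fun_prop) fun x hx => sub_pos.2 hx.2
    simpa using this
  · exact (continuousOn_cpow_Ioi _).mono fun x hx => hx.1

lemma integrableOn_convAdd (hν : ν.re = 0) (hη : ‖η‖ ≤ 1) (hθ : ‖θ‖ ≤ 1)
    (hF : BesselKernel ν η w F) (hG : BesselKernel ν θ v G) (hX : 0 < X) (hY : 0 < Y)
    {c : ℂ} (hc : c.re = 0) : IntegrableOn (convAdd F G X Y c) (Ioi 0) := by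
  obtain ⟨C, hC⟩ := exists_norm_convAdd_le hF hG hX hY
  refine Integrable.mono' (integrableOn_rpow_mul_one_add_inv.const_mul C)
    ((continuousOn_convAdd (hF.continuousOn hν hη) (hG.continuousOn hν hθ) hX hY
      c).aestronglyMeasurable measurableSet_Ioi) ?_
  filter_upwards [ae_restrict_mem measurableSet_Ioi] with x hx using hC c hc x hx

lemma integrableOn_convSub (hν : ν.re = 0) (hη : ‖η‖ ≤ 1) (hθ : ‖θ‖ ≤ 1)
    (hF : BesselKernel ν η w F) (hG : BesselKernel ν θ v G) (hX : 0 < X) (hY : 0 < Y)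
    {c : ℂ} (hc : c.re = 0) : IntegrableOn (convSub F G X Y c) (Ioc 0 (1 / 2)) := by
  obtain ⟨C, hC⟩ := exists_norm_convSub_le hF hG hX hY
  refine Integrable.mono' ((integrableOn_rpow_mul_one_add_inv.mono_set
    Ioc_subset_Ioi_self).const_mul C)
    (((continuousOn_convSub (hF.continuousOn hν hη) (hG.continuousOn hν hθ) hX hY
      c).mono fun x hx => ⟨hx.1, by have := hx.2; linarith⟩).aestronglyMeasurable
        measurableSet_Ioc) ?_
  filter_upwards [ae_restrict_mem measurableSet_Ioc] with x hx using hC c hc x hx.1 hx.2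

lemma continuous_integral_convAdd (hν : ν.re = 0) (hη : ‖η‖ ≤ 1) (hθ : ‖θ‖ ≤ 1)
    (hF : BesselKernel ν η w F) (hG : BesselKernel ν θ v G) (hX : 0 < X) (hY : 0 < Y)
    {c : ℝ → ℂ} (hc : Continuous c) (hc0 : ∀ t, (c t).re = 0) :
    Continuous fun t => ∫ x in Ioi (0 : ℝ), convAdd F G X Y (c t) x := by
  obtain ⟨C, hC⟩ := exists_norm_convAdd_le hF hG hX hY
  refine continuous_of_dominated (bound := fun x => C * (x ^ (-(3 / 4) : ℝ) * (1 + x)⁻¹))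
    (fun t => (continuousOn_convAdd (hF.continuousOn hν hη) (hG.continuousOn hν hθ) hX hY
      _).aestronglyMeasurable measurableSet_Ioi) (fun t => ?_)
    (integrableOn_rpow_mul_one_add_inv.const_mul C) ?_
  · filter_upwards [ae_restrict_mem measurableSet_Ioi] with x hx using hC _ (hc0 t) x hx
  · filter_upwards [ae_restrict_mem measurableSet_Ioi] with x hx
    have hx0 : (x : ℂ) ≠ 0 := by exact_mod_cast (ne_of_gt hx : x ≠ 0)
    have hx1 : (1 + x : ℂ) ≠ 0 := by
      have : 0 < x := hx
      exact_mod_cast (by positivity : (1 + x) ≠ 0)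
    refine (continuous_const.mul ((continuous_const.mul ?_).mul ?_)).div_const _
    · exact (hc.sub continuous_const).const_cpow (Or.inl hx1)
    · exact hc.neg.const_cpow (Or.inl hx0)

lemma continuous_integral_convSub (hν : ν.re = 0) (hη : ‖η‖ ≤ 1) (hθ : ‖θ‖ ≤ 1)
    (hF : BesselKernel ν η w F) (hG : BesselKernel ν θ v G) (hX : 0 < X) (hY : 0 < Y)
    {c : ℝ → ℂ} (hc : Continuous c) (hc0 : ∀ t, (c t).re = 0) :
    Continuous fun t => ∫ x in Ioc (0 : ℝ) (1 / 2), convSub F G X Y (c t) x := by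
  obtain ⟨C, hC⟩ := exists_norm_convSub_le hF hG hX hY
  refine continuous_of_dominated (bound := fun x => C * (x ^ (-(3 / 4) : ℝ) * (1 + x)⁻¹))
    (fun t => ((continuousOn_convSub (hF.continuousOn hν hη) (hG.continuousOn hν hθ) hX hY
      _).mono fun x hx => ⟨hx.1, by have := hx.2; linarith⟩).aestronglyMeasurable
        measurableSet_Ioc) (fun t => ?_)
    ((integrableOn_rpow_mul_one_add_inv.mono_set Ioc_subset_Ioi_self).const_mul C) ?_
  · filter_upwards [ae_restrict_mem measurableSet_Ioc] with x hx using hC _ (hc0 t) x hx.1 hx.2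
  · filter_upwards [ae_restrict_mem measurableSet_Ioc] with x hx
    have hx0 : (x : ℂ) ≠ 0 := by exact_mod_cast hx.1.ne'
    have hx1 : (1 - x : ℂ) ≠ 0 := by
      have : 1 - x ≠ 0 := by have := hx.2; intro h; linarith
      exact_mod_cast this
    refine (continuous_const.mul ((continuous_const.mul ?_).mul ?_)).div_const _
    · exact (hc.sub continuous_const).const_cpow (Or.inl hx1)
    · exact hc.neg.const_cpow (Or.inl hx0)

end Conv

section Expansion

variable {ν η θ : ℂ} {w v : ℂ → ℂ} {F G : ℝ → ℂ} {X Y : ℝ} {c : ℂ}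

/-- The value of the regularised Mellin transform of `F (X * ·)` at `c - k`. -/
noncomputable def scaledMellin (ν : ℂ) (w : ℂ → ℂ) (X : ℝ) (c : ℂ) (k : ℕ) : ℂ :=
  (X : ℂ) ^ (k - c) * (Complex.Gamma (c - k + ν / 2) * Complex.Gamma (c - k - ν / 2) * w (c - k))

lemma exists_two_mul_le_abs_im_add_besselExp (h1 : (c + ν / 2).im ≠ 0) (h2 : (c - ν / 2).im ≠ 0) :
    ∃ e : ℝ, 0 < e ∧ ∀ i, 2 * e ≤ |(c + besselExp ν i).im| := by
  refine ⟨min |(c + ν / 2).im| |(c - ν / 2).im| / 2, ?_, fun i => ?_⟩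
  · have := lt_min (abs_pos.2 h1) (abs_pos.2 h2)
    positivity
  · rw [Complex.add_im c (besselExp ν i)]
    rcases besselExp_im (ν := ν) i with h | h
    · rw [h, ← Complex.add_im]
      have := min_le_left |(c + ν / 2).im| |(c - ν / 2).im|
      linarith
    · rw [h, ← sub_eq_add_neg, ← Complex.sub_im]
      have := min_le_right |(c + ν / 2).im| |(c - ν / 2).im|
      linarith

lemma summable_norm_scaledCoeff_two_pow (hν : ν.re = 0) (hθ : ‖θ‖ ≤ 1) (hY : 0 < Y) :
    Summable fun j => ‖scaledCoeff ν θ Y j‖ * 2 ^ j.2 := by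
  refine (summable_scaledCoeff hν hθ hY two_pos).congr fun j => ?_
  rw [besselExp_re hν, Real.rpow_natCast]

theorem integral_convAdd_eq (hν : ν.re = 0) (hη : ‖η‖ ≤ 1) (hθ : ‖θ‖ ≤ 1)
    (hF : BesselKernel ν η w F) (hG : BesselKernel ν θ v G) (hw : Differentiable ℂ w)
    (hX : 0 < X) (hY : 0 < Y) (hc : c.re = 0) (h1 : (c + ν / 2).im ≠ 0)
    (h2 : (c - ν / 2).im ≠ 0) :
    (Summable fun jk : (Bool × ℕ) × ℕ => scaledCoeff ν θ Y jk.1 *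
      Ring.choose (c - 1 - besselExp ν jk.1) jk.2 * scaledMellin ν w X c jk.2) ∧
    (Summable fun ji : (Bool × ℕ) × (Bool × ℕ) => scaledCoeff ν θ Y ji.1 * scaledCoeff ν η X ji.2 *
      (Complex.Gamma (-c - besselExp ν ji.2) *
        Complex.Gamma (1 + besselExp ν ji.1 + besselExp ν ji.2) /
        Complex.Gamma (1 + besselExp ν ji.1 - c))) ∧
    ∫ x in Ioi (0 : ℝ), convAdd F G X Y c x =
      ∑' jk : (Bool × ℕ) × ℕ, scaledCoeff ν θ Y jk.1 *
        Ring.choose (c - 1 - besselExp ν jk.1) jk.2 * scaledMellin ν w X c jk.2 +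
      ∑' ji : (Bool × ℕ) × (Bool × ℕ), scaledCoeff ν θ Y ji.1 * scaledCoeff ν η X ji.2 *
        (Complex.Gamma (-c - besselExp ν ji.2) *
          Complex.Gamma (1 + besselExp ν ji.1 + besselExp ν ji.2) /
          Complex.Gamma (1 + besselExp ν ji.1 - c)) := by
  obtain ⟨C, -, hC⟩ := hF.exists_bound hX
  obtain ⟨e, he, hce⟩ := exists_two_mul_le_abs_im_add_besselExp h1 h2
  obtain ⟨N, hN⟩ := exists_nat_ge (max ‖ν‖ ‖c‖)
  have hα : ∀ i, 0 ≤ (besselExp ν i).re := fun i => by rw [besselExp_re hν]; positivity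
  have hβ : ∀ j : Bool × ℕ, ‖besselExp ν j‖ ≤ j.2 + N := fun j =>
    (norm_besselExp_le j).trans (by linarith [(le_max_left ‖ν‖ ‖c‖).trans hN])
  have hp : ∀ x : ℝ, 0 < x → Summable fun i => ‖scaledCoeff ν η X i‖ * x ^ (besselExp ν i).re :=
    fun x hx => summable_scaledCoeff hν hη hX hx
  have hf : ∀ x : ℝ, 0 < x →
      HasSum (fun i => scaledCoeff ν η X i * (x : ℂ) ^ besselExp ν i) (F (X * x)) :=
    fun x hx => hF.hasSum_comp_mul hX hx
  have hh : ∀ x : ℝ, 0 < x →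
      HasSum (fun i => scaledCoeff ν θ Y i * (x : ℂ) ^ besselExp ν i) (G (Y * x)) :=
    fun x hx => hG.hasSum_comp_mul hY hx
  have hfc := hF.continuousOn_comp_mul hν hη hX
  have hq := summable_norm_scaledCoeff_two_pow hν hθ hY
  have hint := integrableOn_convAdd hν hη hθ hF hG hX hY hc
  have key := integral_conv_one_add (p := scaledCoeff ν η X) (α := besselExp ν)
    (f := fun x => F (X * x)) (q := scaledCoeff ν θ Y) (β := besselExp ν) (n := fun j => j.2)
    (h := fun x => G (Y * x)) (c := c) (C := C) (δ := 1 / 4) (η := e) (N := N) hα hp hf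
    (by norm_num) hfc (fun x hx => (hC x hx).2) hc he hce hβ ((le_max_right _ _).trans hN)
    (fun j => besselExp_re hν j) hq hh hint
  simp only [hF.regMellin_eq hν hη hw hX hc h1 h2] at key
  exact key

theorem integral_convSub_eq (hν : ν.re = 0) (hη : ‖η‖ ≤ 1) (hθ : ‖θ‖ ≤ 1)
    (hF : BesselKernel ν η w F) (hG : BesselKernel ν θ v G) (hw : Differentiable ℂ w)
    (hX : 0 < X) (hY : 0 < Y) (hc : c.re = 0) (h1 : (c + ν / 2).im ≠ 0)
    (h2 : (c - ν / 2).im ≠ 0) :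
    (Summable fun jk : (Bool × ℕ) × ℕ => scaledCoeff ν θ Y jk.1 *
      ((-1) ^ jk.2 * Ring.choose (c - 1 - besselExp ν jk.1) jk.2) * scaledMellin ν w X c jk.2) ∧
    (Summable fun ji : (Bool × ℕ) × (Bool × ℕ) => scaledCoeff ν θ Y ji.1 * scaledCoeff ν η X ji.2 *
      halfBeta (-c - besselExp ν ji.2) (c - besselExp ν ji.1)) ∧
    ∫ x in Ioc (0 : ℝ) (1 / 2), convSub F G X Y c x =
      ∑' jk : (Bool × ℕ) × ℕ, scaledCoeff ν θ Y jk.1 *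
        ((-1) ^ jk.2 * Ring.choose (c - 1 - besselExp ν jk.1) jk.2) * scaledMellin ν w X c jk.2 +
      ∑' ji : (Bool × ℕ) × (Bool × ℕ), scaledCoeff ν θ Y ji.1 * scaledCoeff ν η X ji.2 *
        halfBeta (-c - besselExp ν ji.2) (c - besselExp ν ji.1) := by
  obtain ⟨C, -, hC⟩ := hF.exists_bound hX
  obtain ⟨e, he, hce⟩ := exists_two_mul_le_abs_im_add_besselExp h1 h2
  obtain ⟨N, hN⟩ := exists_nat_ge (max ‖ν‖ ‖c‖)
  have hα : ∀ i, 0 ≤ (besselExp ν i).re := fun i => by rw [besselExp_re hν]; positivity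
  have hβ : ∀ j : Bool × ℕ, ‖besselExp ν j‖ ≤ j.2 + N := fun j =>
    (norm_besselExp_le j).trans (by linarith [(le_max_left ‖ν‖ ‖c‖).trans hN])
  have hp : ∀ x : ℝ, 0 < x → Summable fun i => ‖scaledCoeff ν η X i‖ * x ^ (besselExp ν i).re :=
    fun x hx => summable_scaledCoeff hν hη hX hx
  have hf : ∀ x : ℝ, 0 < x →
      HasSum (fun i => scaledCoeff ν η X i * (x : ℂ) ^ besselExp ν i) (F (X * x)) :=
    fun x hx => hF.hasSum_comp_mul hX hx
  have hh : ∀ x : ℝ, 0 < x →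
      HasSum (fun i => scaledCoeff ν θ Y i * (x : ℂ) ^ besselExp ν i) (G (Y * x)) :=
    fun x hx => hG.hasSum_comp_mul hY hx
  have hfc := hF.continuousOn_comp_mul hν hη hX
  have hq := summable_norm_scaledCoeff_two_pow hν hθ hY
  have hint := integrableOn_convSub hν hη hθ hF hG hX hY hc
  have key := integral_conv_one_sub (p := scaledCoeff ν η X) (α := besselExp ν)
    (f := fun x => F (X * x)) (q := scaledCoeff ν θ Y) (β := besselExp ν) (n := fun j => j.2)
    (h := fun x => G (Y * x)) (c := c) (C := C) (δ := 1 / 4) (η := e) (N := N) hα hp hf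
    (by norm_num) hfc (fun x hx => (hC x hx).2) hc he hce hβ ((le_max_right _ _).trans hN)
    hq hh hint
  simp only [hF.regMellin_eq hν hη hw hX hc h1 h2] at key
  exact key

end Expansion

lemma two_pi_mul_sqrt_mul_sqrt {y : ℝ} (hy : 0 ≤ y) (t : ℝ) :
    2 * Real.pi * √y * √t = √(4 * Real.pi ^ 2 * y * t) := by
  rw [Real.sqrt_mul (by positivity), Real.sqrt_mul (by positivity),
    show 4 * Real.pi ^ 2 = (2 * Real.pi) ^ 2 by ring, Real.sqrt_sq (by positivity)]

lemma cpow_sub_one_mul_cpow_neg_div {x z u : ℝ} (hx : 0 < x) (hu : 0 < u) (hz : z = x * u ^ 2)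
    (c : ℂ) : (z : ℂ) ^ (c - 1) * (x : ℂ) ^ (-c) / x = (u : ℂ) ^ (2 * c) / ((x : ℂ) ^ 2 * u ^ 2) := by
  have hx0 : (x : ℂ) ≠ 0 := by exact_mod_cast hx.ne'
  have hu0 : (u : ℂ) ≠ 0 := by exact_mod_cast hu.ne'
  have hz0 : (z : ℂ) ≠ 0 := by rw [hz]; push_cast; positivity
  have hzc : (z : ℂ) ^ c = (x : ℂ) ^ c * (u : ℂ) ^ (2 * c) := by
    rw [hz, Complex.ofReal_mul, Complex.mul_cpow_ofReal_nonneg hx.le (by positivity),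
      Complex.ofReal_pow, sq, Complex.mul_cpow_ofReal_nonneg hu.le hu.le, two_mul,
      Complex.cpow_add _ _ hu0]
  have hxc : (x : ℂ) ^ c ≠ 0 := by simp [Complex.cpow_eq_zero_iff, hx0]
  rw [Complex.cpow_sub _ _ hz0, Complex.cpow_neg, Complex.cpow_one, hzc]
  have hz' : (z : ℂ) = x * u ^ 2 := by rw [hz]; push_cast; ring
  rw [hz']
  generalize (x : ℂ) ^ c = a at hxc ⊢
  generalize (u : ℂ) ^ (2 * c) = b
  field_simp

lemma image_inv_sq_sub_one : (fun u : ℝ => (u ^ 2 - 1)⁻¹) '' Ioi 1 = Ioi 0 := by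
  ext x
  simp only [mem_image, mem_Ioi]
  constructor
  · rintro ⟨u, hu, rfl⟩
    have : 0 < u ^ 2 - 1 := by nlinarith
    positivity
  · intro hx
    refine ⟨√(1 + x⁻¹), ?_, ?_⟩
    · rw [Real.lt_sqrt (by norm_num)]
      have : 0 < x⁻¹ := by positivity
      linarith
    · rw [Real.sq_sqrt (by positivity)]
      simp

lemma image_inv_one_add_sq : (fun u : ℝ => (1 + u ^ 2)⁻¹) '' Ioi 0 = Ioo 0 1 := by
  ext x
  simp only [mem_image, mem_Ioi, mem_Ioo]
  constructor
  · rintro ⟨u, hu, rfl⟩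
    exact ⟨by positivity, inv_lt_one_of_one_lt₀ (by nlinarith)⟩
  · rintro ⟨hx, hx1⟩
    have h1 : 1 < x⁻¹ := (one_lt_inv₀ hx).2 hx1
    refine ⟨√(x⁻¹ - 1), Real.sqrt_pos.2 (by linarith), ?_⟩
    rw [Real.sq_sqrt (by linarith)]
    simp

lemma image_inv_one_sub_sq_sub_one : (fun u : ℝ => (1 - u ^ 2)⁻¹ - 1) '' Ioo 0 1 = Ioi 0 := by
  ext x
  simp only [mem_image, mem_Ioi, mem_Ioo]
  constructor
  · rintro ⟨u, ⟨hu, hu1⟩, rfl⟩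
    have : 1 < (1 - u ^ 2)⁻¹ := (one_lt_inv₀ (by nlinarith)).2 (by nlinarith)
    linarith
  · intro hx
    have h1 : (1 + x)⁻¹ < 1 := inv_lt_one_of_one_lt₀ (by linarith)
    have h0 : 0 < (1 + x)⁻¹ := by positivity
    refine ⟨√(1 - (1 + x)⁻¹), ⟨Real.sqrt_pos.2 (by linarith), ?_⟩, ?_⟩
    · rw [Real.sqrt_lt' one_pos]
      linarith
    · rw [Real.sq_sqrt (by linarith)]
      simp

section ChangeOfVariables

variable {F G : ℝ → ℂ} {X Y : ℝ} {c : ℂ}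

lemma integral_convAdd_inv_sq_sub_one :
    ∫ x in Ioi (0 : ℝ), convAdd F G X Y c x = 2 * ∫ u in Ioi (1 : ℝ),
      F (X * (u ^ 2 - 1)) * G (Y * (1 - (1 / u) ^ 2)) * ((u : ℂ) ^ (2 * c) / u) := by
  have hpos : ∀ u ∈ Ioi (1 : ℝ), 0 < u ^ 2 - 1 := fun u hu => by
    have : 1 < u := hu
    nlinarith
  have hd : ∀ u ∈ Ioi (1 : ℝ), HasDerivWithinAt (fun u : ℝ => (u ^ 2 - 1)⁻¹)
      (-(2 * u) / (u ^ 2 - 1) ^ 2) (Ioi 1) u := fun u hu => by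
    have h := (((hasDerivAt_pow 2 u).sub_const 1).fun_inv (hpos u hu).ne').hasDerivWithinAt
      (s := Ioi 1)
    simpa using h
  have hinj : InjOn (fun u : ℝ => (u ^ 2 - 1)⁻¹) (Ioi 1) := fun a ha b hb hab => by
    have ha' : (0 : ℝ) < a := one_pos.trans ha
    have hb' : (0 : ℝ) < b := one_pos.trans hb
    have : a ^ 2 = b ^ 2 := by linarith [inv_injective hab]
    exact (pow_left_inj₀ ha'.le hb'.le two_ne_zero).1 this
  rw [← image_inv_sq_sub_one, integral_image_eq_integral_abs_deriv_smul measurableSet_Ioi hd hinj,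
    ← integral_const_mul]
  · refine setIntegral_congr_fun measurableSet_Ioi fun u hu => ?_
    have hu1 : 1 < u := hu
    have hu0 : 0 < u := by linarith
    have hu0' : (u : ℂ) ≠ 0 := by exact_mod_cast hu0.ne'
    have hx := hpos u hu
    have hx' : ((u ^ 2 - 1 : ℝ) : ℂ) ≠ 0 := by exact_mod_cast hx.ne'
    have h1 : 1 + (u ^ 2 - 1)⁻¹ = (u ^ 2 - 1)⁻¹ * u ^ 2 := by field_simp; ring
    have h2 : (1 + (u ^ 2 - 1)⁻¹)⁻¹ = 1 - (1 / u) ^ 2 := by rw [h1]; field_simp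
    have key := cpow_sub_one_mul_cpow_neg_div (inv_pos.2 hx) hu0 h1 c
    have habs : |-(2 * u) / (u ^ 2 - 1) ^ 2| = 2 * u / (u ^ 2 - 1) ^ 2 := by
      rw [abs_div, abs_neg, abs_of_pos (by positivity), abs_of_pos (by positivity)]
    have hc : (1 : ℂ) + ((u ^ 2 - 1)⁻¹ : ℝ) = ((1 + (u ^ 2 - 1)⁻¹ : ℝ) : ℂ) := by push_cast; ring
    rw [convAdd, inv_inv, h2, hc, mul_div_assoc, mul_assoc (G _), mul_div_assoc (G _), key, habs,
      Complex.real_smul, Complex.ofReal_inv, Complex.ofReal_div]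
    push_cast at hx' ⊢
    generalize (u : ℂ) ^ (2 * c) = b
    field_simp

lemma integral_convSub_inv_one_add_sq :
    ∫ x in Ioo (0 : ℝ) 1, convSub F G X Y c x = 2 * ∫ u in Ioi (0 : ℝ),
      F (X * (1 + u ^ 2)) * G (Y * (1 + (1 / u) ^ 2)) * ((u : ℂ) ^ (2 * c) / u) := by
  have hd : ∀ u ∈ Ioi (0 : ℝ), HasDerivWithinAt (fun u : ℝ => (1 + u ^ 2)⁻¹)
      (-(2 * u) / (1 + u ^ 2) ^ 2) (Ioi 0) u := fun u hu => by
    have h := (((hasDerivAt_pow 2 u).const_add 1).fun_inv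
      (by positivity)).hasDerivWithinAt (s := Ioi 0)
    simpa using h
  have hinj : InjOn (fun u : ℝ => (1 + u ^ 2)⁻¹) (Ioi 0) := fun a ha b hb hab => by
    have ha' : (0 : ℝ) < a := ha
    have hb' : (0 : ℝ) < b := hb
    have : a ^ 2 = b ^ 2 := by linarith [inv_injective hab]
    exact (pow_left_inj₀ ha'.le hb'.le two_ne_zero).1 this
  rw [← image_inv_one_add_sq, integral_image_eq_integral_abs_deriv_smul measurableSet_Ioi hd hinj,
    ← integral_const_mul]
  · refine setIntegral_congr_fun measurableSet_Ioi fun u hu => ?_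
    have hu0 : 0 < u := hu
    have hu0' : (u : ℂ) ≠ 0 := by exact_mod_cast hu0.ne'
    have hx : 0 < 1 + u ^ 2 := by positivity
    have hx' : ((1 + u ^ 2 : ℝ) : ℂ) ≠ 0 := by exact_mod_cast hx.ne'
    have h1 : 1 - (1 + u ^ 2)⁻¹ = (1 + u ^ 2)⁻¹ * u ^ 2 := by field_simp; ring_nf
    have h2 : (1 - (1 + u ^ 2)⁻¹)⁻¹ = 1 + (1 / u) ^ 2 := by rw [h1]; field_simp; ring
    have key := cpow_sub_one_mul_cpow_neg_div (inv_pos.2 hx) hu0 h1 c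
    have habs : |-(2 * u) / (1 + u ^ 2) ^ 2| = 2 * u / (1 + u ^ 2) ^ 2 := by
      rw [abs_div, abs_neg, abs_of_pos (by positivity), abs_of_pos (by positivity)]
    have hc : (1 : ℂ) - ((1 + u ^ 2)⁻¹ : ℝ) = ((1 - (1 + u ^ 2)⁻¹ : ℝ) : ℂ) := by push_cast; ring
    rw [convSub, inv_inv, h2, hc, mul_div_assoc, mul_assoc (G _), mul_div_assoc (G _), key, habs,
      Complex.real_smul, Complex.ofReal_inv, Complex.ofReal_div]
    push_cast at hx' ⊢
    generalize (u : ℂ) ^ (2 * c) = b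
    field_simp

lemma integral_convAdd_inv_one_sub_sq_sub_one :
    ∫ x in Ioi (0 : ℝ), convAdd G F Y X (-c) x = 2 * ∫ u in Ioo (0 : ℝ) 1,
      F (X * (1 - u ^ 2)) * G (Y * ((1 / u) ^ 2 - 1)) * ((u : ℂ) ^ (2 * c) / u) := by
  have hpos : ∀ u ∈ Ioo (0 : ℝ) 1, 0 < 1 - u ^ 2 := fun u hu => by nlinarith [hu.1, hu.2]
  have hd : ∀ u ∈ Ioo (0 : ℝ) 1, HasDerivWithinAt (fun u : ℝ => (1 - u ^ 2)⁻¹ - 1)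
      (2 * u / (1 - u ^ 2) ^ 2) (Ioo 0 1) u := fun u hu => by
    have h := ((((hasDerivAt_pow 2 u).const_sub 1).fun_inv
      (hpos u hu).ne').sub_const 1).hasDerivWithinAt (s := Ioo 0 1)
    simpa using h
  have hinj : InjOn (fun u : ℝ => (1 - u ^ 2)⁻¹ - 1) (Ioo 0 1) := fun a ha b hb hab => by
    have : a ^ 2 = b ^ 2 := by
      have := inv_injective (sub_left_injective hab)
      linarith
    exact (pow_left_inj₀ ha.1.le hb.1.le two_ne_zero).1 this
  rw [← image_inv_one_sub_sq_sub_one,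
    integral_image_eq_integral_abs_deriv_smul measurableSet_Ioo hd hinj, ← integral_const_mul]
  · refine setIntegral_congr_fun measurableSet_Ioo fun u hu => ?_
    have hu0 : 0 < u := hu.1
    have hu0' : (u : ℂ) ≠ 0 := by exact_mod_cast hu0.ne'
    have hz := hpos u hu
    have hz' : ((1 - u ^ 2 : ℝ) : ℂ) ≠ 0 := by exact_mod_cast hz.ne'
    have h1 : (1 - u ^ 2)⁻¹ - 1 = (1 - u ^ 2)⁻¹ * u ^ 2 := by field_simp; ring
    have h2 : ((1 - u ^ 2)⁻¹ - 1)⁻¹ = (1 / u) ^ 2 - 1 := by rw [h1]; field_simp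
    have h3 : (1 + ((1 - u ^ 2)⁻¹ - 1))⁻¹ = 1 - u ^ 2 := by simp
    have hx : 0 < (1 - u ^ 2)⁻¹ - 1 := by rw [h1]; positivity
    have hx' : (((1 - u ^ 2)⁻¹ - 1 : ℝ) : ℂ) ≠ 0 := by exact_mod_cast hx.ne'
    have key := cpow_sub_one_mul_cpow_neg_div (inv_pos.2 hz) hu0 h1 c
    have habs : |2 * u / (1 - u ^ 2) ^ 2| = 2 * u / (1 - u ^ 2) ^ 2 := abs_of_pos (by positivity)
    have hc : (1 : ℂ) + ((1 - u ^ 2)⁻¹ - 1 : ℝ) = (((1 - u ^ 2)⁻¹ : ℝ) : ℂ) := by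
      push_cast; ring
    have key' : (((1 - u ^ 2)⁻¹ : ℝ) : ℂ) ^ (-c - 1) * (((1 - u ^ 2)⁻¹ - 1 : ℝ) : ℂ) ^ (- -c) /
        (((1 - u ^ 2)⁻¹ - 1 : ℝ) : ℂ) =
        (u : ℂ) ^ (2 * c) / ((((1 - u ^ 2)⁻¹ : ℝ) : ℂ) ^ 2 * u ^ 2) := by
      rw [← key, Complex.cpow_sub _ _ hx', Complex.cpow_sub _ _ (by
        rw [Complex.ofReal_inv]; exact inv_ne_zero hz'), neg_neg, Complex.cpow_one,
        Complex.cpow_one]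
      ring
    have hval : convAdd G F Y X (-c) ((1 - u ^ 2)⁻¹ - 1) = G (Y * ((1 / u) ^ 2 - 1)) *
        (F (X * (1 - u ^ 2)) * ((u : ℂ) ^ (2 * c) / ((((1 - u ^ 2)⁻¹ : ℝ) : ℂ) ^ 2 * u ^ 2))) := by
      rw [convAdd, h2, h3, hc, mul_div_assoc, mul_assoc (F _), mul_div_assoc (F _), key']
    rw [hval, habs, Complex.real_smul, Complex.ofReal_inv, Complex.ofReal_div]
    push_cast at hz' ⊢
    generalize (u : ℂ) ^ (2 * c) = b
    field_simp

lemma convSub_one_sub {x : ℝ} (hx : x ≠ 0) (hx1 : x ≠ 1) :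
    convSub F G X Y c (1 - x) = convSub G F Y X (-c) x := by
  have h0 : (x : ℂ) ≠ 0 := by exact_mod_cast hx
  have h1 : (1 - x : ℂ) ≠ 0 := by exact_mod_cast sub_ne_zero.2 hx1.symm
  have h2 : (1 : ℂ) - ((1 - x : ℝ) : ℂ) = x := by push_cast; ring
  rw [convSub, convSub, h2, sub_sub_cancel, neg_neg, Complex.cpow_sub _ _ h0,
    Complex.cpow_sub _ _ h1, Complex.cpow_one, Complex.cpow_one]
  push_cast
  ring

lemma integral_Ioo_convSub (h1 : IntegrableOn (convSub F G X Y c) (Ioc 0 (1 / 2)))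
    (h2 : IntegrableOn (convSub G F Y X (-c)) (Ioc 0 (1 / 2))) :
    ∫ x in Ioo (0 : ℝ) 1, convSub F G X Y c x =
      (∫ x in Ioc (0 : ℝ) (1 / 2), convSub F G X Y c x) +
        ∫ x in Ioc (0 : ℝ) (1 / 2), convSub G F Y X (-c) x := by
  have h12 : (0 : ℝ) ≤ 1 / 2 := by norm_num
  have hcongr : EqOn (fun x => convSub F G X Y c (1 - x)) (convSub G F Y X (-c))
      (Ioc (0 : ℝ) (1 / 2)) := fun x hx =>
    convSub_one_sub hx.1.ne' (by have := hx.2; intro h; linarith)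
  have i1 : IntervalIntegrable (convSub F G X Y c) volume 0 (1 / 2) :=
    (intervalIntegrable_iff_integrableOn_Ioc_of_le h12).2 h1
  have i2 : IntervalIntegrable (fun x => convSub F G X Y c (1 - x)) volume 0 (1 / 2) :=
    (intervalIntegrable_iff_integrableOn_Ioc_of_le h12).2
      (h2.congr_fun hcongr.symm measurableSet_Ioc)
  have i3 : IntervalIntegrable (convSub F G X Y c) volume (1 / 2) 1 := by
    have := (i2.comp_sub_left 1).symm
    simp only [sub_sub_cancel, sub_zero] at this
    norm_num at this ⊢
    exact this
  rw [← integral_Ioc_eq_integral_Ioo, ← intervalIntegral.integral_of_le zero_le_one,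
    ← intervalIntegral.integral_add_adjacent_intervals i1 i3,
    ← intervalIntegral.integral_of_le h12, ← setIntegral_congr_fun measurableSet_Ioc hcongr,
    ← intervalIntegral.integral_of_le h12, intervalIntegral.integral_comp_sub_left
      (fun x => convSub F G X Y c x)]
  norm_num

end ChangeOfVariables

section DoubleBessel

variable {y₁ y₂ : ℝ} {μ₁ μ₂ μ₃ : ℂ}

lemma calJ2minus_eq_convAdd : calJ2minus y₁ y₂ μ₂ μ₃ μ₁ = ((|y₁ / y₂| : ℝ) : ℂ) ^ (μ₃ / 2) *
    (1 / 2 * ∫ x in Ioi (0 : ℝ), convAdd (fun x => Jminus (μ₁ - μ₂) √x)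
      (fun x => Jminus (μ₁ - μ₂) √x) (4 * Real.pi ^ 2 * |y₁|) (4 * Real.pi ^ 2 * |y₂|)
      (3 * μ₃ / 2) x) := by
  rw [calJ2minus, integral_convAdd_inv_sq_sub_one]
  simp only [two_pi_mul_sqrt_mul_sqrt (abs_nonneg _)]
  rw [show 2 * (3 * μ₃ / 2) = 3 * μ₃ by ring]
  ring

lemma calJ3_eq_convSub : calJ3 y₁ y₂ μ₂ μ₃ μ₁ = ((|y₁ / y₂| : ℝ) : ℂ) ^ (μ₃ / 2) *
    (1 / 2 * ∫ x in Ioo (0 : ℝ) 1, convSub (fun x => Ktilde (μ₁ - μ₂) √x)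
      (fun x => Jminus (μ₁ - μ₂) √x) (4 * Real.pi ^ 2 * |y₁|) (4 * Real.pi ^ 2 * |y₂|)
      (3 * μ₃ / 2) x) := by
  rw [calJ3, integral_convSub_inv_one_add_sq]
  simp only [two_pi_mul_sqrt_mul_sqrt (abs_nonneg _)]
  rw [show 2 * (3 * μ₃ / 2) = 3 * μ₃ by ring]
  ring

lemma calJ4_eq_convAdd : calJ4 y₁ y₂ μ₂ μ₃ μ₁ = ((|y₁ / y₂| : ℝ) : ℂ) ^ (μ₃ / 2) *
    (1 / 2 * ∫ x in Ioi (0 : ℝ), convAdd (fun x => Ktilde (μ₁ - μ₂) √x)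
      (fun x => Ktilde (μ₁ - μ₂) √x) (4 * Real.pi ^ 2 * |y₂|) (4 * Real.pi ^ 2 * |y₁|)
      (-(3 * μ₃ / 2)) x) := by
  rw [calJ4, integral_convAdd_inv_one_sub_sq_sub_one (F := fun x => Ktilde (μ₁ - μ₂) √x)]
  simp only [two_pi_mul_sqrt_mul_sqrt (abs_nonneg _)]
  rw [show 2 * (3 * μ₃ / 2) = 3 * μ₃ by ring]
  ring

end DoubleBessel

lemma sin_pi_mul_natCast_add (m : ℕ) (z : ℂ) :
    Complex.sin (Real.pi * (m + z)) = (-1) ^ m * Complex.sin (Real.pi * z) := by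
  have := Complex.sin_antiperiodic.add_nat_mul_eq m (x := Real.pi * z)
  rw [← this]
  congr 1
  ring

lemma cos_pi_mul_sub_natCast (k : ℕ) (z : ℂ) :
    Complex.cos (Real.pi * (z - k)) = (-1) ^ k * Complex.cos (Real.pi * z) := by
  have := Complex.cos_antiperiodic.sub_nat_mul_eq k (x := Real.pi * z)
  rw [← this]
  congr 1
  ring

lemma Gamma_natCast_add_add_one_ne_zero_of_im {z : ℂ} (hz : z.im ≠ 0) (m : ℕ) :
    Complex.Gamma (m + z + 1) ≠ 0 :=
  Complex.Gamma_ne_zero fun j h => hz (by simpa using congrArg Complex.im h)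

lemma Gamma_neg_eq_of_im {z : ℂ} (hz : z.im ≠ 0) (m : ℕ) :
    Complex.Gamma (-(m + z)) =
      -(Real.pi * (-1) ^ m) / (Complex.sin (Real.pi * z) * Complex.Gamma (m + z + 1)) := by
  have h1 := Complex.Gamma_mul_Gamma_one_sub (-(m + z))
  have hs := sin_pi_mul_ne_zero_of_im hz
  have hG := Gamma_natCast_add_add_one_ne_zero_of_im hz m
  have hm : ((-1 : ℂ) ^ m) * (-1) ^ m = 1 := neg_one_pow_mul_self m
  have hm0 : ((-1 : ℂ) ^ m) ≠ 0 := pow_ne_zero _ (by norm_num)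
  rw [show 1 - -((m : ℂ) + z) = m + z + 1 by ring, mul_neg, Complex.sin_neg,
    sin_pi_mul_natCast_add, eq_div_iff (neg_ne_zero.2 (mul_ne_zero hm0 hs))] at h1
  rw [eq_div_iff (mul_ne_zero hs hG)]
  generalize Complex.Gamma (-(m + z)) = a at h1 ⊢
  linear_combination (-(-1) ^ m) * h1 -
    a * Complex.sin (Real.pi * z) * Complex.Gamma (m + z + 1) * hm

lemma Gamma_sub_natCast_eq_of_im {z : ℂ} (hz : z.im ≠ 0) (k : ℕ) :
    Complex.Gamma (z - k) =
      Real.pi * (-1) ^ k / (Complex.sin (Real.pi * z) * Complex.Gamma (k - z + 1)) := by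
  have := Gamma_neg_eq_of_im (z := -z) (by simpa using hz) k
  rw [mul_neg, Complex.sin_neg, neg_mul, neg_div_neg_eq] at this
  rw [← sub_eq_add_neg, neg_sub] at this
  exact this

lemma Gamma_mul_Gamma_mul_cos_sub_cos {c τ : ℂ} (h1 : (c + τ / 2).im ≠ 0)
    (h2 : (c - τ / 2).im ≠ 0) (k : ℕ) :
    Complex.Gamma (c - k + τ / 2) * Complex.Gamma (c - k - τ / 2) *
        (Complex.cos (Real.pi * c) - Complex.cos (Real.pi * τ / 2)) =
      -(Real.pi ^ 2 / (2 * (Complex.cos (Real.pi / 2 * (c + τ / 2)) *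
        Complex.cos (Real.pi / 2 * (c - τ / 2))))) /
        (Complex.Gamma (k - c + τ / 2 + 1) * Complex.Gamma (k - c - τ / 2 + 1)) := by
  have e1 := Gamma_sub_natCast_eq_of_im h1 k
  have e2 := Gamma_sub_natCast_eq_of_im h2 k
  have s1 := sin_pi_mul_ne_zero_of_im h1
  have s2 := sin_pi_mul_ne_zero_of_im h2
  have g1 := Gamma_natCast_add_add_one_ne_zero_of_im (z := -(c + τ / 2)) (by
    rw [Complex.neg_im]; exact neg_ne_zero.2 h1) k
  have g2 := Gamma_natCast_add_add_one_ne_zero_of_im (z := -(c - τ / 2)) (by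
    rw [Complex.neg_im]; exact neg_ne_zero.2 h2) k
  have hd := Complex.cos_sub_cos (Real.pi * c) (Real.pi * τ / 2)
  have hm := neg_one_pow_mul_self k
  rw [sin_pi_mul_eq_two_mul] at e1 e2 s1 s2
  rw [show (c - k + τ / 2 : ℂ) = c + τ / 2 - k by ring,
    show (c - k - τ / 2 : ℂ) = c - τ / 2 - k by ring, e1, e2, hd,
    show (k - c + τ / 2 + 1 : ℂ) = k - (c - τ / 2) + 1 by ring,
    show (k - c - τ / 2 + 1 : ℂ) = k - (c + τ / 2) + 1 by ring,
    show (Real.pi * c + Real.pi * τ / 2) / 2 = Real.pi * (c + τ / 2) / 2 by ring,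
    show (Real.pi * c - Real.pi * τ / 2) / 2 = Real.pi * (c - τ / 2) / 2 by ring,
    show Real.pi / 2 * (c + τ / 2) = Real.pi * (c + τ / 2) / 2 by ring,
    show Real.pi / 2 * (c - τ / 2) = Real.pi * (c - τ / 2) / 2 by ring]
  rw [← sub_eq_add_neg] at g1 g2
  generalize Complex.sin (Real.pi * (c + τ / 2) / 2) = a at *
  generalize Complex.sin (Real.pi * (c - τ / 2) / 2) = b at *
  generalize Complex.cos (Real.pi * (c + τ / 2) / 2) = a' at *
  generalize Complex.cos (Real.pi * (c - τ / 2) / 2) = b' at *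
  generalize Complex.Gamma (k - (c + τ / 2) + 1) = x at *
  generalize Complex.Gamma (k - (c - τ / 2) + 1) = y at *
  generalize (-1 : ℂ) ^ k = e at *
  have ha : a ≠ 0 := fun h => s1 (by rw [h]; ring)
  have ha' : a' ≠ 0 := fun h => s1 (by rw [h]; ring)
  have hb : b ≠ 0 := fun h => s2 (by rw [h]; ring)
  have hb' : b' ≠ 0 := fun h => s2 (by rw [h]; ring)
  have : e ^ 2 = 1 := by rw [sq, hm]
  field_simp
  rw [this]

/-- The terms of the power series of `J_{w_l}`, in the variables `X = 4π²y₁` and `Z = 4π²y₂`. -/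
noncomputable def wlTerm (X Z : ℝ) (a b d : ℂ) (n : ℕ × ℕ) : ℂ :=
  Complex.Gamma ((n.1 : ℂ) + (n.2 : ℂ) + a - d + 1) * (X : ℂ) ^ n.1 * (Z : ℂ) ^ n.2 /
    (Complex.Gamma ((n.1 : ℂ) + a - d + 1) * Complex.Gamma ((n.2 : ℂ) + a - a + 1) *
      Complex.Gamma ((n.1 : ℂ) + b - d + 1) * Complex.Gamma ((n.2 : ℂ) + a - b + 1) *
      Complex.Gamma ((n.1 : ℂ) + d - d + 1) * Complex.Gamma ((n.2 : ℂ) + a - d + 1))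

lemma wlTerm_eq (X Z : ℝ) {a b d p q r : ℂ} (hp : a - d = p) (hq : b - d = q) (hr : a - b = r)
    (m n : ℕ) : wlTerm X Z a b d (m, n) =
      Complex.Gamma (m + n + p + 1) * (X : ℂ) ^ m * (Z : ℂ) ^ n /
        (Complex.Gamma (m + p + 1) * n.factorial * Complex.Gamma (m + q + 1) *
          Complex.Gamma (n + r + 1) * m.factorial * Complex.Gamma (n + p + 1)) := by
  simp only [wlTerm, add_sub_assoc, sub_self, add_zero, hp, hq, hr,
    Complex.Gamma_nat_eq_factorial]

lemma wlTail_eq {c ν : ℂ} (b : Bool) (h1 : (c + ν / 2).im ≠ 0) (h2 : (c - ν / 2).im ≠ 0) {X : ℝ}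
    (hX : 0 < X) (n k : ℕ) :
    Ring.choose (c - 1 - besselExp ν (b, n)) k *
        scaledMellin ν (fun s => Complex.cos (Real.pi * s)) X c k -
      (-1) ^ k * Ring.choose (c - 1 - besselExp ν (b, n)) k *
        scaledMellin ν (fun _ => Complex.cos (Real.pi * ν / 2)) X c k =
    (X : ℂ) ^ k * (X : ℂ) ^ (-c) * -(Real.pi ^ 2 / (2 * (Complex.cos (Real.pi / 2 * (c + ν / 2)) *
        Complex.cos (Real.pi / 2 * (c - ν / 2))))) *
      Complex.Gamma (k + n + (boolSign b * ν / 2 - c) + 1) /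
      (k.factorial * Complex.Gamma (n + (boolSign b * ν / 2 - c) + 1) *
        Complex.Gamma (k + (boolSign b * ν / 2 - c) + 1) *
        Complex.Gamma (k + (-(boolSign b * ν / 2) - c) + 1)) := by
  have hX0 : (X : ℂ) ≠ 0 := by exact_mod_cast hX.ne'
  have key := Gamma_mul_Gamma_mul_cos_sub_cos h1 h2 k
  have hβ : (boolSign b * ν / 2 - c).im ≠ 0 := by
    cases b
    · intro h
      simp [neg_div] at h h1
      exact h1 (by linarith)
    · intro h
      simp at h h2
      exact h2 (by linarith)
  have hch := neg_one_pow_mul_choose (e := c - 1 - besselExp ν (b, n)) (fun m h => by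
    apply Gamma_natCast_add_add_one_ne_zero_of_im hβ n
    rw [Complex.Gamma_eq_zero_iff]
    exact ⟨m, by rw [← h, besselExp]; ring⟩) k
  have hx : (X : ℂ) ^ ((k : ℂ) - c) = (X : ℂ) ^ k * (X : ℂ) ^ (-c) := by
    rw [sub_eq_add_neg, Complex.cpow_add _ _ hX0, Complex.cpow_natCast]
  have hG : Complex.Gamma (k + (boolSign b * ν / 2 - c) + 1) *
        Complex.Gamma (k + (-(boolSign b * ν / 2) - c) + 1) =
      Complex.Gamma (k - c + ν / 2 + 1) * Complex.Gamma (k - c - ν / 2 + 1) := by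
    cases b
    · simp only [boolSign_false]
      rw [mul_comm]
      congr 2 <;> ring
    · simp only [boolSign_true]
      congr 2 <;> ring
  rw [mul_assoc (k.factorial * _ : ℂ), hG]
  simp only [scaledMellin]
  rw [cos_pi_mul_sub_natCast, hx]
  calc _ = ((-1) ^ k * Ring.choose (c - 1 - besselExp ν (b, n)) k) *
      ((X : ℂ) ^ k * (X : ℂ) ^ (-c)) *
      (Complex.Gamma (c - k + ν / 2) * Complex.Gamma (c - k - ν / 2) *
        (Complex.cos (Real.pi * c) - Complex.cos (Real.pi * ν / 2))) := by ring
    _ = _ := by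
      rw [hch, key, show (k - (c - 1 - besselExp ν (b, n)) : ℂ) =
        k + n + (boolSign b * ν / 2 - c) + 1 by rw [besselExp]; ring,
        show (-(c - 1 - besselExp ν (b, n)) : ℂ) = n + (boolSign b * ν / 2 - c) + 1 by
          rw [besselExp]; ring]
      ring

/-- The common constant in the expansion of the Bessel integrals into `J_{w_l}` series. -/
noncomputable def wlConst (c ν : ℂ) : ℂ :=
  Real.pi ^ 3 / (4 * Complex.sin (Real.pi * ν / 2) * (Complex.cos (Real.pi / 2 * (c + ν / 2)) *
    Complex.cos (Real.pi / 2 * (c - ν / 2))))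

lemma cpow_besselExp (ν : ℂ) {X : ℝ} (hX : 0 < X) (b : Bool) (n : ℕ) :
    (X : ℂ) ^ besselExp ν (b, n) = (X : ℂ) ^ n * (X : ℂ) ^ (boolSign b * ν / 2) := by
  have hX0 : (X : ℂ) ≠ 0 := by exact_mod_cast hX.ne'
  rw [besselExp, Complex.cpow_add _ _ hX0, Complex.cpow_natCast]

lemma scaledCoeff_mul_tail_left {c ν : ℂ} {a b d : ℂ} (s : Bool) (h1 : (c + ν / 2).im ≠ 0)
    (h2 : (c - ν / 2).im ≠ 0) {X Y : ℝ} (hX : 0 < X) (hY : 0 < Y)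
    (hp : a - d = boolSign s * ν / 2 - c) (hq : b - d = -(boolSign s * ν / 2) - c)
    (hr : a - b = boolSign s * ν) (n k : ℕ) :
    scaledCoeff ν (-1) Y (s, n) * Ring.choose (c - 1 - besselExp ν (s, n)) k *
        scaledMellin ν (fun s => Complex.cos (Real.pi * s)) X c k -
      scaledCoeff ν (-1) Y (s, n) * ((-1) ^ k * Ring.choose (c - 1 - besselExp ν (s, n)) k) *
        scaledMellin ν (fun _ => Complex.cos (Real.pi * ν / 2)) X c k =
    boolSign s * wlConst c ν * (X : ℂ) ^ (-c) * (Y : ℂ) ^ (boolSign s * ν / 2) *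
      wlTerm X (-Y) a b d (k, n) := by
  have key := wlTail_eq s h1 h2 hX n k
  have h3 : ((-Y : ℝ) : ℂ) ^ n = (-1) ^ n * (Y : ℂ) ^ n := by
    rw [Complex.ofReal_neg, neg_pow]
  calc _ = scaledCoeff ν (-1) Y (s, n) * (Ring.choose (c - 1 - besselExp ν (s, n)) k *
        scaledMellin ν (fun s => Complex.cos (Real.pi * s)) X c k -
      (-1) ^ k * Ring.choose (c - 1 - besselExp ν (s, n)) k *
        scaledMellin ν (fun _ => Complex.cos (Real.pi * ν / 2)) X c k) := by ring
    _ = _ := by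
      rw [key, wlTerm_eq X (-Y) hp hq hr, h3, scaledCoeff, besselCoeff, cpow_besselExp ν hY,
        wlConst]
      ring_nf

lemma scaledCoeff_mul_tail_right {c ν : ℂ} {a b d : ℂ} (s : Bool) (h1 : (c + ν / 2).im ≠ 0)
    (h2 : (c - ν / 2).im ≠ 0) {X Y : ℝ} (hX : 0 < X) (hY : 0 < Y)
    (hp : a - d = c + boolSign s * ν / 2) (hq : b - d = boolSign s * ν)
    (hr : a - b = c - boolSign s * ν / 2) (m k : ℕ) :
    scaledCoeff ν 1 X (s, m) * Ring.choose (-c - 1 - besselExp ν (s, m)) k *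
        scaledMellin ν (fun _ => Complex.cos (Real.pi * ν / 2)) Y (-c) k -
      scaledCoeff ν 1 X (s, m) * ((-1) ^ k * Ring.choose (-c - 1 - besselExp ν (s, m)) k) *
        scaledMellin ν (fun s => Complex.cos (Real.pi * s)) Y (-c) k =
    -(boolSign s * wlConst c ν * (X : ℂ) ^ (boolSign s * ν / 2) * (Y : ℂ) ^ c *
      wlTerm X (-Y) a b d (m, k)) := by
  have h1' : (-c + ν / 2).im ≠ 0 := by
    rw [show -c + ν / 2 = -(c - ν / 2) by ring, Complex.neg_im]; exact neg_ne_zero.2 h2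
  have h2' : (-c - ν / 2).im ≠ 0 := by
    rw [show -c - ν / 2 = -(c + ν / 2) by ring, Complex.neg_im]; exact neg_ne_zero.2 h1
  have key := wlTail_eq s h1' h2' hY m k
  have h3 : ((-Y : ℝ) : ℂ) ^ k = (-1) ^ k * (Y : ℂ) ^ k := by
    rw [Complex.ofReal_neg, neg_pow]
  have hm := neg_one_pow_mul_self k
  have hc1 : Complex.cos (Real.pi / 2 * (-c + ν / 2)) =
      Complex.cos (Real.pi / 2 * (c - ν / 2)) := by
    rw [← Complex.cos_neg]; congr 1; ring
  have hc2 : Complex.cos (Real.pi / 2 * (-c - ν / 2)) =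
      Complex.cos (Real.pi / 2 * (c + ν / 2)) := by
    rw [← Complex.cos_neg]; congr 1; ring
  rw [hc1, hc2, neg_neg] at key
  calc _ = -(scaledCoeff ν 1 X (s, m) * (-1) ^ k * (Ring.choose (-c - 1 - besselExp ν (s, m)) k *
        scaledMellin ν (fun s => Complex.cos (Real.pi * s)) Y (-c) k -
      (-1) ^ k * Ring.choose (-c - 1 - besselExp ν (s, m)) k *
        scaledMellin ν (fun _ => Complex.cos (Real.pi * ν / 2)) Y (-c) k)) := by
        linear_combination (-(scaledCoeff ν 1 X (s, m)) *
          Ring.choose (-c - 1 - besselExp ν (s, m)) k *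
          scaledMellin ν (fun _ => Complex.cos (Real.pi * ν / 2)) Y (-c) k) * hm
    _ = _ := by
      rw [key, wlTerm_eq X (-Y) hp hq hr, h3, scaledCoeff, besselCoeff, cpow_besselExp ν hX,
        wlConst, one_pow, sub_neg_eq_add, sub_neg_eq_add,
        show (k + m + (boolSign s * ν / 2 + c) + 1 : ℂ) = m + k + (c + boolSign s * ν / 2) + 1 by
          ring,
        show (m + (boolSign s * ν / 2 + c) + 1 : ℂ) = m + (c + boolSign s * ν / 2) + 1 by ring,
        show (k + (boolSign s * ν / 2 + c) + 1 : ℂ) = k + (c + boolSign s * ν / 2) + 1 by ring,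
        show (k + (-(boolSign s * ν / 2) + c) + 1 : ℂ) = k + (c - boolSign s * ν / 2) + 1 by ring]
      ring_nf

lemma inv_Gamma_neg_eq {w : ℂ} (hw : 0 ≤ w.re) :
    (Complex.Gamma (-w))⁻¹ = -(Complex.Gamma (w + 1) * Complex.sin (Real.pi * w) / Real.pi) := by
  have hG : Complex.Gamma (w + 1) ≠ 0 :=
    Complex.Gamma_ne_zero_of_re_pos (by rw [Complex.add_re, Complex.one_re]; linarith)
  have hpi : (Real.pi : ℂ) ≠ 0 := by exact_mod_cast Real.pi_ne_zero
  have h := Complex.Gamma_mul_Gamma_one_sub (-w)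
  rw [show 1 - -w = w + 1 by ring, mul_neg, Complex.sin_neg] at h
  by_cases hs : Complex.sin (Real.pi * w) = 0
  · rw [hs, neg_zero, div_zero] at h
    rw [hs, (mul_eq_zero.1 h).resolve_right hG]
    simp
  · have h0 : Complex.Gamma (-w) = -(Real.pi / (Complex.sin (Real.pi * w) *
        Complex.Gamma (w + 1))) := by
      rw [eq_neg_iff_add_eq_zero]
      rw [div_neg, eq_neg_iff_add_eq_zero] at h
      field_simp at h ⊢
      linear_combination h
    rw [h0, inv_neg, inv_div]
    ring

lemma Gamma_bracket_eq {P Q : ℂ} (hP : P.im ≠ 0) (hQ : Q.im ≠ 0) (hPQ : 0 ≤ (P + Q).re)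
    (m n : ℕ) :
    (-1) ^ (m + n) * (Complex.Gamma (-(m + P)) * Complex.Gamma (m + n + (P + Q) + 1) /
        Complex.Gamma (n + Q + 1)) -
      (-1) ^ n * (Complex.Gamma (-(m + P)) * Complex.Gamma (-(n + Q)) /
        Complex.Gamma (-(m + n + (P + Q)))) +
      Complex.Gamma (-(n + Q)) * Complex.Gamma (m + n + (P + Q) + 1) /
        Complex.Gamma (m + P + 1) =
    -Real.pi * (-1) ^ n * Complex.Gamma (m + n + (P + Q) + 1) /
      (Complex.Gamma (m + P + 1) * Complex.Gamma (n + Q + 1)) *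
      ((Complex.sin (Real.pi * P) + Complex.sin (Real.pi * Q) - Complex.sin (Real.pi * (P + Q))) /
        (Complex.sin (Real.pi * P) * Complex.sin (Real.pi * Q))) := by
  have hw : 0 ≤ (m + n + (P + Q) : ℂ).re := by
    rw [show (m + n + (P + Q) : ℂ).re = m + n + (P + Q).re by simp]
    positivity
  have sP := sin_pi_mul_ne_zero_of_im hP
  have sQ := sin_pi_mul_ne_zero_of_im hQ
  have gP := Gamma_natCast_add_add_one_ne_zero_of_im hP m
  have gQ := Gamma_natCast_add_add_one_ne_zero_of_im hQ n
  have hpi : (Real.pi : ℂ) ≠ 0 := by exact_mod_cast Real.pi_ne_zero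
  have hs : Complex.sin (Real.pi * (m + n + (P + Q))) =
      (-1) ^ m * (-1) ^ n * Complex.sin (Real.pi * (P + Q)) := by
    have := sin_pi_mul_natCast_add (m + n) (P + Q)
    rw [pow_add, Nat.cast_add] at this
    exact this
  rw [div_eq_mul_inv _ (Complex.Gamma (-(m + n + (P + Q)))), inv_Gamma_neg_eq hw, hs,
    Gamma_neg_eq_of_im hP, Gamma_neg_eq_of_im hQ, pow_add]
  have hm : ((-1 : ℂ) ^ m) ^ 2 = 1 := by rw [sq, neg_one_pow_mul_self m]
  have hn : ((-1 : ℂ) ^ n) ^ 2 = 1 := by rw [sq, neg_one_pow_mul_self n]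
  generalize (-1 : ℂ) ^ m = e at *
  generalize (-1 : ℂ) ^ n = f at *
  generalize Complex.Gamma (m + n + (P + Q) + 1) = G
  generalize Complex.Gamma (m + P + 1) = a at *
  generalize Complex.Gamma (n + Q + 1) = b at *
  generalize Complex.sin (Real.pi * P) = x at *
  generalize Complex.sin (Real.pi * Q) = y at *
  generalize Complex.sin (Real.pi * (P + Q)) = z at *
  field_simp
  rw [hm, hn]
  ring

/-- The combination of the main terms of the four Bessel integrals. -/
noncomputable def wlMain (ν c : ℂ) (X Y : ℝ) (i j : Bool × ℕ) : ℂ :=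
  scaledCoeff ν (-1) Y j * scaledCoeff ν (-1) X i *
      (Complex.Gamma (-c - besselExp ν i) * Complex.Gamma (1 + besselExp ν j + besselExp ν i) /
        Complex.Gamma (1 + besselExp ν j - c)) -
    scaledCoeff ν (-1) Y j * scaledCoeff ν 1 X i *
      halfBeta (-c - besselExp ν i) (c - besselExp ν j) -
    scaledCoeff ν 1 X i * scaledCoeff ν (-1) Y j *
      halfBeta (-(-c) - besselExp ν j) (-c - besselExp ν i) +
    scaledCoeff ν 1 X i * scaledCoeff ν 1 Y j *
      (Complex.Gamma (-(-c) - besselExp ν j) * Complex.Gamma (1 + besselExp ν i + besselExp ν j) /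
        Complex.Gamma (1 + besselExp ν i - -c))

lemma wlMain_eq {ν c : ℂ} (hν : ν.re = 0) (h1 : (c + ν / 2).im ≠ 0)
    (h2 : (c - ν / 2).im ≠ 0) {X Y : ℝ} (hX : 0 < X) (hY : 0 < Y) (s t : Bool) (m n : ℕ)
    {P Q : ℂ} (hPdef : P = c + boolSign s * ν / 2) (hQdef : Q = boolSign t * ν / 2 - c) :
    wlMain ν c X Y (s, m) (t, n) =
      boolSign s * boolSign t * (Real.pi / (2 * Complex.sin (Real.pi * ν / 2))) ^ 2 *
      ((X : ℂ) ^ m * (X : ℂ) ^ (boolSign s * ν / 2)) *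
      ((Y : ℂ) ^ n * (Y : ℂ) ^ (boolSign t * ν / 2)) /
      (m.factorial * n.factorial * Complex.Gamma (m + boolSign s * ν + 1) *
        Complex.Gamma (n + boolSign t * ν + 1)) *
      (-Real.pi * (-1) ^ n * Complex.Gamma (m + n + (P + Q) + 1) /
      (Complex.Gamma (m + P + 1) * Complex.Gamma (n + Q + 1)) *
      ((Complex.sin (Real.pi * P) + Complex.sin (Real.pi * Q) - Complex.sin (Real.pi * (P + Q))) /
        (Complex.sin (Real.pi * P) * Complex.sin (Real.pi * Q)))) := by
  have hP : P.im ≠ 0 := by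
    rw [hPdef]
    cases s
    · simpa [sub_eq_add_neg, neg_div] using h2
    · simpa using h1
  have hQ : Q.im ≠ 0 := by
    rw [hQdef]
    cases t
    · intro h
      simp [neg_div] at h h1
      exact h1 (by linarith)
    · intro h
      simp at h h2
      exact h2 (by linarith)
  have hPQ : 0 ≤ (P + Q).re := by
    rw [show P + Q = boolSign s * ν / 2 + boolSign t * ν / 2 by rw [hPdef, hQdef]; ring]
    cases s <;> cases t <;> simp [hν]
  have hadd := halfBeta_add (p := -(m + P)) (q := -(n + Q)) (by simpa using hP) (by simpa using hQ)
  rw [show -(m + P) + -(n + Q) = -(m + n + (P + Q)) by ring] at hadd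
  rw [← Gamma_bracket_eq hP hQ hPQ, ← hadd]
  have e1 : -c - besselExp ν (s, m) = -(m + P) := by rw [besselExp, hPdef]; ring
  have e2 : c - besselExp ν (t, n) = -(n + Q) := by rw [besselExp, hQdef]; ring
  have e3 : 1 + besselExp ν (t, n) + besselExp ν (s, m) = m + n + (P + Q) + 1 := by
    rw [besselExp, besselExp, hPdef, hQdef]; ring
  have e4 : 1 + besselExp ν (s, m) + besselExp ν (t, n) = m + n + (P + Q) + 1 := by
    rw [← e3]; ring
  have e5 : 1 + besselExp ν (t, n) - c = n + Q + 1 := by rw [besselExp, hQdef]; ring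
  have e6 : 1 + besselExp ν (s, m) - -c = m + P + 1 := by rw [besselExp, hPdef]; ring
  rw [wlMain, neg_neg, e1, e2, e3, e4, e5, e6]
  simp only [scaledCoeff, besselCoeff, cpow_besselExp ν hX, cpow_besselExp ν hY, one_pow, pow_add]
  have hm := neg_one_pow_mul_self m
  generalize Complex.Gamma (-(m + P)) = a
  generalize Complex.Gamma (-(n + Q)) = b
  generalize Complex.Gamma (m + n + (P + Q) + 1) = G
  generalize Complex.Gamma (m + P + 1) = x
  generalize Complex.Gamma (n + Q + 1) = y
  generalize halfBeta (-(m + P)) (-(n + Q)) = u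
  generalize halfBeta (-(n + Q)) (-(m + P)) = v
  generalize Real.pi / (2 * Complex.sin (Real.pi * ν / 2)) = κ
  generalize (X : ℂ) ^ (boolSign s * ν / 2) = X'
  generalize (Y : ℂ) ^ (boolSign t * ν / 2) = Y'
  generalize Complex.Gamma (m + boolSign s * ν + 1) = A
  generalize Complex.Gamma (n + boolSign t * ν + 1) = B
  ring

lemma sin_add_sin_sub_sin (x y : ℂ) : Complex.sin (2 * x) + Complex.sin (2 * y) -
    Complex.sin (2 * (x + y)) = 4 * Complex.sin x * Complex.sin y * Complex.sin (x + y) := by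
  rw [Complex.sin_two_mul, Complex.sin_two_mul, Complex.sin_two_mul, Complex.sin_add,
    Complex.cos_add]
  have hx := Complex.sin_sq_add_cos_sq x
  have hy := Complex.sin_sq_add_cos_sq y
  linear_combination (-2 * Complex.sin x * Complex.cos x) * hy -
    2 * Complex.sin y * Complex.cos y * hx

lemma wlMain_eq_zero {ν c : ℂ} (hν : ν.re = 0) (h1 : (c + ν / 2).im ≠ 0)
    (h2 : (c - ν / 2).im ≠ 0) {X Y : ℝ} (hX : 0 < X) (hY : 0 < Y) (s : Bool) (m n : ℕ) :
    wlMain ν c X Y (s, m) (!s, n) = 0 := by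
  rw [wlMain_eq hν h1 h2 hX hY s (!s) m n rfl rfl]
  have : boolSign (!s) = -boolSign s := by cases s <;> simp
  rw [this, show (-boolSign s * ν / 2 - c : ℂ) = -(c + boolSign s * ν / 2) by ring,
    mul_neg (Real.pi : ℂ), Complex.sin_neg, add_neg_cancel, add_neg_cancel, mul_zero, Complex.sin_zero, sub_zero,
    zero_div, mul_zero, mul_zero]

lemma wlMain_eq_wlTerm {ν c : ℂ} (hν : ν.re = 0) (hν' : ν.im ≠ 0) (h1 : (c + ν / 2).im ≠ 0)
    (h2 : (c - ν / 2).im ≠ 0) {X Y : ℝ} (hX : 0 < X) (hY : 0 < Y) {a b d : ℂ} (s : Bool)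
    (hp : a - d = boolSign s * ν) (hq : b - d = c + boolSign s * ν / 2)
    (hr : a - b = boolSign s * ν / 2 - c) (m n : ℕ) :
    wlMain ν c X Y (s, m) (s, n) =
      -(boolSign s * wlConst c ν * (X : ℂ) ^ (boolSign s * ν / 2) *
        (Y : ℂ) ^ (boolSign s * ν / 2) * wlTerm X (-Y) a b d (m, n)) := by
  have hP : (c + boolSign s * ν / 2).im ≠ 0 := by
    cases s
    · simpa [sub_eq_add_neg, neg_div] using h2
    · simpa using h1
  have hQ : (boolSign s * ν / 2 - c).im ≠ 0 := by
    cases s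
    · intro h
      simp [neg_div] at h h1
      exact h1 (by linarith)
    · intro h
      simp at h h2
      exact h2 (by linarith)
  rw [wlMain_eq hν h1 h2 hX hY s s m n rfl rfl, wlTerm_eq X (-Y) hp hq hr]
  have h3 : ((-Y : ℝ) : ℂ) ^ n = (-1) ^ n * (Y : ℂ) ^ n := by
    rw [Complex.ofReal_neg, neg_pow]
  have hs := sin_add_sin_sub_sin (Real.pi * (c + boolSign s * ν / 2) / 2)
    (Real.pi * (boolSign s * ν / 2 - c) / 2)
  rw [← add_div, ← mul_add, mul_div_cancel₀ _ two_ne_zero, mul_div_cancel₀ _ two_ne_zero,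
    mul_div_cancel₀ _ two_ne_zero] at hs
  have sP := sin_pi_mul_ne_zero_of_im hP
  have sQ := sin_pi_mul_ne_zero_of_im hQ
  have hν2 : Complex.sin (Real.pi * ν / 2) ≠ 0 := by
    have := sin_pi_mul_ne_zero_of_im (z := ν / 2) (by simpa using hν')
    rwa [← mul_div_assoc] at this
  have hsν : Complex.sin (Real.pi * (boolSign s * ν) / 2) =
      boolSign s * Complex.sin (Real.pi * ν / 2) := by
    cases s
    · rw [boolSign_false, neg_one_mul, neg_one_mul, ← Complex.sin_neg]
      congr 1; ring
    · simp
  have hcc : Complex.cos (Real.pi * (c + boolSign s * ν / 2) / 2) *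
        Complex.cos (Real.pi * (boolSign s * ν / 2 - c) / 2) =
      Complex.cos (Real.pi / 2 * (c + ν / 2)) * Complex.cos (Real.pi / 2 * (c - ν / 2)) := by
    cases s
    · rw [boolSign_false, mul_comm, ← Complex.cos_neg]
      congr 2 <;> ring
    · rw [boolSign_true, ← Complex.cos_neg (Real.pi * (1 * ν / 2 - c) / 2)]
      congr 2 <;> ring
  rw [hs, h3, wlConst, ← hcc]
  rw [show c + boolSign s * ν / 2 + (boolSign s * ν / 2 - c) = boolSign s * ν by ring, hsν]
  rw [sin_pi_mul_eq_two_mul] at sP sQ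
  rw [sin_pi_mul_eq_two_mul (c + boolSign s * ν / 2),
    sin_pi_mul_eq_two_mul (boolSign s * ν / 2 - c)]
  have hb : boolSign s * boolSign s = (1 : ℂ) := by cases s <;> simp
  generalize Complex.sin (Real.pi * ν / 2) = S at *
  generalize Complex.sin (Real.pi * (c + boolSign s * ν / 2) / 2) = x at *
  generalize Complex.cos (Real.pi * (c + boolSign s * ν / 2) / 2) = x' at *
  generalize Complex.sin (Real.pi * (boolSign s * ν / 2 - c) / 2) = y at *
  generalize Complex.cos (Real.pi * (boolSign s * ν / 2 - c) / 2) = y' at *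
  have hx : x ≠ 0 := fun h => sP (by rw [h]; ring)
  have hx' : x' ≠ 0 := fun h => sP (by rw [h]; ring)
  have hy : y ≠ 0 := fun h => sQ (by rw [h]; ring)
  have hy' : y' ≠ 0 := fun h => sQ (by rw [h]; ring)
  have hfrac : (4 * x * y * (boolSign s * S)) / (2 * x * x' * (2 * y * y')) =
      boolSign s * S / (x' * y') := by
    field_simp
    ring
  rw [hfrac]
  generalize (X : ℂ) ^ (boolSign s * ν / 2) = X'
  generalize (Y : ℂ) ^ (boolSign s * ν / 2) = Y'
  generalize Complex.Gamma (m + (c + boolSign s * ν / 2) + 1) = A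
  generalize Complex.Gamma (n + (boolSign s * ν / 2 - c) + 1) = B
  generalize Complex.Gamma (m + boolSign s * ν + 1) = A'
  generalize Complex.Gamma (n + boolSign s * ν + 1) = B'
  have hS : S * S⁻¹ ^ 2 = S⁻¹ := by field_simp
  simp only [div_eq_mul_inv, mul_inv, mul_pow]
  linear_combination (-(boolSign s * Real.pi ^ 3 * (2⁻¹) ^ 2 * S * S⁻¹ ^ 2 * X' * Y' * X ^ m * Y ^ n *
    (-1) ^ n * A⁻¹ * B⁻¹ * A'⁻¹ * B'⁻¹ * (m.factorial : ℂ)⁻¹ * (n.factorial : ℂ)⁻¹ *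
    Complex.Gamma (m + n + boolSign s * ν + 1) * x'⁻¹ * y'⁻¹)) * hb -
    (boolSign s * Real.pi ^ 3 * 4⁻¹ * X' * Y' * X ^ m * Y ^ n *
    (-1) ^ n * A⁻¹ * B⁻¹ * A'⁻¹ * B'⁻¹ * (m.factorial : ℂ)⁻¹ * (n.factorial : ℂ)⁻¹ *
    Complex.Gamma (m + n + boolSign s * ν + 1) * x'⁻¹ * y'⁻¹) * hS

lemma tsum_bool_nat_nat {f : (Bool × ℕ) × ℕ → ℂ} (hf : Summable f) :
    ∑' x, f x = ∑' p : ℕ × ℕ, f ((true, p.1), p.2) + ∑' p : ℕ × ℕ, f ((false, p.1), p.2) := by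
  have hf' := (Equiv.prodAssoc Bool ℕ ℕ).symm.summable_iff.2 hf
  rw [← (Equiv.prodAssoc Bool ℕ ℕ).symm.tsum_eq f]
  exact (hf'.tsum_prod).trans (by rw [tsum_bool, add_comm]; rfl)

lemma tsum_bool_nat_bool_nat {f : (Bool × ℕ) × (Bool × ℕ) → ℂ} (hf : Summable f)
    (h0 : ∀ s m n, f ((!s, n), (s, m)) = 0) :
    ∑' x, f x = ∑' p : ℕ × ℕ, f ((true, p.1), (true, p.2)) +
      ∑' p : ℕ × ℕ, f ((false, p.1), (false, p.2)) := by
  have hf' := (Equiv.prodProdProdComm Bool Bool ℕ ℕ).summable_iff.2 hf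
  rw [← (Equiv.prodProdProdComm Bool Bool ℕ ℕ).tsum_eq f]
  refine hf'.tsum_prod.trans ?_
  rw [tsum_fintype, Fintype.sum_prod_type]
  have h1 : ∀ p : ℕ × ℕ, f ((true, p.1), (false, p.2)) = 0 := fun p => h0 false p.2 p.1
  have h2 : ∀ p : ℕ × ℕ, f ((false, p.1), (true, p.2)) = 0 := fun p => h0 true p.2 p.1
  simp [Equiv.prodProdProdComm, h1, h2]

/-- The power series defining `J_{w_l}`. -/
noncomputable def wlSum (X Z : ℝ) (a b d : ℂ) : ℂ := ∑' n : ℕ × ℕ, wlTerm X Z a b d n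

lemma tsum_wlTerm_swap (X Z : ℝ) (a b d : ℂ) :
    ∑' p : ℕ × ℕ, wlTerm X Z a b d (p.2, p.1) = wlSum X Z a b d :=
  (Equiv.prodComm ℕ ℕ).tsum_eq (wlTerm X Z a b d)

/-- The value of the combination of Bessel integrals away from the resonances. -/
theorem integral_conv_combination_eq {ν c : ℂ} {F G : ℝ → ℂ} (hν : ν.re = 0) (hν' : ν.im ≠ 0)
    (hF : BesselKernel ν (-1) (fun s => Complex.cos (Real.pi * s)) F)
    (hG : BesselKernel ν 1 (fun _ => Complex.cos (Real.pi * ν / 2)) G)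
    {X Y : ℝ} (hX : 0 < X) (hY : 0 < Y) (hc : c.re = 0) (h1 : (c + ν / 2).im ≠ 0)
    (h2 : (c - ν / 2).im ≠ 0) {μ₁ μ₂ μ₃ : ℂ} (hsum : μ₁ + μ₂ + μ₃ = 0) (hνμ : ν = μ₁ - μ₂)
    (hcμ : c = 3 * μ₃ / 2) :
    (∫ x in Ioi (0 : ℝ), convAdd F F X Y c x) - (∫ x in Ioc (0 : ℝ) (1 / 2), convSub G F X Y c x) -
      (∫ x in Ioc (0 : ℝ) (1 / 2), convSub F G Y X (-c) x) +
      (∫ x in Ioi (0 : ℝ), convAdd G G Y X (-c) x) =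
    wlConst c ν * ((X : ℂ) ^ (-c) * (Y : ℂ) ^ (ν / 2) * wlSum X (-Y) μ₁ μ₂ μ₃ -
      (X : ℂ) ^ (-c) * (Y : ℂ) ^ (-(ν / 2)) * wlSum X (-Y) μ₂ μ₁ μ₃ -
      (X : ℂ) ^ (ν / 2) * (Y : ℂ) ^ c * wlSum X (-Y) μ₃ μ₁ μ₂ +
      (X : ℂ) ^ (-(ν / 2)) * (Y : ℂ) ^ c * wlSum X (-Y) μ₃ μ₂ μ₁ -
      (X : ℂ) ^ (ν / 2) * (Y : ℂ) ^ (ν / 2) * wlSum X (-Y) μ₁ μ₃ μ₂ +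
      (X : ℂ) ^ (-(ν / 2)) * (Y : ℂ) ^ (-(ν / 2)) * wlSum X (-Y) μ₂ μ₃ μ₁) := by
  have hw1 : Differentiable ℂ fun s : ℂ => Complex.cos (Real.pi * s) := by fun_prop
  have hw2 : Differentiable ℂ fun _ : ℂ => Complex.cos (Real.pi * ν / 2) := by fun_prop
  have hc' : (-c).re = 0 := by rw [Complex.neg_re, hc, neg_zero]
  have h1' : (-c + ν / 2).im ≠ 0 := by
    rw [show -c + ν / 2 = -(c - ν / 2) by ring, Complex.neg_im]; exact neg_ne_zero.2 h2
  have h2' : (-c - ν / 2).im ≠ 0 := by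
    rw [show -c - ν / 2 = -(c + ν / 2) by ring, Complex.neg_im]; exact neg_ne_zero.2 h1
  have n1 : ‖(-1 : ℂ)‖ ≤ 1 := by simp
  have n2 : ‖(1 : ℂ)‖ ≤ 1 := by simp
  obtain ⟨a2, b2, e2⟩ := integral_convAdd_eq hν n1 n1 hF hF hw1 hX hY hc h1 h2
  obtain ⟨a3, b3, e3⟩ := integral_convSub_eq hν n2 n1 hG hF hw2 hX hY hc h1 h2
  obtain ⟨a3', b3', e3'⟩ := integral_convSub_eq hν n1 n2 hF hG hw1 hY hX hc' h1' h2'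
  obtain ⟨a4, b4, e4⟩ := integral_convAdd_eq hν n2 n2 hG hG hw2 hY hX hc' h1' h2'
  have tA := (a2.tsum_sub a3).symm.trans (tsum_bool_nat_nat (a2.sub a3))
  have tB := (a4.tsum_sub a3').symm.trans (tsum_bool_nat_nat (a4.sub a3'))
  have tC1 := b2.tsum_sub b3
  have tC2 := b4.tsum_sub b3'
  have sC := (b2.sub b3).add ((Equiv.prodComm _ _).summable_iff.2 (b4.sub b3'))
  have tC3 := ((b2.sub b3).tsum_add ((Equiv.prodComm _ _).summable_iff.2 (b4.sub b3')))
  have tC4 := (Equiv.prodComm (Bool × ℕ) (Bool × ℕ)).tsum_eq (fun ji =>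
    scaledCoeff ν 1 X ji.1 * scaledCoeff ν 1 Y ji.2 *
      (Complex.Gamma (-(-c) - besselExp ν ji.2) *
        Complex.Gamma (1 + besselExp ν ji.1 + besselExp ν ji.2) /
        Complex.Gamma (1 + besselExp ν ji.1 - -c)) -
    scaledCoeff ν 1 X ji.1 * scaledCoeff ν (-1) Y ji.2 *
      halfBeta (-(-c) - besselExp ν ji.2) (-c - besselExp ν ji.1))
  have hfun : (fun ji : (Bool × ℕ) × (Bool × ℕ) => wlMain ν c X Y ji.2 ji.1) = fun ji =>
      (scaledCoeff ν (-1) Y ji.1 * scaledCoeff ν (-1) X ji.2 *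
        (Complex.Gamma (-c - besselExp ν ji.2) *
          Complex.Gamma (1 + besselExp ν ji.1 + besselExp ν ji.2) /
          Complex.Gamma (1 + besselExp ν ji.1 - c)) -
      scaledCoeff ν (-1) Y ji.1 * scaledCoeff ν 1 X ji.2 *
        halfBeta (-c - besselExp ν ji.2) (c - besselExp ν ji.1)) +
      ((fun ji : (Bool × ℕ) × (Bool × ℕ) => scaledCoeff ν 1 X ji.1 * scaledCoeff ν 1 Y ji.2 *
      (Complex.Gamma (-(-c) - besselExp ν ji.2) *
        Complex.Gamma (1 + besselExp ν ji.1 + besselExp ν ji.2) /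
        Complex.Gamma (1 + besselExp ν ji.1 - -c)) -
    scaledCoeff ν 1 X ji.1 * scaledCoeff ν (-1) Y ji.2 *
      halfBeta (-(-c) - besselExp ν ji.2) (-c - besselExp ν ji.1)) ∘ Equiv.prodComm _ _) ji := by
    funext ji
    simp only [wlMain, Function.comp_apply, Equiv.prodComm_apply, Prod.fst_swap, Prod.snd_swap]
    ring
  have sC' : Summable fun ji : (Bool × ℕ) × (Bool × ℕ) => wlMain ν c X Y ji.2 ji.1 := by
    rw [hfun]; exact sC
  have tC := tsum_bool_nat_bool_nat sC' fun s m n => by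
    exact wlMain_eq_zero hν h1 h2 hX hY s m n
  have tC0 := (tsum_congr (congrFun hfun)).trans (tC3.trans (congrArg _ tC4))
  have μe : μ₁ = -μ₂ - μ₃ := by linear_combination hsum
  have A1 := fun n k => scaledCoeff_mul_tail_left (a := μ₁) (b := μ₂) (d := μ₃) true h1 h2 hX hY
    (by rw [boolSign_true, hνμ, hcμ, μe]; ring) (by rw [boolSign_true, hνμ, hcμ, μe]; ring)
    (by rw [boolSign_true, hνμ, μe]; ring) n k
  have A2 := fun n k => scaledCoeff_mul_tail_left (a := μ₂) (b := μ₁) (d := μ₃) false h1 h2 hX hY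
    (by rw [boolSign_false, hνμ, hcμ, μe]; ring) (by rw [boolSign_false, hνμ, hcμ, μe]; ring)
    (by rw [boolSign_false, hνμ, μe]; ring) n k
  have B1 := fun m k => scaledCoeff_mul_tail_right (a := μ₃) (b := μ₁) (d := μ₂) true h1 h2 hX hY
    (by rw [boolSign_true, hνμ, hcμ, μe]; ring) (by rw [boolSign_true, hνμ, μe]; ring)
    (by rw [boolSign_true, hνμ, hcμ, μe]; ring) m k
  have B2 := fun m k => scaledCoeff_mul_tail_right (a := μ₃) (b := μ₂) (d := μ₁) false h1 h2 hX hY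
    (by rw [boolSign_false, hνμ, hcμ, μe]; ring) (by rw [boolSign_false, hνμ, μe]; ring)
    (by rw [boolSign_false, hνμ, hcμ, μe]; ring) m k
  have C1 := fun m n => wlMain_eq_wlTerm (a := μ₁) (b := μ₃) (d := μ₂) hν hν' h1 h2 hX hY true
    (by rw [boolSign_true, hνμ, μe]; ring) (by rw [boolSign_true, hνμ, hcμ, μe]; ring)
    (by rw [boolSign_true, hνμ, hcμ, μe]; ring) m n
  have C2 := fun m n => wlMain_eq_wlTerm (a := μ₂) (b := μ₃) (d := μ₁) hν hν' h1 h2 hX hY false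
    (by rw [boolSign_false, hνμ, μe]; ring) (by rw [boolSign_false, hνμ, hcμ, μe]; ring)
    (by rw [boolSign_false, hνμ, hcμ, μe]; ring) m n
  simp only [A1, A2, tsum_mul_left, tsum_wlTerm_swap] at tA
  simp only [B1, B2, tsum_neg, tsum_mul_left] at tB
  simp only [C1, C2, tsum_neg, tsum_mul_left, tsum_wlTerm_swap] at tC
  change _ = -(_ * wlSum X (-Y) μ₃ μ₁ μ₂) + -(_ * wlSum X (-Y) μ₃ μ₂ μ₁) at tB
  simp only [boolSign_true, boolSign_false, one_mul, neg_one_mul, neg_div] at tA tB tC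
  rw [e2, e3, e3', e4]
  rw [tC0] at tC
  linear_combination tA + tB + tC - tC1 - tC2

lemma Jwl_eq_wlSum {y₁ y₂ : ℝ} (hy₁ : 0 < y₁) (hy₂ : y₂ < 0) (a b d : ℂ) :
    Jwl y₁ y₂ a b d = ((4 * Real.pi ^ 2 * y₁ : ℝ) : ℂ) * ((4 * Real.pi ^ 2 * |y₂| : ℝ) : ℂ) *
      (((4 * Real.pi ^ 2 * y₁ : ℝ) : ℂ) ^ (-d) * ((4 * Real.pi ^ 2 * |y₂| : ℝ) : ℂ) ^ a *
      wlSum (4 * Real.pi ^ 2 * y₁) (-(4 * Real.pi ^ 2 * |y₂|)) a b d) := by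
  have hX : 0 < 4 * Real.pi ^ 2 * y₁ := by positivity
  have hY : 0 < 4 * Real.pi ^ 2 * |y₂| := mul_pos (by positivity) (abs_pos.2 hy₂.ne)
  have hX0 : ((4 * Real.pi ^ 2 * y₁ : ℝ) : ℂ) ≠ 0 := Complex.ofReal_ne_zero.2 hX.ne'
  have hY0 : ((4 * Real.pi ^ 2 * |y₂| : ℝ) : ℂ) ≠ 0 := Complex.ofReal_ne_zero.2 hY.ne'
  have hy : 4 * Real.pi ^ 2 * y₂ = -(4 * Real.pi ^ 2 * |y₂|) := by rw [abs_of_neg hy₂]; ring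
  rw [Jwl, abs_of_pos hX, hy, abs_neg, abs_of_pos hY, sub_eq_add_neg, Complex.cpow_add _ _ hX0,
    Complex.cpow_add _ _ hY0, Complex.cpow_one, Complex.cpow_one]
  simp only [wlSum, wlTerm]
  ring

/-- The right-hand side as a combination of convolution integrals. -/
lemma calJ_combination_eq {y₁ y₂ : ℝ} {μ₁ μ₂ μ₃ : ℂ} (hν : (μ₁ - μ₂).re = 0)
    (hν' : (μ₁ - μ₂).im ≠ 0) (hc : (3 * μ₃ / 2).re = 0) (hy₁ : 0 < y₁) (hy₂ : y₂ < 0) :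
    calJ2minus y₁ y₂ μ₂ μ₃ μ₁ - calJ3 y₁ y₂ μ₂ μ₃ μ₁ + calJ4 y₁ y₂ μ₂ μ₃ μ₁ =
    ((|y₁ / y₂| : ℝ) : ℂ) ^ (μ₃ / 2) * (1 / 2 *
      ((∫ x in Ioi (0 : ℝ), convAdd (fun x => Jminus (μ₁ - μ₂) √x) (fun x => Jminus (μ₁ - μ₂) √x)
          (4 * Real.pi ^ 2 * y₁) (4 * Real.pi ^ 2 * |y₂|) (3 * μ₃ / 2) x) -
        (∫ x in Ioc (0 : ℝ) (1 / 2), convSub (fun x => Ktilde (μ₁ - μ₂) √x)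
          (fun x => Jminus (μ₁ - μ₂) √x)
          (4 * Real.pi ^ 2 * y₁) (4 * Real.pi ^ 2 * |y₂|) (3 * μ₃ / 2) x) -
        (∫ x in Ioc (0 : ℝ) (1 / 2), convSub (fun x => Jminus (μ₁ - μ₂) √x)
          (fun x => Ktilde (μ₁ - μ₂) √x)
          (4 * Real.pi ^ 2 * |y₂|) (4 * Real.pi ^ 2 * y₁) (-(3 * μ₃ / 2)) x) +
        (∫ x in Ioi (0 : ℝ), convAdd (fun x => Ktilde (μ₁ - μ₂) √x) (fun x => Ktilde (μ₁ - μ₂) √x)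
          (4 * Real.pi ^ 2 * |y₂|) (4 * Real.pi ^ 2 * y₁) (-(3 * μ₃ / 2)) x))) := by
  have hX : 0 < 4 * Real.pi ^ 2 * y₁ := by positivity
  have hY : 0 < 4 * Real.pi ^ 2 * |y₂| := mul_pos (by positivity) (abs_pos.2 hy₂.ne)
  have hJ := besselKernel_Jminus hν hν'
  have hK := besselKernel_Ktilde hν hν'
  have hc' : (-(3 * μ₃ / 2)).re = 0 := by rw [Complex.neg_re, hc, neg_zero]
  have n1 : ‖(-1 : ℂ)‖ ≤ 1 := by simp
  have n2 : ‖(1 : ℂ)‖ ≤ 1 := by simp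
  have h := integral_Ioo_convSub (integrableOn_convSub hν n2 n1 hK hJ hX hY hc)
    (integrableOn_convSub hν n1 n2 hJ hK hY hX hc')
  rw [calJ2minus_eq_convAdd, calJ3_eq_convSub, calJ4_eq_convAdd, abs_of_pos hy₁, h]
  ring

lemma abs_div_cpow_eq {y₁ y₂ : ℝ} (hy₁ : 0 < y₁) (hy₂ : y₂ < 0) (s : ℂ) :
    ((|y₁ / y₂| : ℝ) : ℂ) ^ s = ((4 * Real.pi ^ 2 * y₁ : ℝ) : ℂ) ^ s *
      ((4 * Real.pi ^ 2 * |y₂| : ℝ) : ℂ) ^ (-s) := by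
  have hX : 0 < 4 * Real.pi ^ 2 * y₁ := by positivity
  have hY : 0 < 4 * Real.pi ^ 2 * |y₂| := mul_pos (by positivity) (abs_pos.2 hy₂.ne)
  have : |y₁ / y₂| = 4 * Real.pi ^ 2 * y₁ / (4 * Real.pi ^ 2 * |y₂|) := by
    rw [abs_div, abs_of_pos hy₁, mul_div_mul_left _ _ (by positivity)]
  rw [this, Complex.ofReal_div, Complex.cpow_neg, div_eq_mul_inv, ← Complex.ofReal_inv,
    Complex.mul_cpow_ofReal_nonneg hX.le (inv_pos.2 hY).le, Complex.ofReal_inv, Complex.inv_cpow]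
  rw [Complex.arg_ofReal_of_nonneg hY.le]
  exact Real.pi_pos.ne

theorem K1wl_eq_of_nonresonant {μ₁ μ₂ μ₃ : ℂ} (hsum : μ₁ + μ₂ + μ₃ = 0)
    (hν : (μ₁ - μ₂).re = 0) (hν' : (μ₁ - μ₂).im ≠ 0) (hc : (3 * μ₃ / 2).re = 0)
    (h1 : (μ₃ - μ₂).im ≠ 0) (h2 : (μ₃ - μ₁).im ≠ 0)
    {y₁ y₂ : ℝ} (hy₁ : 0 < y₁) (hy₂ : y₂ < 0) :
    K1wl y₁ y₂ μ₁ μ₂ μ₃ / ((8 * |y₁ * y₂| : ℝ) : ℂ) =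
      calJ2minus y₁ y₂ μ₂ μ₃ μ₁ - calJ3 y₁ y₂ μ₂ μ₃ μ₁ + calJ4 y₁ y₂ μ₂ μ₃ μ₁ := by
  have hX : 0 < 4 * Real.pi ^ 2 * y₁ := by positivity
  have hY : 0 < 4 * Real.pi ^ 2 * |y₂| := mul_pos (by positivity) (abs_pos.2 hy₂.ne)
  have hX0 : ((4 * Real.pi ^ 2 * y₁ : ℝ) : ℂ) ≠ 0 := Complex.ofReal_ne_zero.2 hX.ne'
  have hY0 : ((4 * Real.pi ^ 2 * |y₂| : ℝ) : ℂ) ≠ 0 := Complex.ofReal_ne_zero.2 hY.ne'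
  have hpi : (Real.pi : ℂ) ≠ 0 := by exact_mod_cast Real.pi_ne_zero
  have μe : μ₁ = -μ₂ - μ₃ := by linear_combination hsum
  have hcp : 3 * μ₃ / 2 + (μ₁ - μ₂) / 2 = μ₃ - μ₂ := by rw [μe]; ring
  have hcm : 3 * μ₃ / 2 - (μ₁ - μ₂) / 2 = μ₃ - μ₁ := by rw [μe]; ring
  have main := integral_conv_combination_eq hν hν' (besselKernel_Jminus hν hν')
    (besselKernel_Ktilde hν hν') hX hY hc (hcp ▸ h1) (hcm ▸ h2) hsum rfl rfl
  rw [calJ_combination_eq hν hν' hc hy₁ hy₂, main, abs_div_cpow_eq hy₁ hy₂, wlConst, hcp, hcm,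
    K1wl, Jsign, Jsign, Real.sign_of_pos hy₁, Real.sign_of_neg hy₂]
  simp only [Jwl_eq_wlSum hy₁ hy₂]
  have hyy : ((8 * |y₁ * y₂| : ℝ) : ℂ) = ((4 * Real.pi ^ 2 * y₁ : ℝ) : ℂ) *
      ((4 * Real.pi ^ 2 * |y₂| : ℝ) : ℂ) / (2 * Real.pi ^ 4) := by
    rw [abs_mul, abs_of_pos hy₁]
    push_cast
    field_simp
    ring
  rw [hyy]
  have hc1 : Complex.cos (Real.pi / 2 * (μ₁ - μ₃)) = Complex.cos (Real.pi / 2 * (μ₃ - μ₁)) := by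
    rw [← Complex.cos_neg]; congr 1; ring
  have hc2 : Complex.cos (Real.pi / 2 * (μ₂ - μ₃)) = Complex.cos (Real.pi / 2 * (μ₃ - μ₂)) := by
    rw [← Complex.cos_neg]; congr 1; ring
  rw [hc1, hc2, show (Real.pi : ℂ) / 2 * (μ₁ - μ₂) = Real.pi * (μ₁ - μ₂) / 2 by ring]
  have hcx : Complex.cos (Real.pi / 2 * (μ₃ - μ₁)) ≠ 0 := by
    have := cos_pi_mul_ne_zero_of_im (z := (μ₃ - μ₁) / 2) (by simpa using h2)
    rwa [show (Real.pi : ℂ) / 2 * (μ₃ - μ₁) = Real.pi * ((μ₃ - μ₁) / 2) by ring]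
  have hcy : Complex.cos (Real.pi / 2 * (μ₃ - μ₂)) ≠ 0 := by
    have := cos_pi_mul_ne_zero_of_im (z := (μ₃ - μ₂) / 2) (by simpa using h1)
    rwa [show (Real.pi : ℂ) / 2 * (μ₃ - μ₂) = Real.pi * ((μ₃ - μ₂) / 2) by ring]
  have hs : Complex.sin (Real.pi * (μ₁ - μ₂) / 2) ≠ 0 := by
    have := sin_pi_mul_ne_zero_of_im (z := (μ₁ - μ₂) / 2) (by simpa using hν')
    rwa [← mul_div_assoc] at this
  generalize Complex.cos (Real.pi / 2 * (μ₃ - μ₁)) = u at *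
  generalize Complex.cos (Real.pi / 2 * (μ₃ - μ₂)) = v at *
  generalize Complex.sin (Real.pi * (μ₁ - μ₂) / 2) = w at *
  generalize ((4 * Real.pi ^ 2 * y₁ : ℝ) : ℂ) = X at *
  generalize ((4 * Real.pi ^ 2 * |y₂| : ℝ) : ℂ) = Y at *
  have eX3 : X ^ (μ₃ / 2) * X ^ (-(3 * μ₃ / 2)) = X ^ (-μ₃) := by
    rw [← Complex.cpow_add _ _ hX0]; congr 1; ring
  have eX2 : X ^ (μ₃ / 2) * X ^ ((μ₁ - μ₂) / 2) = X ^ (-μ₂) := by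
    rw [← Complex.cpow_add _ _ hX0]; congr 1; rw [μe]; ring
  have eX1 : X ^ (μ₃ / 2) * X ^ (-((μ₁ - μ₂) / 2)) = X ^ (-μ₁) := by
    rw [← Complex.cpow_add _ _ hX0]; congr 1; rw [μe]; ring
  have eY3 : Y ^ (-(μ₃ / 2)) * Y ^ (3 * μ₃ / 2) = Y ^ μ₃ := by
    rw [← Complex.cpow_add _ _ hY0]; congr 1; ring
  have eY1 : Y ^ (-(μ₃ / 2)) * Y ^ ((μ₁ - μ₂) / 2) = Y ^ μ₁ := by
    rw [← Complex.cpow_add _ _ hY0]; congr 1; rw [μe]; ring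
  have eY2 : Y ^ (-(μ₃ / 2)) * Y ^ (-((μ₁ - μ₂) / 2)) = Y ^ μ₂ := by
    rw [← Complex.cpow_add _ _ hY0]; congr 1; rw [μe]; ring
  rw [← eX1, ← eX2, ← eX3, ← eY1, ← eY2, ← eY3]
  generalize X ^ (μ₃ / 2) = X0
  generalize X ^ (-(3 * μ₃ / 2)) = X1
  generalize X ^ ((μ₁ - μ₂) / 2) = X2
  generalize X ^ (-((μ₁ - μ₂) / 2)) = X3
  generalize Y ^ (-(μ₃ / 2)) = Y0
  generalize Y ^ (3 * μ₃ / 2) = Y1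
  generalize Y ^ ((μ₁ - μ₂) / 2) = Y2
  generalize Y ^ (-((μ₁ - μ₂) / 2)) = Y3
  generalize wlSum _ _ μ₁ μ₂ μ₃ = S1
  generalize wlSum _ _ μ₁ μ₃ μ₂ = S2
  generalize wlSum _ _ μ₂ μ₁ μ₃ = S3
  generalize wlSum _ _ μ₂ μ₃ μ₁ = S4
  generalize wlSum _ _ μ₃ μ₁ μ₂ = S5
  generalize wlSum _ _ μ₃ μ₂ μ₁ = S6
  push_cast
  field_simp
  ring

lemma norm_Gamma_le {z : ℂ} (hz : 0 < z.re) : ‖Complex.Gamma z‖ ≤ Real.Gamma z.re := by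
  rw [Complex.Gamma_eq_integral hz, Real.Gamma_eq_integral hz, Complex.GammaIntegral]
  refine (norm_integral_le_integral_norm _).trans_eq
    (setIntegral_congr_fun measurableSet_Ioi fun x hx => ?_)
  rw [norm_mul, Complex.norm_real, Real.norm_of_nonneg (Real.exp_pos _).le,
    Complex.norm_cpow_eq_rpow_re_of_pos hx, Complex.sub_re, Complex.one_re]

lemma norm_Gamma_mul_inv_Gamma_le {z : ℂ} (hz : z.re = 0) (m : ℕ) :
    ‖Complex.Gamma (1 + z) * (Complex.Gamma (m + z + 1))⁻¹‖ ≤ (m.factorial : ℝ)⁻¹ := by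
  have h := factorial_mul_norm_Gamma_le hz m
  have h0 := norm_Gamma_one_add_pos hz
  have hm : (0 : ℝ) < m.factorial := by positivity
  have h1 : 0 < ‖Complex.Gamma (m + z + 1)‖ := lt_of_lt_of_le (by positivity) h
  rw [norm_mul, norm_inv, ← div_eq_mul_inv, div_le_iff₀ h1, inv_mul_eq_div, le_div_iff₀ hm]
  linarith

/-- The factor that makes the terms of the `J_{w_l}` series uniformly bounded. -/
noncomputable def wlNorm (a b d : ℂ) : ℂ :=
  Complex.Gamma (1 + (a - d)) ^ 2 * Complex.Gamma (1 + (b - d)) * Complex.Gamma (1 + (a - b))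

lemma norm_wlNorm_mul_wlTerm_le {X Z : ℝ} {a b d : ℂ} (ha : a.re = 0) (hb : b.re = 0)
    (hd : d.re = 0) (n : ℕ × ℕ) : ‖wlNorm a b d * wlTerm X Z a b d n‖ ≤
      (2 * |X|) ^ n.1 / n.1.factorial * ((2 * |Z|) ^ n.2 / n.2.factorial) := by
  obtain ⟨m, n⟩ := n
  have hp : (a - d).re = 0 := by simp [ha, hd]
  have hq : (b - d).re = 0 := by simp [hb, hd]
  have hr : (a - b).re = 0 := by simp [ha, hb]
  have hm : (1 : ℝ) ≤ m.factorial := by exact_mod_cast m.factorial_pos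
  have hn : (1 : ℝ) ≤ n.factorial := by exact_mod_cast n.factorial_pos
  have hG : ‖Complex.Gamma (m + n + (a - d) + 1)‖ ≤ 2 ^ (m + n) * m.factorial * n.factorial := by
    have hre : (m + n + (a - d) + 1 : ℂ).re = ((m + n : ℕ) : ℝ) + 1 := by
      simp [ha, hd]
    refine (norm_Gamma_le (by rw [hre]; positivity)).trans ?_
    rw [hre, Real.Gamma_nat_eq_factorial]
    have := Nat.add_choose_mul_factorial_mul_factorial m n
    rw [← this]
    push_cast
    gcongr
    exact_mod_cast Nat.choose_le_two_pow (m + n) n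
  have e1 := norm_Gamma_mul_inv_Gamma_le hp m
  have e2 := norm_Gamma_mul_inv_Gamma_le hp n
  have e3 := norm_Gamma_mul_inv_Gamma_le hq m
  have e4 := norm_Gamma_mul_inv_Gamma_le hr n
  have heq : wlNorm a b d * wlTerm X Z a b d (m, n) =
      Complex.Gamma (m + n + (a - d) + 1) * ((X : ℂ) ^ m * (Z : ℂ) ^ n *
      ((m.factorial : ℂ)⁻¹ * (n.factorial : ℂ)⁻¹)) *
      ((Complex.Gamma (1 + (a - d)) * (Complex.Gamma (m + (a - d) + 1))⁻¹) *
      (Complex.Gamma (1 + (a - d)) * (Complex.Gamma (n + (a - d) + 1))⁻¹) *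
      (Complex.Gamma (1 + (b - d)) * (Complex.Gamma (m + (b - d) + 1))⁻¹) *
      (Complex.Gamma (1 + (a - b)) * (Complex.Gamma (n + (a - b) + 1))⁻¹)) := by
    rw [wlTerm_eq X Z rfl rfl rfl, wlNorm, div_eq_mul_inv]
    simp only [mul_inv]
    ring
  rw [heq]
  calc _ ≤ (2 ^ (m + n) * m.factorial * n.factorial : ℝ) * (|X| ^ m * |Z| ^ n *
      ((m.factorial : ℝ)⁻¹ * (n.factorial : ℝ)⁻¹)) *
      ((m.factorial : ℝ)⁻¹ * (n.factorial : ℝ)⁻¹ * (m.factorial : ℝ)⁻¹ * (n.factorial : ℝ)⁻¹) := by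
        have e0 : ‖(X : ℂ) ^ m * (Z : ℂ) ^ n * ((m.factorial : ℂ)⁻¹ * (n.factorial : ℂ)⁻¹)‖ ≤
            |X| ^ m * |Z| ^ n * ((m.factorial : ℝ)⁻¹ * (n.factorial : ℝ)⁻¹) := by
          refine le_of_eq ?_
          simp
        refine (norm_mul_le _ _).trans (mul_le_mul ((norm_mul_le _ _).trans
          (mul_le_mul hG e0 (norm_nonneg _) (by positivity))) ?_ (norm_nonneg _) (by positivity))
        refine (norm_mul_le _ _).trans (mul_le_mul ?_ e4 (norm_nonneg _) (by positivity))
        refine (norm_mul_le _ _).trans (mul_le_mul ?_ e3 (norm_nonneg _) (by positivity))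
        exact (norm_mul_le _ _).trans (mul_le_mul e1 e2 (norm_nonneg _) (by positivity))
    _ = ((2 * |X|) ^ m / m.factorial * ((2 * |Z|) ^ n / n.factorial)) *
      ((m.factorial : ℝ)⁻¹ * (n.factorial : ℝ)⁻¹) := by
        rw [mul_pow, mul_pow, pow_add]
        field_simp
    _ ≤ _ := mul_le_of_le_one_right (by positivity)
        (mul_le_one₀ (inv_le_one_of_one_le₀ hm) (by positivity) (inv_le_one_of_one_le₀ hn))

lemma continuous_Gamma_comp {f : ℝ → ℂ} (hf : Continuous f) (h : ∀ t, 0 < (f t).re) :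
    Continuous fun t => Complex.Gamma (f t) := by
  refine continuous_iff_continuousAt.2 fun t => ?_
  have : DifferentiableAt ℂ Complex.Gamma (f t) := Complex.differentiableAt_Gamma _ fun m hm => by
    have := h t
    rw [hm, Complex.neg_re, Complex.natCast_re] at this
    linarith [(Nat.cast_nonneg m : (0 : ℝ) ≤ m)]
  exact this.continuousAt.comp hf.continuousAt

lemma continuous_wlSum {X Z : ℝ} {a b d : ℝ → ℂ} (ha : Continuous a) (hb : Continuous b)
    (hd : Continuous d) (ha0 : ∀ t, (a t).re = 0) (hb0 : ∀ t, (b t).re = 0)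
    (hd0 : ∀ t, (d t).re = 0) : Continuous fun t => wlSum X Z (a t) (b t) (d t) := by
  have hp : ∀ t, (a t - d t).re = 0 := fun t => by simp [ha0, hd0]
  have hq : ∀ t, (b t - d t).re = 0 := fun t => by simp [hb0, hd0]
  have hr : ∀ t, (a t - b t).re = 0 := fun t => by simp [ha0, hb0]
  have cG : ∀ {z : ℝ → ℂ} (m : ℕ), Continuous z → (∀ t, (z t).re = 0) →
      Continuous fun t => Complex.Gamma (m + z t + 1) := fun m hz hz0 =>
    continuous_Gamma_comp (by fun_prop) fun t => by
      simp only [Complex.add_re, Complex.natCast_re, Complex.one_re, hz0]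
      positivity
  have nG : ∀ {z : ℂ} (m : ℕ), z.re = 0 → Complex.Gamma (m + z + 1) ≠ 0 := fun m hz =>
    Complex.Gamma_ne_zero_of_re_pos (by
      simp only [Complex.add_re, Complex.natCast_re, Complex.one_re, hz]
      positivity)
  have cG1 : ∀ {z : ℝ → ℂ}, Continuous z → (∀ t, (z t).re = 0) →
      Continuous fun t => Complex.Gamma (1 + z t) := fun hz hz0 =>
    continuous_Gamma_comp (by fun_prop) fun t => by simp [hz0]
  have nG1 : ∀ {z : ℂ}, z.re = 0 → Complex.Gamma (1 + z) ≠ 0 := fun hz =>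
    Complex.Gamma_ne_zero_of_re_pos (by simp [hz])
  have hN : Continuous fun t => wlNorm (a t) (b t) (d t) :=
    (((cG1 (ha.sub hd) hp).pow 2).mul (cG1 (hb.sub hd) hq)).mul (cG1 (ha.sub hb) hr)
  have hN0 : ∀ t, wlNorm (a t) (b t) (d t) ≠ 0 := fun t =>
    mul_ne_zero (mul_ne_zero (pow_ne_zero _ (nG1 (hp t))) (nG1 (hq t))) (nG1 (hr t))
  have hT : ∀ n, Continuous fun t => wlTerm X Z (a t) (b t) (d t) n := by
    rintro ⟨m, n⟩
    simp only [fun t => wlTerm_eq X Z (a := a t) (b := b t) (d := d t) rfl rfl rfl m n]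
    have cp := ha.sub hd
    have cq := hb.sub hd
    have cr := ha.sub hb
    have c0 : Continuous fun t => Complex.Gamma (m + n + (a t - d t) + 1) := by
      have := cG (m + n) cp hp
      push_cast at this
      exact this
    refine ((c0.mul continuous_const).mul continuous_const).div
      ((((((cG m cp hp).mul continuous_const).mul (cG m cq hq)).mul (cG n cr hr)).mul
        continuous_const).mul (cG n cp hp)) fun t => ?_
    have fm : (m.factorial : ℂ) ≠ 0 := by exact_mod_cast m.factorial_ne_zero
    have fn : (n.factorial : ℂ) ≠ 0 := by exact_mod_cast n.factorial_ne_zero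
    exact mul_ne_zero (mul_ne_zero (mul_ne_zero (mul_ne_zero (mul_ne_zero (nG m (hp t)) fn)
      (nG m (hq t))) (nG n (hr t))) fm) (nG n (hp t))
  have hs : Summable fun n : ℕ × ℕ =>
      (2 * |X|) ^ n.1 / n.1.factorial * ((2 * |Z|) ^ n.2 / n.2.factorial) :=
    (Real.summable_pow_div_factorial _).mul_of_nonneg (Real.summable_pow_div_factorial _)
      (fun _ => by positivity) (fun _ => by positivity)
  have key : Continuous fun t => ∑' n, wlNorm (a t) (b t) (d t) * wlTerm X Z (a t) (b t) (d t) n :=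
    continuous_tsum (fun n => hN.mul (hT n)) hs fun n t =>
      norm_wlNorm_mul_wlTerm_le (ha0 t) (hb0 t) (hd0 t) n
  have := key.div hN hN0
  refine this.congr fun t => ?_
  change (∑' n, wlNorm (a t) (b t) (d t) * wlTerm X Z (a t) (b t) (d t) n) /
    wlNorm (a t) (b t) (d t) = _
  rw [tsum_mul_left, mul_div_cancel_left₀ _ (hN0 t), wlSum]

lemma continuous_Jwl {y₁ y₂ : ℝ} (hy₁ : 0 < y₁) (hy₂ : y₂ < 0) {a b d : ℝ → ℂ}
    (ha : Continuous a) (hb : Continuous b) (hd : Continuous d) (ha0 : ∀ t, (a t).re = 0)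
    (hb0 : ∀ t, (b t).re = 0) (hd0 : ∀ t, (d t).re = 0) :
    Continuous fun t => Jwl y₁ y₂ (a t) (b t) (d t) := by
  have hX : 0 < 4 * Real.pi ^ 2 * y₁ := by positivity
  have hY : 0 < 4 * Real.pi ^ 2 * |y₂| := mul_pos (by positivity) (abs_pos.2 hy₂.ne)
  simp only [Jwl_eq_wlSum hy₁ hy₂]
  exact continuous_const.mul (((hd.neg.const_cpow (Or.inl (Complex.ofReal_ne_zero.2 hX.ne'))).mul
    (ha.const_cpow (Or.inl (Complex.ofReal_ne_zero.2 hY.ne')))).mul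
    (continuous_wlSum ha hb hd ha0 hb0 hd0))

lemma cos_ne_zero_of_re_eq_zero {z : ℂ} (hz : z.re = 0) : Complex.cos z ≠ 0 := by
  have : z = z.im * Complex.I := by
    apply Complex.ext <;> simp [hz]
  rw [this, Complex.cos_mul_I, ← Complex.ofReal_cosh]
  exact Complex.ofReal_ne_zero.2 (Real.cosh_pos _).ne'

/-- The identity extends to the resonant parameters by continuity in `μ₃` for fixed `μ₁ - μ₂`. -/
theorem K1wl_eq_of_ne {μ₁ μ₂ μ₃ : ℂ} (hsum : μ₁ + μ₂ + μ₃ = 0) (hre₁ : μ₁.re = 0)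
    (hre₂ : μ₂.re = 0) (hre₃ : μ₃.re = 0) (hne : μ₁ ≠ μ₂)
    {y₁ y₂ : ℝ} (hy₁ : 0 < y₁) (hy₂ : y₂ < 0) :
    K1wl y₁ y₂ μ₁ μ₂ μ₃ / ((8 * |y₁ * y₂| : ℝ) : ℂ) =
      calJ2minus y₁ y₂ μ₂ μ₃ μ₁ - calJ3 y₁ y₂ μ₂ μ₃ μ₁ + calJ4 y₁ y₂ μ₂ μ₃ μ₁ := by
  set ν := μ₁ - μ₂ with hνdef
  have hν : ν.re = 0 := by simp [hνdef, hre₁, hre₂]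
  have hν' : ν.im ≠ 0 := fun h => hne (sub_eq_zero.1 (Complex.ext hν h))
  have hX : 0 < 4 * Real.pi ^ 2 * y₁ := by positivity
  have hY : 0 < 4 * Real.pi ^ 2 * |y₂| := mul_pos (by positivity) (abs_pos.2 hy₂.ne)
  let m₁ : ℝ → ℂ := fun t => (ν - Complex.I * t) / 2
  let m₂ : ℝ → ℂ := fun t => (-ν - Complex.I * t) / 2
  let m₃ : ℝ → ℂ := fun t => Complex.I * t
  have c₁ : Continuous m₁ := by fun_prop
  have c₂ : Continuous m₂ := by fun_prop
  have c₃ : Continuous m₃ := by fun_prop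
  have r₁ : ∀ t, (m₁ t).re = 0 := fun t => by simp [m₁, hν]
  have r₂ : ∀ t, (m₂ t).re = 0 := fun t => by simp [m₂, hν]
  have r₃ : ∀ t, (m₃ t).re = 0 := fun t => by simp [m₃]
  have s : ∀ t, m₁ t + m₂ t + m₃ t = 0 := fun t => by simp only [m₁, m₂, m₃]; ring
  have d : ∀ t, m₁ t - m₂ t = ν := fun t => by simp only [m₁, m₂]; ring
  have hcr : ∀ t, (3 * m₃ t / 2).re = 0 := fun t => by simp [m₃]
  have hcr' : ∀ t, (-(3 * m₃ t / 2)).re = 0 := fun t => by simp [m₃]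
  have hL : Continuous fun t => K1wl y₁ y₂ (m₁ t) (m₂ t) (m₃ t) / ((8 * |y₁ * y₂| : ℝ) : ℂ) := by
    simp only [K1wl, Jsign, d]
    have J := fun {a b d : ℝ → ℂ} => continuous_Jwl hy₁ hy₂ (a := a) (b := b) (d := d)
    refine (continuous_const.mul (Continuous.div ?_ ?_ fun t => ?_)).div_const _
    · exact (((continuous_const.mul (J c₁ c₂ c₃ r₁ r₂ r₃)).add
        (continuous_const.mul (J c₃ c₁ c₂ r₃ r₁ r₂))).add
        (continuous_const.mul (J c₂ c₃ c₁ r₂ r₃ r₁))).sub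
        (((continuous_const.mul (J c₂ c₁ c₃ r₂ r₁ r₃)).add
        (continuous_const.mul (J c₃ c₂ c₁ r₃ r₂ r₁))).add
        (continuous_const.mul (J c₁ c₃ c₂ r₁ r₃ r₂)))
    · fun_prop
    · have hs : Complex.sin (Real.pi / 2 * ν) ≠ 0 := by
        have := sin_pi_mul_ne_zero_of_im (z := ν / 2) (by simpa using hν')
        rwa [show (Real.pi : ℂ) / 2 * ν = Real.pi * (ν / 2) by ring]
      have hr : ∀ z : ℂ, z.re = 0 → ((Real.pi : ℂ) / 2 * z).re = 0 := fun z hz => by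
        rw [show (Real.pi : ℂ) / 2 = ((Real.pi / 2 : ℝ) : ℂ) by push_cast; rfl,
          Complex.re_ofReal_mul, hz, mul_zero]
      exact mul_ne_zero (mul_ne_zero
        (cos_ne_zero_of_re_eq_zero (hr _ (by simp [r₁, r₃])))
        (cos_ne_zero_of_re_eq_zero (hr _ (by simp [r₂, r₃])))) hs
  have hR : Continuous fun t => calJ2minus y₁ y₂ (m₂ t) (m₃ t) (m₁ t) -
      calJ3 y₁ y₂ (m₂ t) (m₃ t) (m₁ t) + calJ4 y₁ y₂ (m₂ t) (m₃ t) (m₁ t) := by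
    simp only [fun t => calJ_combination_eq (by rw [d]; exact hν) (by rw [d]; exact hν') (hcr t)
      hy₁ hy₂ (μ₁ := m₁ t) (μ₂ := m₂ t) (μ₃ := m₃ t), d]
    have hJ := besselKernel_Jminus hν hν'
    have hK := besselKernel_Ktilde hν hν'
    have n1 : ‖(-1 : ℂ)‖ ≤ 1 := by simp
    have n2 : ‖(1 : ℂ)‖ ≤ 1 := by simp
    have k₁ : Continuous fun t => 3 * m₃ t / 2 := by fun_prop
    have k₂ : Continuous fun t => -(3 * m₃ t / 2) := by fun_prop
    have hyy : ((|y₁ / y₂| : ℝ) : ℂ) ≠ 0 :=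
      Complex.ofReal_ne_zero.2 (abs_pos.2 (div_ne_zero hy₁.ne' hy₂.ne)).ne'
    exact ((c₃.div_const 2).const_cpow (Or.inl hyy)).mul (continuous_const.mul
      ((((continuous_integral_convAdd hν n1 n1 hJ hJ hX hY k₁ hcr).sub
        (continuous_integral_convSub hν n2 n1 hK hJ hX hY k₁ hcr)).sub
        (continuous_integral_convSub hν n1 n2 hJ hK hY hX k₂ hcr')).add
        (continuous_integral_convAdd hν n2 n2 hK hK hY hX k₂ hcr')))
  have hdense : Dense ({-(ν.im / 3), ν.im / 3}ᶜ : Set ℝ) :=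
    (Set.toFinite {-(ν.im / 3), ν.im / 3}).countable.dense_compl ℝ
  have hEq := Continuous.ext_on hdense hL hR fun t ht => by
    rw [mem_compl_iff, mem_insert_iff, mem_singleton_iff, not_or] at ht
    refine K1wl_eq_of_nonresonant (s t) (by rw [d]; exact hν) (by rw [d]; exact hν') (hcr t)
      (fun h => ht.1 ?_) (fun h => ht.2 ?_) hy₁ hy₂
    · simp [m₃, m₂] at h
      linarith
    · simp [m₃, m₁] at h
      linarith
  have h₃ : m₃ μ₃.im = μ₃ := by apply Complex.ext <;> simp [m₃, hre₃]
  have h₁ : m₁ μ₃.im = μ₁ := by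
    change (ν - m₃ μ₃.im) / 2 = μ₁
    rw [h₃]
    linear_combination (-1 / 2 : ℂ) * hsum
  have h₂ : m₂ μ₃.im = μ₂ := by
    change (-ν - m₃ μ₃.im) / 2 = μ₂
    rw [h₃]
    linear_combination (-1 / 2 : ℂ) * hsum
  have := congrFun hEq μ₃.im
  simpa only [h₁, h₂, h₃] using this

end

/-- The double-Bessel integral representation of `K¹_{w_l}` in the sign case `(+,−)`. -/
theorem stmt15 (μ₁ μ₂ μ₃ : ℂ) (hsum : μ₁ + μ₂ + μ₃ = 0)
    (hre₁ : μ₁.re = 0) (hre₂ : μ₂.re = 0) (hre₃ : μ₃.re = 0) (hne : μ₁ ≠ μ₂)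
    (y₁ y₂ : ℝ) (hy₁ : 0 < y₁) (hy₂ : y₂ < 0) :
    K1wl y₁ y₂ μ₁ μ₂ μ₃ / ((8 * |y₁ * y₂| : ℝ) : ℂ) =
      calJ2minus y₁ y₂ μ₂ μ₃ μ₁ - calJ3 y₁ y₂ μ₂ μ₃ μ₁ + calJ4 y₁ y₂ μ₂ μ₃ μ₁ := by
  exact K1wl_eq_of_ne hsum hre₁ hre₂ hre₃ hne hy₁ hy₂
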